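/- There exist constants C, ν₀, ε₁ > 0 depending only on V such that the following holds. Let 0 < ν ≤ ν₀, νk² ≤ sup_{[0,1]}∂_yV, |o(ν,k)| ≤ ε₁(νk²)^{1/3}, let F be continuous on [0,1], and let (w_{Na},φ_{Na}) solve the Orr–Sommerfeld equation with Navier-slip boundary conditions and forcing F. Then (1+|k(λ−V(0))|)^{3/4}|c₁| + (1+|k(λ−V(1))|)^{3/4}|c₂| ≤ C ν^{−1/6}|k|^{−5/6}‖F‖_{L²}, where c₁ = ∫₀¹ (sinh(k(1−y))/sinh k) w_{Na}(y) dy and c₂ = ∫₀¹ (sinh(ky)/sinh k) w_{Na}(y) dy. -/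

import Mathlib

open MeasureTheory Set

noncomputable section

/-- Derivative within the interval `[0,1]` (complex-valued functions). -/
def dI (f : ℝ → ℂ) (y : ℝ) : ℂ := derivWithin f (Set.Icc 0 1) y

/-- Derivative within the interval `[0,1]` (real-valued functions). -/
def dIR (f : ℝ → ℝ) (y : ℝ) : ℝ := derivWithin f (Set.Icc 0 1) y

/-- `L²(0,1)` norm. -/
def L2 (g : ℝ → ℂ) : ℝ := Real.sqrt (∫ y in Set.Ioo (0:ℝ) 1, ‖g y‖ ^ 2)

/-- `H¹_k` norm on `(0,1)`: `‖g‖² = ‖∂_y g‖² + k²‖g‖²`. -/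
def H1k (k : ℤ) (g : ℝ → ℂ) : ℝ :=
  Real.sqrt (∫ y in Set.Ioo (0:ℝ) 1, ‖dI g y‖ ^ 2 + (k : ℝ) ^ 2 * ‖g y‖ ^ 2)

/-- The boundary-layer weight `ρ_k` with parameter `L = ν^{-1/3}|k|^{1/3}`. -/
def rhoW (L y : ℝ) : ℝ :=
  if y ≤ L⁻¹ then L * y else if y ≤ 1 - L⁻¹ then 1 else L * (1 - y)

/-- Weighted `L²` norm `‖ρ_k^{1/2} g‖_{L²}`. -/
def L2rho (L : ℝ) (g : ℝ → ℂ) : ℝ :=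
  Real.sqrt (∫ y in Set.Ioo (0:ℝ) 1, rhoW L y * ‖g y‖ ^ 2)

/-- The shear profile `V ∈ C⁴([0,1])`, strictly monotone with `∂_yV ≥ c₀ > 0`,
and strictly convex or strictly concave on `(0,1)`. -/
def GoodShear (V : ℝ → ℝ) : Prop :=
  ContDiffOn ℝ 4 V (Set.Icc 0 1) ∧
  (∃ c₀ > (0:ℝ), ∀ y ∈ Set.Icc (0:ℝ) 1, c₀ ≤ dIR V y) ∧
  ((∀ y ∈ Set.Ioo (0:ℝ) 1, 0 < dIR (dIR V) y) ∨
    (∀ y ∈ Set.Ioo (0:ℝ) 1, dIR (dIR V) y < 0))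

/-- `sup_{[0,1]} ∂_y V`. -/
def supDV (V : ℝ → ℝ) : ℝ := sSup (dIR V '' Set.Icc 0 1)

/-- `(w,φ)` solves the Orr–Sommerfeld equation with no-slip boundary conditions
and forcing `F`. -/
def OSNoSlip (ν lam : ℝ) (k : ℤ) (o : ℂ) (V : ℝ → ℝ) (w φ F : ℝ → ℂ) : Prop :=
  ContDiffOn ℝ 2 w (Set.Icc 0 1) ∧ ContDiffOn ℝ 2 φ (Set.Icc 0 1) ∧
  (∀ y ∈ Set.Ioo (0:ℝ) 1,
    -(ν : ℂ) * (dI (dI w) y - (k : ℂ) ^ 2 * w y)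
      + Complex.I * (k : ℂ) * ((V y - lam : ℝ) : ℂ) * w y
      - Complex.I * (k : ℂ) * ((dIR (dIR V) y : ℝ) : ℂ) * φ y
      + o * w y = F y) ∧
  (∀ y ∈ Set.Ioo (0:ℝ) 1, dI (dI φ) y - (k : ℂ) ^ 2 * φ y = w y) ∧
  φ 0 = 0 ∧ φ 1 = 0 ∧ dI φ 0 = 0 ∧ dI φ 1 = 0

/-- `(w,φ)` solves the Orr–Sommerfeld equation with Navier-slip boundary conditions
and forcing `F`. -/
def OSNavier (ν lam : ℝ) (k : ℤ) (o : ℂ) (V : ℝ → ℝ) (w φ F : ℝ → ℂ) : Prop :=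
  ContDiffOn ℝ 2 w (Set.Icc 0 1) ∧ ContDiffOn ℝ 2 φ (Set.Icc 0 1) ∧
  (∀ y ∈ Set.Ioo (0:ℝ) 1,
    -(ν : ℂ) * (dI (dI w) y - (k : ℂ) ^ 2 * w y)
      + Complex.I * (k : ℂ) * ((V y - lam : ℝ) : ℂ) * w y
      - Complex.I * (k : ℂ) * ((dIR (dIR V) y : ℝ) : ℂ) * φ y
      + o * w y = F y) ∧
  (∀ y ∈ Set.Ioo (0:ℝ) 1, dI (dI φ) y - (k : ℂ) ^ 2 * φ y = w y) ∧
  φ 0 = 0 ∧ φ 1 = 0 ∧ w 0 = 0 ∧ w 1 = 0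

/-- The `H⁻¹_k` bound hypothesis: `|⟨F,φ⟩| ≤ M ‖φ‖_{H¹_k}` for all `C¹` test
functions vanishing at the endpoints. -/
def Hm1Bound (k : ℤ) (F : ℝ → ℂ) (M : ℝ) : Prop :=
  0 ≤ M ∧ ∀ φ : ℝ → ℂ, ContDiffOn ℝ 1 φ (Set.Icc 0 1) → φ 0 = 0 → φ 1 = 0 →
    ‖∫ y in Set.Ioo (0:ℝ) 1, F y * (starRingEnd ℂ) (φ y)‖ ≤ M * H1k k φ

/-- `L^∞` norm over `[0,1]`. -/
def supI (g : ℝ → ℂ) : ℝ := ⨆ y : Set.Icc (0:ℝ) 1, ‖g (y : ℝ)‖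

/-- The set `E_δ = {y ∈ [0,1] : λ - δ < V(y) < λ + δ}`. -/
def ED (V : ℝ → ℝ) (lam δ : ℝ) : Set ℝ :=
  {y | y ∈ Set.Icc (0:ℝ) 1 ∧ lam - δ < V y ∧ V y < lam + δ}

/-- The cutoff function `χ_δ`. -/
def chiD (V : ℝ → ℝ) (lam δ : ℝ) (y : ℝ) : ℝ :=
  if lam - δ < V y ∧ V y < lam + δ then
    2 * (V y - lam) ^ 2 / δ ^ 2 - (V y - lam) ^ 4 / δ ^ 4
  else 1

/-- The function `f · χ_δ / (V - λ)`. -/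
def chiQuot (V : ℝ → ℝ) (lam δ : ℝ) (f : ℝ → ℂ) : ℝ → ℂ :=
  fun y => f y * ((chiD V lam δ y / (V y - lam) : ℝ) : ℂ)

/-- The coefficient `c₁ = ∫₀¹ sinh(k(1-y))/sinh(k) · w(y) dy`. -/
def coefA (k : ℤ) (w : ℝ → ℂ) : ℂ :=
  ∫ y in Set.Ioo (0:ℝ) 1,
    ((Real.sinh ((k : ℝ) * (1 - y)) / Real.sinh (k : ℝ) : ℝ) : ℂ) * w y

/-- The coefficient `c₂ = ∫₀¹ sinh(ky)/sinh(k) · w(y) dy`. -/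
def coefB (k : ℤ) (w : ℝ → ℂ) : ℂ :=
  ∫ y in Set.Ioo (0:ℝ) 1,
    ((Real.sinh ((k : ℝ) * y) / Real.sinh (k : ℝ) : ℝ) : ℂ) * w y

/-- `L²(0,1)` norm with interval integrals. -/
def nr (g : ℝ → ℂ) : ℝ := Real.sqrt (∫ y in (0:ℝ)..1, ‖g y‖ ^ 2)

lemma nr_nonneg (g : ℝ → ℂ) : 0 ≤ nr g := Real.sqrt_nonneg _

lemma nr_sq (g : ℝ → ℂ) : nr g ^ 2 = ∫ y in (0:ℝ)..1, ‖g y‖ ^ 2 := by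
  unfold nr
  rw [Real.sq_sqrt]
  exact intervalIntegral.integral_nonneg (by norm_num) (fun y _ => by positivity)

lemma ii_of_cont {E : Type*} [NormedAddCommGroup E] {g : ℝ → E}
    (hg : ContinuousOn g (Icc 0 1)) : IntervalIntegrable g volume 0 1 := by
  apply ContinuousOn.intervalIntegrable
  rwa [uIcc_of_le (by norm_num)]

lemma cs (g h : ℝ → ℂ) (hg : ContinuousOn g (Icc 0 1)) (hh : ContinuousOn h (Icc 0 1)) :
    ∫ y in (0:ℝ)..1, ‖g y‖ * ‖h y‖ ≤ nr g * nr h := by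
  have i1 : IntervalIntegrable (fun y => ‖g y‖ ^ 2) volume 0 1 := ii_of_cont (hg.norm.pow 2)
  have i2 : IntervalIntegrable (fun y => ‖h y‖ ^ 2) volume 0 1 := ii_of_cont (hh.norm.pow 2)
  have i3 : IntervalIntegrable (fun y => ‖g y‖ * ‖h y‖) volume 0 1 :=
    ii_of_cont (hg.norm.mul hh.norm)
  have key : ∀ t : ℝ, 0 ≤ (nr g ^ 2) * (t * t) + (-2 * ∫ y in (0:ℝ)..1, ‖g y‖ * ‖h y‖) * t
      + nr h ^ 2 := by
    intro t
    have : (nr g ^ 2) * (t * t) + (-2 * ∫ y in (0:ℝ)..1, ‖g y‖ * ‖h y‖) * t + nr h ^ 2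
        = ∫ y in (0:ℝ)..1, ((t * t) * ‖g y‖ ^ 2 + (-2 * t) * (‖g y‖ * ‖h y‖) + ‖h y‖ ^ 2) := by
      rw [intervalIntegral.integral_add ((i1.const_mul _).add (i3.const_mul _)) i2,
        intervalIntegral.integral_add (i1.const_mul _) (i3.const_mul _),
        intervalIntegral.integral_const_mul, intervalIntegral.integral_const_mul,
        nr_sq, nr_sq]
      ring
    rw [this]
    apply intervalIntegral.integral_nonneg (by norm_num)
    intro y _
    nlinarith [sq_nonneg (t * ‖g y‖ - ‖h y‖)]
  have := discrim_le_zero key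
  unfold discrim at this
  apply abs_le_of_sq_le_sq' _ (mul_nonneg (nr_nonneg g) (nr_nonneg h)) |>.2
  nlinarith

lemma csb (T g h : ℝ → ℂ) (A : ℝ) (hA : 0 ≤ A) (hg : ContinuousOn g (Icc 0 1))
    (hh : ContinuousOn h (Icc 0 1))
    (hT : ∀ y ∈ Icc (0:ℝ) 1, ‖T y‖ ≤ A * (‖g y‖ * ‖h y‖)) :
    ‖∫ y in (0:ℝ)..1, T y‖ ≤ A * (nr g * nr h) := by
  have i3 : IntervalIntegrable (fun y => A * (‖g y‖ * ‖h y‖)) volume 0 1 :=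
    (ii_of_cont (hg.norm.mul hh.norm)).const_mul A
  calc ‖∫ y in (0:ℝ)..1, T y‖ ≤ ∫ y in (0:ℝ)..1, A * (‖g y‖ * ‖h y‖) := by
        apply intervalIntegral.norm_integral_le_of_norm_le (by norm_num) _ i3
        exact Filter.Eventually.of_forall (fun y hy => hT y ⟨hy.1.le, hy.2⟩)
    _ = A * ∫ y in (0:ℝ)..1, (‖g y‖ * ‖h y‖) := intervalIntegral.integral_const_mul _ _
    _ ≤ _ := mul_le_mul_of_nonneg_left (cs g h hg hh) hA

lemma nr_le (g h : ℝ → ℂ) (A : ℝ) (hA : 0 ≤ A) (hg : ContinuousOn g (Icc 0 1))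
    (hh : ContinuousOn h (Icc 0 1))
    (hT : ∀ y ∈ Icc (0:ℝ) 1, ‖g y‖ ≤ A * ‖h y‖) : nr g ≤ A * nr h := by
  apply abs_le_of_sq_le_sq' _ (mul_nonneg hA (nr_nonneg h)) |>.2
  rw [mul_pow, nr_sq, nr_sq, ← intervalIntegral.integral_const_mul]
  apply intervalIntegral.integral_mono_on (by norm_num) (ii_of_cont (hg.norm.pow 2))
    ((ii_of_cont (hh.norm.pow 2)).const_mul _)
  intro y hy
  show ‖g y‖ ^ 2 ≤ A ^ 2 * ‖h y‖ ^ 2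
  rw [← mul_pow]
  exact pow_le_pow_left₀ (norm_nonneg _) (hT y hy) 2

lemma nr_le_const (g : ℝ → ℂ) (A : ℝ) (hA : 0 ≤ A) (hg : ContinuousOn g (Icc 0 1))
    (hT : ∀ y ∈ Icc (0:ℝ) 1, ‖g y‖ ≤ A) : nr g ≤ A := by
  have h1 : nr (fun _ => (1:ℂ)) = 1 := by simp [nr]
  have := nr_le g (fun _ => 1) A hA hg continuousOn_const (by simpa using hT)
  rwa [h1, mul_one] at this

lemma nr_add (g h : ℝ → ℂ) (hg : ContinuousOn g (Icc 0 1))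
    (hh : ContinuousOn h (Icc 0 1)) : nr (fun y => g y + h y) ≤ nr g + nr h := by
  apply abs_le_of_sq_le_sq' _ (add_nonneg (nr_nonneg g) (nr_nonneg h)) |>.2
  have i1 : IntervalIntegrable (fun y => ‖g y‖ ^ 2) volume 0 1 := ii_of_cont (hg.norm.pow 2)
  have i2 : IntervalIntegrable (fun y => ‖h y‖ ^ 2) volume 0 1 := ii_of_cont (hh.norm.pow 2)
  have i3 : IntervalIntegrable (fun y => ‖g y‖ * ‖h y‖) volume 0 1 :=
    ii_of_cont (hg.norm.mul hh.norm)
  have h1 : nr (fun y => g y + h y) ^ 2 ≤ ∫ y in (0:ℝ)..1,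
      (‖g y‖ ^ 2 + 2 * (‖g y‖ * ‖h y‖) + ‖h y‖ ^ 2) := by
    rw [nr_sq]
    apply intervalIntegral.integral_mono_on (by norm_num) (ii_of_cont ((hg.add hh).norm.pow 2))
      ((i1.add (i3.const_mul 2)).add i2)
    intro y _
    have := norm_add_le (g y) (h y)
    show ‖g y + h y‖ ^ 2 ≤ _
    nlinarith [norm_nonneg (g y + h y), norm_nonneg (g y), norm_nonneg (h y)]
  rw [intervalIntegral.integral_add (i1.add (i3.const_mul _)) i2,
        intervalIntegral.integral_add i1 (i3.const_mul _),
        intervalIntegral.integral_const_mul, ← nr_sq, ← nr_sq] at h1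
  nlinarith [cs g h hg hh]

/-- Integration by parts with vanishing boundary terms. -/
lemma ibp (a a1 b b1 : ℝ → ℂ) (ca : ContinuousOn a (Icc 0 1)) (ca1 : ContinuousOn a1 (Icc 0 1))
    (cb : ContinuousOn b (Icc 0 1)) (cb1 : ContinuousOn b1 (Icc 0 1))
    (da : ∀ y ∈ Ioo (0:ℝ) 1, HasDerivAt a (a1 y) y)
    (db : ∀ y ∈ Ioo (0:ℝ) 1, HasDerivAt b (b1 y) y)
    (h0 : a 0 * b 0 = 0) (h1 : a 1 * b 1 = 0) :
    ∫ y in (0:ℝ)..1, a y * b1 y = - ∫ y in (0:ℝ)..1, a1 y * b y := by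
  have i1 : IntervalIntegrable (fun y => a1 y * b y) volume 0 1 := ii_of_cont (ca1.mul cb)
  have i2 : IntervalIntegrable (fun y => a y * b1 y) volume 0 1 := ii_of_cont (ca.mul cb1)
  have := intervalIntegral.integral_eq_sub_of_hasDerivAt_of_le (f := fun y => a y * b y)
    (f' := fun y => a1 y * b y + a y * b1 y) (by norm_num : (0:ℝ) ≤ 1) (ca.mul cb)
    (fun y hy => (da y hy).mul (db y hy)) (i1.add i2)
  rw [intervalIntegral.integral_add i1 i2] at this
  simp only [h0, h1, sub_zero] at this
  linear_combination this

lemma ftc0 (g g1 : ℝ → ℂ) (cg : ContinuousOn g (Icc 0 1)) (cg1 : ContinuousOn g1 (Icc 0 1))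
    (dg : ∀ y ∈ Ioo (0:ℝ) 1, HasDerivAt g (g1 y) y) (x y : ℝ) (hx : x ∈ Icc (0:ℝ) 1)
    (hy : y ∈ Icc (0:ℝ) 1) (hxy : x ≤ y) :
    g y - g x = ∫ t in x..y, g1 t := by
  have hs : Icc x y ⊆ Icc (0:ℝ) 1 := Icc_subset_Icc hx.1 hy.2
  have := intervalIntegral.integral_eq_sub_of_hasDerivAt_of_le (f := g) (f' := g1) hxy
    (cg.mono hs) (fun t ht => dg t ⟨lt_of_le_of_lt hx.1 ht.1, lt_of_lt_of_le ht.2 hy.2⟩)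
    ((cg1.mono hs).intervalIntegrable_of_Icc hxy)
  exact this.symm

lemma holder (g g1 : ℝ → ℂ) (cg : ContinuousOn g (Icc 0 1)) (cg1 : ContinuousOn g1 (Icc 0 1))
    (dg : ∀ y ∈ Ioo (0:ℝ) 1, HasDerivAt g (g1 y) y) (x y : ℝ) (hx : x ∈ Icc (0:ℝ) 1)
    (hy : y ∈ Icc (0:ℝ) 1) (hxy : x ≤ y) :
    ‖g y - g x‖ ^ 2 ≤ (y - x) * nr g1 ^ 2 := by
  rw [ftc0 g g1 cg cg1 dg x y hx hy hxy]
  have hs : Icc x y ⊆ Icc (0:ℝ) 1 := Icc_subset_Icc hx.1 hy.2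
  have i0 : IntervalIntegrable (fun t => ‖g1 t‖) volume x y :=
    ((cg1.mono hs).norm).intervalIntegrable_of_Icc hxy
  have i1 : IntervalIntegrable (fun t => ‖g1 t‖ ^ 2) volume x y :=
    ((cg1.mono hs).norm.pow 2).intervalIntegrable_of_Icc hxy
  have hle : ∫ t in x..y, ‖g1 t‖ ^ 2 ≤ nr g1 ^ 2 := by
    rw [nr_sq]
    apply intervalIntegral.integral_mono_interval hx.1 hxy hy.2
    · exact Filter.Eventually.of_forall (fun t => by positivity)
    · exact ii_of_cont (cg1.norm.pow 2)
  have hn : ‖∫ t in x..y, g1 t‖ ≤ ∫ t in x..y, ‖g1 t‖ :=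
    intervalIntegral.norm_integral_le_integral_norm hxy
  set B := ∫ t in x..y, ‖g1 t‖
  have hB : 0 ≤ B := intervalIntegral.integral_nonneg hxy (fun t _ => norm_nonneg _)
  have key : ∀ t : ℝ, 0 ≤ (∫ t in x..y, ‖g1 t‖ ^ 2) * (t * t) + (-2 * B) * t + (y - x) := by
    intro t
    have : (∫ t in x..y, ‖g1 t‖ ^ 2) * (t * t) + (-2 * B) * t + (y - x)
        = ∫ u in x..y, ((t * t) * ‖g1 u‖ ^ 2 + (-2 * t) * ‖g1 u‖ + 1) := by
      rw [intervalIntegral.integral_add ((i1.const_mul _).add (i0.const_mul _)) (by simp),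
        intervalIntegral.integral_add (i1.const_mul _) (i0.const_mul _),
        intervalIntegral.integral_const_mul, intervalIntegral.integral_const_mul]
      simp [B]
      ring
    rw [this]
    apply intervalIntegral.integral_nonneg hxy
    intro u _
    nlinarith [sq_nonneg (t * ‖g1 u‖ - 1)]
  have := discrim_le_zero key
  unfold discrim at this
  have h2 : ‖∫ t in x..y, g1 t‖ ^ 2 ≤ B ^ 2 := pow_le_pow_left₀ (norm_nonneg _) hn 2
  nlinarith [mul_le_mul_of_nonneg_left hle (sub_nonneg.2 hxy)]

lemma nsup_le (g g1 : ℝ → ℂ) (cg : ContinuousOn g (Icc 0 1)) (cg1 : ContinuousOn g1 (Icc 0 1))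
    (dg : ∀ y ∈ Ioo (0:ℝ) 1, HasDerivAt g (g1 y) y) (h0 : g 0 = 0) (y : ℝ)
    (hy : y ∈ Icc (0:ℝ) 1) : ‖g y‖ ≤ nr g1 := by
  have := holder g g1 cg cg1 dg 0 y (by simp) hy hy.1
  rw [h0, sub_zero, sub_zero] at this
  apply abs_le_of_sq_le_sq' _ (nr_nonneg g1) |>.2
  nlinarith [sq_nonneg (nr g1), hy.2]

lemma nsup_sq_le (g g1 : ℝ → ℂ) (cg : ContinuousOn g (Icc 0 1)) (cg1 : ContinuousOn g1 (Icc 0 1))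
    (dg : ∀ y ∈ Ioo (0:ℝ) 1, HasDerivAt g (g1 y) y) (h0 : g 0 = 0) (y : ℝ)
    (hy : y ∈ Icc (0:ℝ) 1) : ‖g y‖ ^ 2 ≤ 2 * (nr g * nr g1) := by
  have cc : ∀ u : ℝ → ℂ, ContinuousOn u (Icc 0 1) →
      ContinuousOn (fun t => (starRingEnd ℂ) (u t)) (Icc 0 1) := fun u hu =>
    Complex.continuous_conj.comp_continuousOn hu
  have h := ftc0 (fun t => g t * (starRingEnd ℂ) (g t))
    (fun t => g1 t * (starRingEnd ℂ) (g t) + g t * (starRingEnd ℂ) (g1 t))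
    (cg.mul (cc g cg)) ((cg1.mul (cc g cg)).add (cg.mul (cc g1 cg1)))
    (fun t ht => (dg t ht).mul (dg t ht).star) 0 y (by simp) hy hy.1
  simp only [h0, zero_mul, sub_zero] at h
  have e1 : ‖g y‖ ^ 2 = ‖g y * (starRingEnd ℂ) (g y)‖ := by simp [sq]
  rw [e1, h]
  have i3 : IntervalIntegrable (fun t => 2 * (‖g t‖ * ‖g1 t‖)) volume 0 1 :=
    (ii_of_cont (cg.norm.mul cg1.norm)).const_mul 2
  calc _ ≤ ∫ t in (0:ℝ)..y, 2 * (‖g t‖ * ‖g1 t‖) := by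
        apply intervalIntegral.norm_integral_le_of_norm_le hy.1
        · refine Filter.Eventually.of_forall (fun t _ => ?_)
          refine (norm_add_le _ _).trans ?_
          simp only [norm_mul, RCLike.norm_conj]
          linarith
        · apply i3.mono_set
          rw [uIcc_of_le hy.1, uIcc_of_le (by norm_num)]
          exact Icc_subset_Icc le_rfl hy.2
    _ ≤ ∫ t in (0:ℝ)..1, 2 * (‖g t‖ * ‖g1 t‖) := by
        apply intervalIntegral.integral_mono_interval le_rfl hy.1 hy.2 _ i3
        exact Filter.Eventually.of_forall (fun t => by positivity)
    _ = 2 * ∫ t in (0:ℝ)..1, (‖g t‖ * ‖g1 t‖) := intervalIntegral.integral_const_mul _ _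
    _ ≤ _ := mul_le_mul_of_nonneg_left (cs g g1 cg cg1) (by norm_num)

/-- Quantitative data of the shear profile. -/
structure Prof (M : ℝ) (V V1 V2 V3 : ℝ → ℝ) : Prop where
  hM : 1 ≤ M
  cV : ContinuousOn V (Icc 0 1)
  cV1 : ContinuousOn V1 (Icc 0 1)
  cV2 : ContinuousOn V2 (Icc 0 1)
  cV3 : ContinuousOn V3 (Icc 0 1)
  dV : ∀ y ∈ Ioo (0:ℝ) 1, HasDerivAt V (V1 y) y
  dV1 : ∀ y ∈ Ioo (0:ℝ) 1, HasDerivAt V1 (V2 y) y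
  dV2 : ∀ y ∈ Ioo (0:ℝ) 1, HasDerivAt V2 (V3 y) y
  lo : ∀ y ∈ Icc (0:ℝ) 1, 1 ≤ M * V1 y
  hi : ∀ y ∈ Icc (0:ℝ) 1, V1 y ≤ M
  b2 : ∀ y ∈ Icc (0:ℝ) 1, |V2 y| ≤ M
  b3 : ∀ y ∈ Icc (0:ℝ) 1, |V3 y| ≤ M

/-- Rescaled solution of the Orr-Sommerfeld system, with `r ^ 2` the layer width. -/
structure Sol (M r lam K τ e : ℝ) (V V2 : ℝ → ℝ) (o : ℂ) (w w1 w2 φ φ1 f : ℝ → ℂ) : Prop where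
  hr : 0 < r
  hr1 : r ≤ 1
  hK : 1 ≤ K
  hKr : K * r ^ 2 ≤ M
  hτ : τ = 1 ∨ τ = -1
  he : 0 ≤ e
  ho : ‖o‖ ≤ e * r ^ 2
  cw : ContinuousOn w (Icc 0 1)
  cw1 : ContinuousOn w1 (Icc 0 1)
  cw2 : ContinuousOn w2 (Icc 0 1)
  cφ : ContinuousOn φ (Icc 0 1)
  cφ1 : ContinuousOn φ1 (Icc 0 1)
  cf : ContinuousOn f (Icc 0 1)
  dw : ∀ y ∈ Ioo (0:ℝ) 1, HasDerivAt w (w1 y) y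
  dw1 : ∀ y ∈ Ioo (0:ℝ) 1, HasDerivAt w1 (w2 y) y
  dφ : ∀ y ∈ Ioo (0:ℝ) 1, HasDerivAt φ (φ1 y) y
  dφ1 : ∀ y ∈ Ioo (0:ℝ) 1, HasDerivAt φ1 (w y + (K:ℂ) ^ 2 * φ y) y
  φ_0 : φ 0 = 0
  φ_1 : φ 1 = 0
  w_0 : w 0 = 0
  w_1 : w 1 = 0
  eq : ∀ y ∈ Icc (0:ℝ) 1, ((V y - lam : ℝ) : ℂ) * w y - (V2 y : ℂ) * φ y
    + Complex.I * (τ : ℂ) * (r : ℂ) ^ 6 * (w2 y - (K : ℂ) ^ 2 * w y) + o * w y = f y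

def Pw (V : ℝ → ℝ) (lam r y : ℝ) : ℝ := (V y - lam) ^ 2 + r ^ 4
def kp (V : ℝ → ℝ) (lam r y : ℝ) : ℝ := (V y - lam) / Pw V lam r y
def kp1 (V V1 : ℝ → ℝ) (lam r y : ℝ) : ℝ :=
  V1 y * (r ^ 4 - (V y - lam) ^ 2) / (Pw V lam r y) ^ 2
def om (V : ℝ → ℝ) (lam r y : ℝ) : ℝ := r / Real.sqrt (Pw V lam r y)
/-- Weighted norm. -/
def nw (V : ℝ → ℝ) (lam r : ℝ) (g : ℝ → ℂ) : ℝ := nr (fun y => (om V lam r y : ℂ) * g y)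

lemma nw_nonneg (V : ℝ → ℝ) (lam r : ℝ) (g : ℝ → ℂ) : 0 ≤ nw V lam r g := nr_nonneg _

section kern
variable {M : ℝ} {V V1 V2 V3 : ℝ → ℝ} (lam : ℝ) {r : ℝ}

lemma Pw_pos (V : ℝ → ℝ) (hr : 0 < r) (y : ℝ) : 0 < Pw V lam r y := by
  unfold Pw; positivity

lemma om_nonneg (V : ℝ → ℝ) (hr : 0 < r) (y : ℝ) : 0 ≤ om V lam r y := by
  unfold om; positivity

lemma om_sq (V : ℝ → ℝ) (hr : 0 < r) (y : ℝ) : om V lam r y ^ 2 = r ^ 2 / Pw V lam r y := by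
  unfold om; rw [div_pow, Real.sq_sqrt (Pw_pos lam V hr y).le]

lemma om_le (V : ℝ → ℝ) (hr : 0 < r) (y : ℝ) : r * om V lam r y ≤ 1 := by
  apply abs_le_of_sq_le_sq' _ zero_le_one |>.2
  rw [mul_pow, om_sq lam V hr, mul_div_assoc', div_le_iff₀ (Pw_pos lam V hr y)]
  unfold Pw; nlinarith [sq_nonneg (V y - lam)]

lemma kp_le (V : ℝ → ℝ) (hr : 0 < r) (y : ℝ) : |kp V lam r y| ≤ om V lam r y / r := by
  have hP := Pw_pos lam V hr y
  apply abs_le_of_sq_le_sq _ (div_nonneg (om_nonneg lam V hr y) hr.le)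
  rw [div_pow, om_sq lam V hr, kp, div_pow]
  have : r ^ 2 / Pw V lam r y / r ^ 2 = Pw V lam r y / Pw V lam r y ^ 2 := by
    field_simp
  rw [this]
  gcongr
  unfold Pw; nlinarith [pow_pos hr 4]

lemma kp_le2 (V : ℝ → ℝ) (hr : 0 < r) (y : ℝ) : |kp V lam r y| ≤ 1 / r ^ 2 := by
  refine (kp_le lam V hr y).trans ?_
  rw [div_le_div_iff₀ hr (by positivity)]
  nlinarith [om_le lam V hr y, om_nonneg lam V hr y]

lemma w4_le (V : ℝ → ℝ) (hr : 0 < r) (y : ℝ) :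
    r ^ 4 / Pw V lam r y ≤ r * om V lam r y := by
  have : r ^ 4 / Pw V lam r y = r ^ 2 * om V lam r y ^ 2 := by
    rw [om_sq lam V hr]; ring
  rw [this]
  nlinarith [om_le lam V hr y, om_nonneg lam V hr y, mul_nonneg hr.le (om_nonneg lam V hr y)]

lemma kp1_le (hp : Prof M V V1 V2 V3) (hr : 0 < r) (y : ℝ) (hy : y ∈ Icc (0:ℝ) 1) :
    |kp1 V V1 lam r y| ≤ M * om V lam r y ^ 2 / r ^ 2 := by
  have hP := Pw_pos lam V hr y
  have h1 : 0 ≤ V1 y := by nlinarith [hp.lo y hy, hp.hM]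
  rw [om_sq lam V hr, kp1, abs_div, abs_mul, abs_of_nonneg h1, abs_of_pos (pow_pos hP 2)]
  have : M * (r ^ 2 / Pw V lam r y) / r ^ 2 = M * Pw V lam r y / Pw V lam r y ^ 2 := by
    field_simp
  rw [this]
  gcongr
  · linarith [hp.hM]
  · exact hp.hi y hy
  · rw [abs_le]; unfold Pw; constructor <;> nlinarith [pow_pos hr 4, sq_nonneg (V y - lam)]

lemma kp1_le2 (hp : Prof M V V1 V2 V3) (hr : 0 < r) (y : ℝ) (hy : y ∈ Icc (0:ℝ) 1) :
    |kp1 V V1 lam r y| ≤ M * om V lam r y / r ^ 3 := by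
  refine (kp1_le lam hp hr y hy).trans ?_
  rw [div_le_div_iff₀ (by positivity) (by positivity)]
  have h := om_le lam V hr y
  have h0 := om_nonneg lam V hr y
  have hM := hp.hM
  have : M * om V lam r y ^ 2 * r ^ 3 = M * om V lam r y * r ^ 2 * (r * om V lam r y) := by ring
  rw [this]
  exact mul_le_of_le_one_right (by positivity) h

lemma kp1_le3 (hp : Prof M V V1 V2 V3) (hr : 0 < r) (y : ℝ) (hy : y ∈ Icc (0:ℝ) 1) :
    |kp1 V V1 lam r y| ≤ M / r ^ 4 := by
  refine (kp1_le2 lam hp hr y hy).trans ?_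
  rw [div_le_div_iff₀ (by positivity) (by positivity)]
  have h := om_le lam V hr y
  have hM := hp.hM
  have : M * om V lam r y * r ^ 4 = M * r ^ 3 * (r * om V lam r y) := by ring
  rw [this]
  exact mul_le_of_le_one_right (by positivity) h

lemma cPw (hp : Prof M V V1 V2 V3) : ContinuousOn (Pw V lam r) (Icc 0 1) := by
  unfold Pw
  exact ((hp.cV.sub continuousOn_const).pow 2).add continuousOn_const

lemma ckp (hp : Prof M V V1 V2 V3) (hr : 0 < r) : ContinuousOn (kp V lam r) (Icc 0 1) :=
  (hp.cV.sub continuousOn_const).div (cPw lam hp) (fun y _ => (Pw_pos lam V hr y).ne')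

lemma ckp1 (hp : Prof M V V1 V2 V3) (hr : 0 < r) : ContinuousOn (kp1 V V1 lam r) (Icc 0 1) :=
  (hp.cV1.mul (continuousOn_const.sub ((hp.cV.sub continuousOn_const).pow 2))).div
    ((cPw lam hp).pow 2) (fun y _ => (pow_pos (Pw_pos lam V hr y) 2).ne')

lemma com (hp : Prof M V V1 V2 V3) (hr : 0 < r) : ContinuousOn (om V lam r) (Icc 0 1) :=
  continuousOn_const.div (cPw lam hp).sqrt
    (fun y _ => (Real.sqrt_pos.2 (Pw_pos lam V hr y)).ne')

lemma cC {g : ℝ → ℝ} (hg : ContinuousOn g (Icc 0 1)) :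
    ContinuousOn (fun y => (g y : ℂ)) (Icc 0 1) :=
  Complex.continuous_ofReal.comp_continuousOn hg

lemma cconj {g : ℝ → ℂ} (hg : ContinuousOn g (Icc 0 1)) :
    ContinuousOn (fun y => (starRingEnd ℂ) (g y)) (Icc 0 1) :=
  Complex.continuous_conj.comp_continuousOn hg

lemma dPw (hp : Prof M V V1 V2 V3) (y : ℝ) (hy : y ∈ Ioo (0:ℝ) 1) :
    HasDerivAt (Pw V lam r) (2 * (V y - lam) * V1 y) y := by
  unfold Pw
  have := (((hp.dV y hy).sub_const lam).pow 2).add_const (r ^ 4)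
  exact this.congr_deriv (by ring)

lemma dkp (hp : Prof M V V1 V2 V3) (hr : 0 < r) (y : ℝ) (hy : y ∈ Ioo (0:ℝ) 1) :
    HasDerivAt (kp V lam r) (kp1 V V1 lam r y) y := by
  have hP := Pw_pos lam V hr y
  have := ((hp.dV y hy).sub_const lam).div (dPw (r := r) lam hp y hy) hP.ne'
  refine this.congr_deriv ?_
  unfold kp1
  congr 1
  unfold Pw
  ring

lemma int_om (hp : Prof M V V1 V2 V3) (hr : 0 < r) :
    ∫ y in (0:ℝ)..1, om V lam r y ^ 2 ≤ 4 * M := by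
  have hM := hp.hM
  have e : ∫ y in (0:ℝ)..1, V1 y * om V lam r y ^ 2 =
      Real.arctan ((V 1 - lam) / r ^ 2) - Real.arctan ((V 0 - lam) / r ^ 2) := by
    apply intervalIntegral.integral_eq_sub_of_hasDerivAt_of_le
      (f := fun y => Real.arctan ((V y - lam) / r ^ 2)) (by norm_num)
    · exact Real.continuous_arctan.comp_continuousOn
        ((hp.cV.sub continuousOn_const).div_const _)
    · intro y hy
      have := (((hp.dV y hy).sub_const lam).div_const (r ^ 2)).arctan
      refine this.congr_deriv ?_
      rw [om_sq lam V hr]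
      have hP := Pw_pos lam V hr y
      have h2 : 1 + ((V y - lam) / r ^ 2) ^ 2 = Pw V lam r y / r ^ 4 := by
        unfold Pw; field_simp; ring
      rw [h2]
      field_simp
    · exact ii_of_cont (hp.cV1.mul ((com lam hp hr).pow 2))
  have h1 : ∫ y in (0:ℝ)..1, om V lam r y ^ 2 ≤ ∫ y in (0:ℝ)..1, M * (V1 y * om V lam r y ^ 2) := by
    apply intervalIntegral.integral_mono_on (by norm_num) (ii_of_cont ((com lam hp hr).pow 2))
      (ii_of_cont (continuousOn_const.mul (hp.cV1.mul ((com lam hp hr).pow 2))))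
    intro y hy
    show om V lam r y ^ 2 ≤ M * (V1 y * om V lam r y ^ 2)
    nlinarith [hp.lo y hy, sq_nonneg (om V lam r y)]
  rw [intervalIntegral.integral_const_mul, e] at h1
  have a1 := Real.arctan_lt_pi_div_two ((V 1 - lam) / r ^ 2)
  have a2 := Real.neg_pi_div_two_lt_arctan ((V 0 - lam) / r ^ 2)
  have := Real.pi_lt_four
  nlinarith

lemma nw_le (hp : Prof M V V1 V2 V3) (hr : 0 < r) (g : ℝ → ℂ) (m : ℝ) (hm : 0 ≤ m)
    (cg : ContinuousOn g (Icc 0 1)) (hg : ∀ y ∈ Icc (0:ℝ) 1, ‖g y‖ ≤ m) :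
    nw V lam r g ≤ 2 * M * m := by
  have hM := hp.hM
  apply abs_le_of_sq_le_sq' _ (by positivity) |>.2
  have co := cC (com (r := r) lam hp hr)
  have : nw V lam r g ^ 2 ≤ m ^ 2 * ∫ y in (0:ℝ)..1, om V lam r y ^ 2 := by
    rw [nw, nr_sq, ← intervalIntegral.integral_const_mul]
    apply intervalIntegral.integral_mono_on (by norm_num) (ii_of_cont ((co.mul cg).norm.pow 2))
      (ii_of_cont (continuousOn_const.mul ((com lam hp hr).pow 2)))
    intro y hy
    show ‖(om V lam r y : ℂ) * g y‖ ^ 2 ≤ m ^ 2 * om V lam r y ^ 2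
    rw [norm_mul, mul_pow, Complex.norm_real, Real.norm_eq_abs, sq_abs, mul_comm]
    gcongr
    exact hg y hy
  have h2 := int_om lam hp hr
  have h3 : m ^ 2 * ∫ y in (0:ℝ)..1, om V lam r y ^ 2 ≤ m ^ 2 * (4 * M) := by gcongr
  nlinarith [sq_nonneg m, mul_nonneg (sq_nonneg m) (sub_nonneg.2 hM)]
end kern

lemma lin2 {T A B : ℝ → ℂ} (a b : ℂ) (cA : ContinuousOn A (Icc 0 1)) (cB : ContinuousOn B (Icc 0 1))
    (h : ∀ y ∈ Icc (0:ℝ) 1, T y = a * A y + b * B y) :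
    ∫ y in (0:ℝ)..1, T y = a * (∫ y in (0:ℝ)..1, A y) + b * (∫ y in (0:ℝ)..1, B y) := by
  rw [← intervalIntegral.integral_const_mul, ← intervalIntegral.integral_const_mul,
    ← intervalIntegral.integral_add ((ii_of_cont cA).const_mul a) ((ii_of_cont cB).const_mul b)]
  apply intervalIntegral.integral_congr
  intro y hy
  rw [uIcc_of_le (by norm_num)] at hy
  exact h y hy

lemma lin3 {T A B C : ℝ → ℂ} (a b c : ℂ) (cA : ContinuousOn A (Icc 0 1))
    (cB : ContinuousOn B (Icc 0 1)) (cC : ContinuousOn C (Icc 0 1))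
    (h : ∀ y ∈ Icc (0:ℝ) 1, T y = a * A y + b * B y + c * C y) :
    ∫ y in (0:ℝ)..1, T y = a * (∫ y in (0:ℝ)..1, A y) + b * (∫ y in (0:ℝ)..1, B y)
      + c * (∫ y in (0:ℝ)..1, C y) := by
  rw [lin2 (T := T) (A := fun y => a * A y + b * B y) (B := C) 1 c
    ((continuousOn_const.mul cA).add (continuousOn_const.mul cB)) cC
    (fun y hy => by rw [h y hy]; ring), lin2 (T := fun y => a * A y + b * B y) a b cA cB
    (fun y _ => rfl)]
  ring

lemma lin4 {T A B C D : ℝ → ℂ} (a b c d : ℂ) (cA : ContinuousOn A (Icc 0 1))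
    (cB : ContinuousOn B (Icc 0 1)) (cC : ContinuousOn C (Icc 0 1)) (cD : ContinuousOn D (Icc 0 1))
    (h : ∀ y ∈ Icc (0:ℝ) 1, T y = a * A y + b * B y + c * C y + d * D y) :
    ∫ y in (0:ℝ)..1, T y = a * (∫ y in (0:ℝ)..1, A y) + b * (∫ y in (0:ℝ)..1, B y)
      + c * (∫ y in (0:ℝ)..1, C y) + d * (∫ y in (0:ℝ)..1, D y) := by
  rw [lin2 (T := T) (A := fun y => a * A y + b * B y + c * C y) (B := D) 1 d
    (((continuousOn_const.mul cA).add (continuousOn_const.mul cB)).add (continuousOn_const.mul cC)) cD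
    (fun y hy => by rw [h y hy]; ring), lin3 (T := fun y => a * A y + b * B y + c * C y) a b c cA cB cC
    (fun y _ => rfl)]
  ring

lemma lin5 {T A B C D E : ℝ → ℂ} (a b c d e : ℂ) (cA : ContinuousOn A (Icc 0 1))
    (cB : ContinuousOn B (Icc 0 1)) (cC : ContinuousOn C (Icc 0 1)) (cD : ContinuousOn D (Icc 0 1))
    (cE : ContinuousOn E (Icc 0 1))
    (h : ∀ y ∈ Icc (0:ℝ) 1, T y = a * A y + b * B y + c * C y + d * D y + e * E y) :
    ∫ y in (0:ℝ)..1, T y = a * (∫ y in (0:ℝ)..1, A y) + b * (∫ y in (0:ℝ)..1, B y)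
      + c * (∫ y in (0:ℝ)..1, C y) + d * (∫ y in (0:ℝ)..1, D y) + e * (∫ y in (0:ℝ)..1, E y) := by
  rw [lin2 (T := T) (A := fun y => a * A y + b * B y + c * C y + d * D y) (B := E) 1 e
    ((((continuousOn_const.mul cA).add (continuousOn_const.mul cB)).add
      (continuousOn_const.mul cC)).add (continuousOn_const.mul cD)) cE
    (fun y hy => by rw [h y hy]; ring),
    lin4 (T := fun y => a * A y + b * B y + c * C y + d * D y) a b c d cA cB cC cD
    (fun y _ => rfl)]
  ring

section sol
variable {M r lam K τ e : ℝ} {V V1 V2 V3 : ℝ → ℝ} {o : ℂ} {w w1 w2 φ φ1 f : ℝ → ℂ}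

lemma testEq (hp : Prof M V V1 V2 V3) (hs : Sol M r lam K τ e V V2 o w w1 w2 φ φ1 f)
    (G G1 : ℝ → ℂ) (cG : ContinuousOn G (Icc 0 1)) (cG1 : ContinuousOn G1 (Icc 0 1))
    (dG : ∀ y ∈ Ioo (0:ℝ) 1, HasDerivAt G (G1 y) y) (G0 : G 0 = 0) (G1' : G 1 = 0) :
    (∫ y in (0:ℝ)..1, G y * ((V y - lam : ℝ) : ℂ) * w y) =
      (∫ y in (0:ℝ)..1, G y * (V2 y : ℂ) * φ y) + (∫ y in (0:ℝ)..1, G y * f y)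
      + Complex.I * (τ : ℂ) * (r : ℂ) ^ 6 * (∫ y in (0:ℝ)..1, G1 y * w1 y)
      + (Complex.I * (τ : ℂ) * (r : ℂ) ^ 6 * (K : ℂ) ^ 2 - o) * (∫ y in (0:ℝ)..1, G y * w y) := by
  have i := ibp G G1 w1 w2 cG cG1 hs.cw1 hs.cw2 dG hs.dw1 (by rw [G0, zero_mul])
    (by rw [G1', zero_mul])
  have cV2 := cC hp.cV2
  have := lin4 (T := fun y => G y * ((V y - lam : ℝ) : ℂ) * w y)
    (A := fun y => G y * (V2 y : ℂ) * φ y) (B := fun y => G y * f y)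
    (C := fun y => G y * w2 y) (D := fun y => G y * w y) 1 1 (-(Complex.I * (τ : ℂ) * (r : ℂ) ^ 6))
    (Complex.I * (τ : ℂ) * (r : ℂ) ^ 6 * (K : ℂ) ^ 2 - o)
    ((cG.mul cV2).mul hs.cφ) (cG.mul hs.cf) (cG.mul hs.cw2) (cG.mul hs.cw)
    (fun y hy => by
      have h := hs.eq y hy
      linear_combination G y * h)
  rw [this, i]
  ring

lemma normτ (hs : Sol M r lam K τ e V V2 o w w1 w2 φ φ1 f) :
    ‖Complex.I * (τ : ℂ) * (r : ℂ) ^ 6‖ = r ^ 6 := by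
  have : |τ| = 1 := by rcases hs.hτ with h | h <;> simp [h]
  rw [norm_mul, norm_mul, norm_pow, Complex.norm_real, Complex.norm_real]
  simp [this, abs_of_pos hs.hr]

lemma normKo (hs : Sol M r lam K τ e V V2 o w w1 w2 φ φ1 f) :
    ‖Complex.I * (τ : ℂ) * (r : ℂ) ^ 6 * (K : ℂ) ^ 2 - o‖ ≤ r ^ 2 * (K ^ 2 * r ^ 4 + e) := by
  refine (norm_sub_le _ _).trans ?_
  rw [norm_mul, normτ hs, norm_pow, Complex.norm_real, Real.norm_eq_abs,
    sq_abs]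
  nlinarith [hs.ho]

lemma Kr4 (hs : Sol M r lam K τ e V V2 o w w1 w2 φ φ1 f) : K ^ 2 * r ^ 4 ≤ M ^ 2 := by
  have h1 := hs.hKr
  have h2 : 0 ≤ K * r ^ 2 := mul_nonneg (by linarith [hs.hK]) (by positivity)
  have := pow_le_pow_left₀ h2 h1 2
  nlinarith

lemma nC (x : ℝ) : ‖(x:ℂ)‖ = |x| := by rw [Complex.norm_real, Real.norm_eq_abs]

lemma nI (a : ℂ) (x : ℂ) {A B : ℝ} (hA : 0 ≤ A) (h : ‖a‖ ≤ A) (h2 : ‖x‖ ≤ B) : ‖a * x‖ ≤ A * B := by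
  rw [norm_mul]; exact mul_le_mul h h2 (norm_nonneg _) hA

set_option maxHeartbeats 1000000 in
lemma pairing (hp : Prof M V V1 V2 V3) (hs : Sol M r lam K τ e V V2 o w w1 w2 φ φ1 f)
    (g g1 : ℝ → ℂ) (cg : ContinuousOn g (Icc 0 1)) (cg1 : ContinuousOn g1 (Icc 0 1))
    (dg : ∀ y ∈ Ioo (0:ℝ) 1, HasDerivAt g (g1 y) y) (g_0 : g 0 = 0) (g_1 : g 1 = 0) :
    ‖(∫ y in (0:ℝ)..1, g y * w y) - ∫ y in (0:ℝ)..1, (V2 y : ℂ) * φ y * g y * (kp V lam r y : ℂ)‖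
    ≤ nw V lam r g * (nr f / r + (1 + e + M ^ 2) * (r * nr w) + M * (r ^ 3 * nr w1))
      + r * nr g1 * (r ^ 3 * nr w1) := by
  have hr := hs.hr
  have ck := cC (ckp (r := r) lam hp hr)
  have ck1 := cC (ckp1 (r := r) lam hp hr)
  have co := cC (com (r := r) lam hp hr)
  have cV := cC (hp.cV.sub (continuousOn_const (c := lam)))
  have cV2 := cC hp.cV2
  have cP := cC ((continuousOn_const (c := r ^ 4)).div (cPw (r := r) lam hp)
    (fun y _ => (Pw_pos lam V hr y).ne'))
  have t := testEq hp hs (fun y => g y * (kp V lam r y : ℂ))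
    (fun y => g1 y * (kp V lam r y : ℂ) + g y * (kp1 V V1 lam r y : ℂ)) (cg.mul ck)
    ((cg1.mul ck).add (cg.mul ck1))
    (fun y hy => (dg y hy).mul (dkp lam hp hr y hy).ofReal_comp) (by simp [g_0]) (by simp [g_1])
  have t2 := lin2 (T := fun y => g y * w y)
    (A := fun y => g y * (kp V lam r y : ℂ) * ((V y - lam : ℝ) : ℂ) * w y)
    (B := fun y => ((r ^ 4 / Pw V lam r y : ℝ) : ℂ) * (g y * w y)) 1 1
    (((cg.mul ck).mul cV).mul hs.cw) (cP.mul (cg.mul hs.cw)) (fun y hy => by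
      have hP := (Pw_pos lam V hr y).ne'
      have : kp V lam r y * (V y - lam) + r ^ 4 / Pw V lam r y = 1 := by
        unfold kp
        field_simp
        unfold Pw
        ring
      have h2 : (kp V lam r y : ℂ) * ((V y - lam : ℝ) : ℂ) + ((r ^ 4 / Pw V lam r y : ℝ) : ℂ) = 1 := by
        exact_mod_cast this
      linear_combination (-(g y * w y)) * h2)
  have t3 : (∫ y in (0:ℝ)..1, (V2 y : ℂ) * φ y * g y * (kp V lam r y : ℂ)) =
      ∫ y in (0:ℝ)..1, g y * (kp V lam r y : ℂ) * (V2 y : ℂ) * φ y := by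
    congr 1; ext y; ring
  rw [t2, t3, t]
  have hw := nr_nonneg w
  have b1 : ‖∫ y in (0:ℝ)..1, ((r ^ 4 / Pw V lam r y : ℝ) : ℂ) * (g y * w y)‖
      ≤ r * (nw V lam r g * nr w) := by
    apply csb _ (fun y => (om V lam r y : ℂ) * g y) w r hr.le (co.mul cg) hs.cw
    intro y hy
    have h := w4_le lam V hr y
    rw [norm_mul, norm_mul, norm_mul, nC, nC, abs_of_nonneg (om_nonneg lam V hr y),
      abs_of_nonneg (div_nonneg (by positivity) (Pw_pos lam V hr y).le)]
    calc _ ≤ r * om V lam r y * (‖g y‖ * ‖w y‖) := by gcongr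
      _ = _ := by ring
  have b2 : ∀ h : ℝ → ℂ, ContinuousOn h (Icc 0 1) → ‖∫ y in (0:ℝ)..1, g y * (kp V lam r y : ℂ) * h y‖
      ≤ 1 / r * (nw V lam r g * nr h) := by
    intro h ch
    apply csb _ (fun y => (om V lam r y : ℂ) * g y) h (1 / r) (by positivity) (co.mul cg) ch
    intro y hy
    have h1 := kp_le lam V hr y
    rw [norm_mul, norm_mul, norm_mul, nC, nC, abs_of_nonneg (om_nonneg lam V hr y)]
    calc _ ≤ ‖g y‖ * (om V lam r y / r) * ‖h y‖ := by gcongr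
      _ = _ := by ring
  have b3 : ‖∫ y in (0:ℝ)..1, (g1 y * (kp V lam r y : ℂ) + g y * (kp1 V V1 lam r y : ℂ)) * w1 y‖
      ≤ 1 / r ^ 2 * (nr g1 * nr w1) + M / r ^ 3 * (nw V lam r g * nr w1) := by
    rw [lin2 (A := fun y => g1 y * (kp V lam r y : ℂ) * w1 y)
      (B := fun y => g y * (kp1 V V1 lam r y : ℂ) * w1 y) 1 1 ((cg1.mul ck).mul hs.cw1)
      ((cg.mul ck1).mul hs.cw1) (fun y _ => by ring), one_mul, one_mul]
    refine (norm_add_le _ _).trans (add_le_add ?_ ?_)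
    · apply csb _ g1 w1 _ (by positivity) cg1 hs.cw1
      intro y hy
      rw [norm_mul, norm_mul, nC]
      calc _ ≤ ‖g1 y‖ * (1 / r ^ 2) * ‖w1 y‖ := by gcongr; exact kp_le2 lam V hr y
        _ = _ := by ring
    · apply csb _ (fun y => (om V lam r y : ℂ) * g y) w1 _
        (div_nonneg (by linarith [hp.hM]) (by positivity)) (co.mul cg) hs.cw1
      intro y hy
      rw [norm_mul, norm_mul, norm_mul, nC, nC, abs_of_nonneg (om_nonneg lam V hr y)]
      calc _ ≤ ‖g y‖ * (M * om V lam r y / r ^ 3) * ‖w1 y‖ := by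
            gcongr; exact kp1_le2 lam hp hr y hy
        _ = _ := by ring
  have e1 : ∀ a b c d x : ℂ, 1 * (a + b + c + d) + 1 * x - a = b + c + d + x := by intros; ring
  rw [e1]
  refine (norm_add_le _ _).trans ?_
  refine (add_le_add_left (norm_add₃_le) _).trans ?_
  have c2 := b2 f hs.cf
  have c3 := nI _ _ (by positivity) (normτ hs).le b3
  have c4 := nI _ _ (mul_nonneg (sq_nonneg r) (add_nonneg (by positivity) hs.he)) (normKo hs) (b2 w hs.cw)
  have c5 : r ^ 2 * (K ^ 2 * r ^ 4 + e) * (1 / r * (nw V lam r g * nr w)) ≤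
      (M ^ 2 + e) * (r * (nw V lam r g * nr w)) := by
    have : r ^ 2 * (K ^ 2 * r ^ 4 + e) * (1 / r * (nw V lam r g * nr w)) =
      (K ^ 2 * r ^ 4 + e) * (r * (nw V lam r g * nr w)) := by field_simp
    rw [this]
    have := Kr4 hs
    have := nw_nonneg V lam r g
    gcongr
  have c6 : r ^ 6 * (1 / r ^ 2 * (nr g1 * nr w1) + M / r ^ 3 * (nw V lam r g * nr w1)) =
      r ^ 4 * (nr g1 * nr w1) + M * r ^ 3 * (nw V lam r g * nr w1) := by field_simp
  rw [c6] at c3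
  refine (add_le_add (add_le_add (add_le_add c2 c3) (c4.trans c5)) b1).trans (le_of_eq ?_)
  ring

set_option maxHeartbeats 1000000 in
lemma Wbound (hp : Prof M V V1 V2 V3) (hs : Sol M r lam K τ e V V2 o w w1 w2 φ φ1 f)
    (he : e ≤ 1 / 2) :
    r * nr w ≤ 2 * (nw V lam r (fun y => (V2 y : ℂ) * φ y) + nr f / r + 9 * M * (r ^ 3 * nr w1)) := by
  have hr := hs.hr
  have ck := cC (ckp (r := r) lam hp hr)
  have ck1 := cC (ckp1 (r := r) lam hp hr)
  have co := cC (com (r := r) lam hp hr)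
  have cV := cC (hp.cV.sub (continuousOn_const (c := lam)))
  have cV2 := cC hp.cV2
  have cwb := cconj hs.cw
  have cw1b := cconj hs.cw1
  have cPr : ContinuousOn (fun y => r ^ 4 / Pw V lam r y) (Icc 0 1) :=
    ((continuousOn_const (c := r ^ 4)).div (cPw (r := r) lam hp)
    (fun y _ => (Pw_pos lam V hr y).ne'))
  have cn : ContinuousOn (fun y => ‖w y‖ ^ 2) (Icc 0 1) := hs.cw.norm.pow 2
  have cPn : ContinuousOn (fun y => r ^ 4 / Pw V lam r y * ‖w y‖ ^ 2) (Icc 0 1) := cPr.mul cn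
  have cP := cC cPr
  have cu := cV2.mul hs.cφ
  set u : ℝ → ℂ := fun y => (V2 y : ℂ) * φ y with hu
  have t := testEq hp hs (fun y => (kp V lam r y : ℂ) * (starRingEnd ℂ) (w y))
    (fun y => (kp1 V V1 lam r y : ℂ) * (starRingEnd ℂ) (w y) + (kp V lam r y : ℂ) * (starRingEnd ℂ) (w1 y))
    (ck.mul cwb) ((ck1.mul cwb).add (ck.mul cw1b))
    (fun y hy => (dkp lam hp hr y hy).ofReal_comp.mul (hs.dw y hy).star) (by simp [hs.w_0])
      (by simp [hs.w_1])
  -- real integrals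
  have wsq : ∀ z : ℂ, (starRingEnd ℂ) z * z = ((‖z‖ ^ 2 : ℝ) : ℂ) := by
    intro z; rw [mul_comm, Complex.mul_conj, Complex.normSq_eq_norm_sq]
  set J : ℝ := ∫ y in (0:ℝ)..1, r ^ 4 / Pw V lam r y * ‖w y‖ ^ 2 with hJ
  set J1 : ℝ := ∫ y in (0:ℝ)..1, kp V lam r y * ‖w1 y‖ ^ 2 with hJ1
  set J0 : ℝ := ∫ y in (0:ℝ)..1, kp V lam r y * ‖w y‖ ^ 2 with hJ0
  have L1 : (∫ y in (0:ℝ)..1, (kp V lam r y : ℂ) * (starRingEnd ℂ) (w y) * ((V y - lam : ℝ) : ℂ) * w y)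
      = ((nr w ^ 2 - J : ℝ) : ℂ) := by
    rw [nr_sq, hJ, ← intervalIntegral.integral_sub (ii_of_cont cn)
      (ii_of_cont cPn), ← intervalIntegral.integral_ofReal]
    congr 1; ext y
    have hP := (Pw_pos lam V hr y).ne'
    have h1 : kp V lam r y * (V y - lam) = 1 - r ^ 4 / Pw V lam r y := by
      unfold kp
      field_simp
      unfold Pw
      ring
    have h2 : (kp V lam r y : ℂ) * ((V y - lam : ℝ) : ℂ) = 1 - ((r ^ 4 / Pw V lam r y : ℝ) : ℂ) := by
      exact_mod_cast h1
    have h3 := wsq (w y)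
    push_cast at h3 h2 ⊢
    linear_combination (1 - (r:ℂ) ^ 4 / (Pw V lam r y : ℂ)) * h3 + (starRingEnd ℂ) (w y) * w y * h2
  have L2 : (∫ y in (0:ℝ)..1, (kp V lam r y : ℂ) * (starRingEnd ℂ) (w y) * w y) = ((J0 : ℝ) : ℂ) := by
    rw [hJ0, ← intervalIntegral.integral_ofReal]
    congr 1; ext y
    rw [mul_assoc, wsq]; push_cast; ring
  have L3 : (∫ y in (0:ℝ)..1, ((kp1 V V1 lam r y : ℂ) * (starRingEnd ℂ) (w y)
      + (kp V lam r y : ℂ) * (starRingEnd ℂ) (w1 y)) * w1 y)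
      = (∫ y in (0:ℝ)..1, (kp1 V V1 lam r y : ℂ) * (starRingEnd ℂ) (w y) * w1 y) + ((J1 : ℝ) : ℂ) := by
    rw [hJ1, ← intervalIntegral.integral_ofReal, lin2
      (A := fun y => (kp1 V V1 lam r y : ℂ) * (starRingEnd ℂ) (w y) * w1 y)
      (B := fun y => ((kp V lam r y * ‖w1 y‖ ^ 2 : ℝ) : ℂ)) 1 1 ((ck1.mul cwb).mul hs.cw1)
      (cC ((ckp lam hp hr).mul (hs.cw1.norm.pow 2))) (fun y _ => by
        have := wsq (w1 y)
        push_cast at this ⊢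
        linear_combination (kp V lam r y : ℂ) * this)]
    simp
  rw [L1, L2, L3] at t
  have b1 : ‖∫ y in (0:ℝ)..1, (kp V lam r y : ℂ) * (starRingEnd ℂ) (w y) * (V2 y : ℂ) * φ y‖
      ≤ 1 / r * (nw V lam r u * nr w) := by
    apply csb _ (fun y => (om V lam r y : ℂ) * u y) w (1 / r) (by positivity) (co.mul cu) hs.cw
    intro y hy
    have h1 := kp_le lam V hr y
    simp only [norm_mul, nC, abs_of_nonneg (om_nonneg lam V hr y), hu, RCLike.norm_conj]
    calc _ ≤ (om V lam r y / r) * ‖w y‖ * |V2 y| * ‖φ y‖ := by gcongr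
      _ = _ := by ring
  have b2 : ‖∫ y in (0:ℝ)..1, (kp V lam r y : ℂ) * (starRingEnd ℂ) (w y) * f y‖
      ≤ 1 / r ^ 2 * (nr w * nr f) := by
    apply csb _ w f _ (by positivity) hs.cw hs.cf
    intro y hy
    simp only [norm_mul, nC, RCLike.norm_conj]
    calc _ ≤ (1 / r ^ 2) * ‖w y‖ * ‖f y‖ := by gcongr; exact kp_le2 lam V hr y
      _ = _ := by ring
  have hM0 : 0 ≤ M := by linarith [hp.hM]
  have b3 : ‖∫ y in (0:ℝ)..1, (kp1 V V1 lam r y : ℂ) * (starRingEnd ℂ) (w y) * w1 y‖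
      ≤ M / r ^ 4 * (nr w * nr w1) := by
    apply csb _ w w1 _ (by positivity) hs.cw hs.cw1
    intro y hy
    simp only [norm_mul, nC, RCLike.norm_conj]
    calc _ ≤ (M / r ^ 4) * ‖w y‖ * ‖w1 y‖ := by gcongr; exact kp1_le3 lam hp hr y hy
      _ = _ := by ring
  have b4 : ‖((J0 : ℝ) : ℂ)‖ ≤ 1 / r ^ 2 * (nr w * nr w) := by
    rw [← L2]
    apply csb _ w w _ (by positivity) hs.cw hs.cw
    intro y hy
    simp only [norm_mul, nC, RCLike.norm_conj]
    calc _ ≤ (1 / r ^ 2) * ‖w y‖ * ‖w y‖ := by gcongr; exact kp_le2 lam V hr y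
      _ = _ := by ring
  have b5 : J ≤ r ^ 2 * (2 * (nr w * nr w1)) * (4 * M) := by
    have hw1 := mul_nonneg (nr_nonneg w) (nr_nonneg w1)
    refine le_trans ?_ (mul_le_mul_of_nonneg_left (int_om lam hp hr) (by positivity))
    rw [hJ, ← intervalIntegral.integral_const_mul]
    apply intervalIntegral.integral_mono_on (by norm_num)
      (ii_of_cont cPn)
      (ii_of_cont (continuousOn_const.mul ((com lam hp hr).pow 2)))
    intro y hy
    show r ^ 4 / Pw V lam r y * ‖w y‖ ^ 2 ≤ r ^ 2 * (2 * (nr w * nr w1)) * om V lam r y ^ 2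
    have h1 := nsup_sq_le w w1 hs.cw hs.cw1 hs.dw hs.w_0 y hy
    have h2 : r ^ 4 / Pw V lam r y = r ^ 2 * om V lam r y ^ 2 := by rw [om_sq lam V hr]; ring
    rw [h2]
    have := mul_le_mul_of_nonneg_left h1 (mul_nonneg (sq_nonneg r) (sq_nonneg (om V lam r y)))
    linarith
  have tr := congrArg Complex.re t
  set z1 := ∫ y in (0:ℝ)..1, (kp V lam r y : ℂ) * (starRingEnd ℂ) (w y) * (V2 y : ℂ) * φ y
  set z2 := ∫ y in (0:ℝ)..1, (kp V lam r y : ℂ) * (starRingEnd ℂ) (w y) * f y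
  set z3 := ∫ y in (0:ℝ)..1, (kp1 V V1 lam r y : ℂ) * (starRingEnd ℂ) (w y) * w1 y
  have e1 : (Complex.I * (τ : ℂ) * (r : ℂ) ^ 6 * (z3 + ((J1 : ℝ) : ℂ))).re =
      (Complex.I * (τ : ℂ) * (r : ℂ) ^ 6 * z3).re := by
    have : Complex.I * (τ : ℂ) * (r : ℂ) ^ 6 * (z3 + ((J1 : ℝ) : ℂ)) =
      Complex.I * (τ : ℂ) * (r : ℂ) ^ 6 * z3 + ((τ * r ^ 6 * J1 : ℝ) : ℂ) * Complex.I := by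
      push_cast; ring
    rw [this, Complex.add_re, Complex.re_ofReal_mul]; simp
  have e2 : ((Complex.I * (τ : ℂ) * (r : ℂ) ^ 6 * (K : ℂ) ^ 2 - o) * ((J0 : ℝ) : ℂ)).re =
      (-o * ((J0 : ℝ) : ℂ)).re := by
    have : (Complex.I * (τ : ℂ) * (r : ℂ) ^ 6 * (K : ℂ) ^ 2 - o) * ((J0 : ℝ) : ℂ) =
      -o * ((J0 : ℝ) : ℂ) + ((τ * r ^ 6 * K ^ 2 * J0 : ℝ) : ℂ) * Complex.I := by
      push_cast; ring
    rw [this, Complex.add_re, Complex.re_ofReal_mul]; simp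
  rw [Complex.add_re, Complex.add_re, Complex.add_re, e1, e2, Complex.ofReal_re] at tr
  have r1 := (Complex.re_le_norm z1).trans b1
  have r2 := (Complex.re_le_norm z2).trans b2
  have r3 := (Complex.re_le_norm _).trans (nI _ _ (by positivity) (normτ hs).le b3)
  have r4 := (Complex.re_le_norm _).trans
    (nI (-o) _ (mul_nonneg hs.he (sq_nonneg r)) (by rw [norm_neg]; exact hs.ho) b4)
  have f3 : r ^ 6 * (M / r ^ 4 * (nr w * nr w1)) = M * r ^ 2 * (nr w * nr w1) := by field_simp
  have f4 : e * r ^ 2 * (1 / r ^ 2 * (nr w * nr w)) = e * (nr w * nr w) := by field_simp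
  rw [f3] at r3
  rw [f4] at r4
  have hw := nr_nonneg w
  by_cases h0 : nr w = 0
  · rw [h0]
    have := nw_nonneg V lam r u
    have := nr_nonneg f
    have := nr_nonneg w1
    rw [mul_zero]
    positivity
  have hw' : 0 < nr w := lt_of_le_of_ne hw (Ne.symm h0)
  have main : nr w * (nr w / 2) ≤ nr w * (1 / r * nw V lam r u + 1 / r ^ 2 * nr f + 9 * M * r ^ 2 * nr w1) := by
    have : e * (nr w * nr w) ≤ 1 / 2 * (nr w * nr w) := by gcongr
    linarith
  have main2 := le_of_mul_le_mul_left main hw'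
  have := mul_le_mul_of_nonneg_left main2 (by positivity : 0 ≤ 2 * r)
  have f5 : 2 * r * (1 / r * nw V lam r u + 1 / r ^ 2 * nr f + 9 * M * r ^ 2 * nr w1) =
    2 * (nw V lam r u + nr f / r + 9 * M * (r ^ 3 * nr w1)) := by field_simp
  linarith
end sol

/-- The energy norm. -/
def EE (K : ℝ) (φ φ1 : ℝ → ℂ) : ℝ := Real.sqrt (nr φ1 ^ 2 + K ^ 2 * nr φ ^ 2)

lemma EE_nonneg (K : ℝ) (φ φ1 : ℝ → ℂ) : 0 ≤ EE K φ φ1 := Real.sqrt_nonneg _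

lemma EE_sq (K : ℝ) (φ φ1 : ℝ → ℂ) : EE K φ φ1 ^ 2 = nr φ1 ^ 2 + K ^ 2 * nr φ ^ 2 := by
  unfold EE; rw [Real.sq_sqrt (by positivity)]

lemma conj_mul_self' (z : ℂ) : (starRingEnd ℂ) z * z = ((‖z‖ ^ 2 : ℝ) : ℂ) := by
  rw [mul_comm, Complex.mul_conj, Complex.normSq_eq_norm_sq]

section sol
variable {M r lam K τ e : ℝ} {V V1 V2 V3 : ℝ → ℝ} {o : ℂ} {w w1 w2 φ φ1 f : ℝ → ℂ}

lemma nr1_le_EE : nr φ1 ≤ EE K φ φ1 := by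
  apply abs_le_of_sq_le_sq' _ (EE_nonneg _ _ _) |>.2
  rw [EE_sq]; nlinarith [sq_nonneg (K * nr φ)]

lemma Knr_le_EE (hK : 0 ≤ K) : K * nr φ ≤ EE K φ φ1 := by
  apply abs_le_of_sq_le_sq' _ (EE_nonneg _ _ _) |>.2
  rw [EE_sq]; nlinarith [sq_nonneg (nr φ1)]

lemma nr_le_EE (hK : 1 ≤ K) : nr φ ≤ EE K φ φ1 := by
  have := Knr_le_EE (K := K) (φ := φ) (φ1 := φ1) (by linarith)
  nlinarith [nr_nonneg φ]

lemma φ_le_EE (hs : Sol M r lam K τ e V V2 o w w1 w2 φ φ1 f) (y : ℝ) (hy : y ∈ Icc (0:ℝ) 1) :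
    ‖φ y‖ ≤ EE K φ φ1 :=
  (nsup_le φ φ1 hs.cφ hs.cφ1 hs.dφ hs.φ_0 y hy).trans nr1_le_EE

lemma φ_sq_le (hs : Sol M r lam K τ e V V2 o w w1 w2 φ φ1 f) (y : ℝ) (hy : y ∈ Icc (0:ℝ) 1) :
    K * ‖φ y‖ ^ 2 ≤ EE K φ φ1 ^ 2 := by
  have h := nsup_sq_le φ φ1 hs.cφ hs.cφ1 hs.dφ hs.φ_0 y hy
  have hK := hs.hK
  rw [EE_sq]
  nlinarith [sq_nonneg (nr φ1 - K * nr φ), mul_le_mul_of_nonneg_left h (by linarith : (0:ℝ) ≤ K)]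

/-- norm of the derivative of `V2 φ` -/
lemma u1_le (hp : Prof M V V1 V2 V3) (hs : Sol M r lam K τ e V V2 o w w1 w2 φ φ1 f) :
    nr (fun y => (V3 y : ℂ) * φ y + (V2 y : ℂ) * φ1 y) ≤ 2 * M * EE K φ φ1 := by
  have hM : 0 ≤ M := by linarith [hp.hM]
  refine (nr_add (fun y => (V3 y : ℂ) * φ y) (fun y => (V2 y : ℂ) * φ1 y) ((cC hp.cV3).mul hs.cφ) ((cC hp.cV2).mul hs.cφ1)).trans ?_
  have h1 := nr_le (fun y => (V3 y : ℂ) * φ y) φ M hM ((cC hp.cV3).mul hs.cφ) hs.cφ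
    (fun y hy => by rw [norm_mul, nC]; gcongr; exact hp.b3 y hy)
  have h2 := nr_le (fun y => (V2 y : ℂ) * φ1 y) φ1 M hM ((cC hp.cV2).mul hs.cφ1) hs.cφ1
    (fun y hy => by rw [norm_mul, nC]; gcongr; exact hp.b2 y hy)
  have h3 := nr_le_EE (φ := φ) (φ1 := φ1) hs.hK
  have h4 := nr1_le_EE (K := K) (φ := φ) (φ1 := φ1)
  nlinarith

lemma Q_le (hp : Prof M V V1 V2 V3) (hs : Sol M r lam K τ e V V2 o w w1 w2 φ φ1 f) (m : ℝ)
    (hm : 0 ≤ m) (h : ∀ y ∈ Icc (0:ℝ) 1, ‖φ y‖ ≤ m) :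
    nw V lam r (fun y => (V2 y : ℂ) * φ y) ≤ 2 * M ^ 2 * m := by
  have hM : 0 ≤ M := by linarith [hp.hM]
  have := nw_le lam hp hs.hr (fun y => (V2 y : ℂ) * φ y) (M * m) (by positivity)
    ((cC hp.cV2).mul hs.cφ) (fun y hy => by
      rw [norm_mul, nC]; have := h y hy; have := hp.b2 y hy; gcongr)
  linarith

def Rk (V : ℝ → ℝ) (lam r y : ℝ) : ℝ := r ^ 6 / Pw V lam r y ^ 2

lemma Rk_nonneg (V : ℝ → ℝ) (hr : 0 < r) (y : ℝ) : 0 ≤ Rk V lam r y := by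
  unfold Rk; positivity

lemma Rk_eq (V : ℝ → ℝ) (hr : 0 < r) (y : ℝ) : Rk V lam r y = r ^ 2 * om V lam r y ^ 4 := by
  have : om V lam r y ^ 4 = (om V lam r y ^ 2) ^ 2 := by ring
  rw [this, om_sq lam V hr]; unfold Rk; ring

lemma Rk_le (V : ℝ → ℝ) (hr : 0 < r) (y : ℝ) : Rk V lam r y ≤ om V lam r y / r := by
  rw [Rk_eq V hr, le_div_iff₀ hr]
  have h := om_le lam V hr y
  have h0 := om_nonneg lam V hr y
  have : r ^ 2 * om V lam r y ^ 4 * r = om V lam r y * (r * om V lam r y) ^ 3 := by ring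
  rw [this]
  exact mul_le_of_le_one_right h0 (pow_le_one₀ (by positivity) h)

lemma Rk_le2 (V : ℝ → ℝ) (hr : 0 < r) (y : ℝ) : Rk V lam r y ≤ 1 / r ^ 2 := by
  refine (Rk_le V hr y).trans ?_
  rw [div_le_div_iff₀ hr (by positivity)]
  nlinarith [om_le lam V hr y, om_nonneg lam V hr y]

set_option maxHeartbeats 2000000 in
lemma Qbound (hp : Prof M V V1 V2 V3) (hs : Sol M r lam K τ e V V2 o w w1 w2 φ φ1 f) :
    nw V lam r (fun y => (V2 y : ℂ) * φ y) ^ 2 ≤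
      nw V lam r (fun y => (V2 y : ℂ) * φ y) *
        (9 * M * (r ^ 3 * nr w1) + 2 * (nr f / r) + (M ^ 3 * r ^ 2 + 2 * (K ^ 2 * r ^ 4) + 2 * e) * (r * nr w))
      + r * (2 * M * EE K φ φ1) * (M * (r * nr w) + 2 * (r ^ 3 * nr w1)
        + 3 * M ^ 3 * nw V lam r (fun y => (V2 y : ℂ) * φ y)) := by
  have hr := hs.hr
  have hM1 := hp.hM
  have hM : 0 ≤ M := by linarith [hp.hM]
  have ck := cC (ckp (r := r) lam hp hr)
  have ck1 := cC (ckp1 (r := r) lam hp hr)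
  have co := cC (com (r := r) lam hp hr)
  have cV2 := cC hp.cV2
  have cV3 := cC hp.cV3
  have hV1 : ∀ y ∈ Icc (0:ℝ) 1, 0 < V1 y := fun y hy => by nlinarith [hp.lo y hy]
  have hU := u1_le hp hs
  set u : ℝ → ℂ := fun y => (V2 y : ℂ) * φ y with hu
  set u1 : ℝ → ℂ := fun y => (V3 y : ℂ) * φ y + (V2 y : ℂ) * φ1 y with hu1
  have cu : ContinuousOn u (Icc 0 1) := cV2.mul hs.cφ
  have cu1 : ContinuousOn u1 (Icc 0 1) := (cV3.mul hs.cφ).add (cV2.mul hs.cφ1)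
  have du : ∀ y ∈ Ioo (0:ℝ) 1, HasDerivAt u (u1 y) y := fun y hy =>
    (hp.dV2 y hy).ofReal_comp.mul (hs.dφ y hy)
  have u_0 : u 0 = 0 := by simp [hu, hs.φ_0]
  have u_1 : u 1 = 0 := by simp [hu, hs.φ_1]
  have cub := cconj cu
  have cu1b := cconj cu1
  have cPinv : ContinuousOn (fun y => 1 / Pw V lam r y) (Icc 0 1) :=
    (continuousOn_const (c := (1:ℝ))).div (cPw (r := r) lam hp)
    (fun y _ => (Pw_pos lam V hr y).ne')
  have cR : ContinuousOn (Rk V lam r) (Icc 0 1) :=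
    (continuousOn_const (c := r ^ 6)).div ((cPw (r := r) lam hp).pow 2)
    (fun y _ => (pow_pos (Pw_pos lam V hr y) 2).ne')
  have ciV : ContinuousOn (fun y => 1 / V1 y) (Icc 0 1) :=
    (continuousOn_const (c := (1:ℝ))).div hp.cV1 (fun y hy => (hV1 y hy).ne')
  have ciV1 : ContinuousOn (fun y => -V2 y / V1 y ^ 2) (Icc 0 1) :=
    (hp.cV2.neg).div (hp.cV1.pow 2) (fun y hy => (pow_pos (hV1 y hy) 2).ne')
  have diV : ∀ y ∈ Ioo (0:ℝ) 1, HasDerivAt (fun y => 1 / V1 y) (-V2 y / V1 y ^ 2) y := by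
    intro y hy
    have h := (hasDerivAt_const y (1:ℝ)).div (hp.dV1 y hy) (hV1 y ⟨hy.1.le, hy.2.le⟩).ne'
    exact h.congr_deriv (by ring)
  have biV : ∀ y ∈ Icc (0:ℝ) 1, |1 / V1 y| ≤ M := by
    intro y hy
    rw [abs_of_pos (one_div_pos.2 (hV1 y hy)), div_le_iff₀ (hV1 y hy)]
    exact hp.lo y hy
  have biV1 : ∀ y ∈ Icc (0:ℝ) 1, |-V2 y / V1 y ^ 2| ≤ M ^ 3 := by
    intro y hy
    have : -V2 y / V1 y ^ 2 = -(V2 y * ((1 / V1 y) * (1 / V1 y))) := by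
      have := (hV1 y hy).ne'; field_simp
    rw [this, abs_neg, abs_mul, abs_mul]
    calc _ ≤ M * (M * M) := by
          have := biV y hy
          have := hp.b2 y hy
          gcongr
      _ = _ := by ring
  have dR : ∀ y ∈ Ioo (0:ℝ) 1, HasDerivAt (Rk V lam r) (-4 * kp V lam r y * V1 y * Rk V lam r y) y := by
    intro y hy
    have hP := Pw_pos lam V hr y
    have h := (hasDerivAt_const y (r ^ 6)).div ((dPw (r := r) lam hp y hy).pow 2) (pow_pos hP 2).ne'
    refine h.congr_deriv ?_
    unfold Rk kp
    simp only [Pi.pow_apply]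
    field_simp
    push_cast
    ring
  have cR1 : ContinuousOn (fun y => -4 * kp V lam r y * V1 y * Rk V lam r y) (Icc 0 1) :=
    ((continuousOn_const.mul (ckp lam hp hr)).mul hp.cV1).mul cR
  have dPinv : ∀ y ∈ Ioo (0:ℝ) 1, HasDerivAt (fun y => 1 / Pw V lam r y)
      (-(2 * (V y - lam) * V1 y) / Pw V lam r y ^ 2) y := by
    intro y hy
    have hP := Pw_pos lam V hr y
    have h := (hasDerivAt_const y (1:ℝ)).div (dPw (r := r) lam hp y hy) hP.ne'
    exact h.congr_deriv (by ring)
  have cPinv1 : ContinuousOn (fun y => -(2 * (V y - lam) * V1 y) / Pw V lam r y ^ 2) (Icc 0 1) :=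
    (((continuousOn_const.mul (hp.cV.sub continuousOn_const)).mul hp.cV1).neg).div
      ((cPw (r := r) lam hp).pow 2) (fun y _ => (pow_pos (Pw_pos lam V hr y) 2).ne')
  have cRC := cC cR
  have cR1C := cC cR1
  have ciVC := cC ciV
  have ciV1C := cC ciV1
  have cPiC := cC cPinv
  have cPi1C := cC cPinv1
  have hPb : ∀ y, 1 / Pw V lam r y = om V lam r y ^ 2 / r ^ 2 := by
    intro y; rw [om_sq lam V hr]; have := (Pw_pos lam V hr y).ne'; field_simp
  have hPb1 : ∀ y, |1 / Pw V lam r y| ≤ om V lam r y / r ^ 3 := by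
    intro y
    have h := om_le lam V hr y
    have h0 := om_nonneg lam V hr y
    rw [hPb, abs_of_nonneg (by positivity), div_le_div_iff₀ (by positivity) (by positivity)]
    have : om V lam r y ^ 2 * r ^ 3 = om V lam r y * r ^ 2 * (r * om V lam r y) := by ring
    rw [this]; exact mul_le_of_le_one_right (by positivity) h
  have hPb2 : ∀ y, |1 / Pw V lam r y| ≤ 1 / r ^ 4 := by
    intro y
    have h := om_le lam V hr y
    have h0 := om_nonneg lam V hr y
    refine (hPb1 y).trans ?_
    rw [div_le_div_iff₀ (by positivity) (by positivity)]
    have : om V lam r y * r ^ 4 = r ^ 3 * (r * om V lam r y) := by ring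
    rw [this]; have : r ^ 3 * (r * om V lam r y) ≤ r ^ 3 := mul_le_of_le_one_right (by positivity) h
    linarith
  -- test
  have t := testEq hp hs (fun y => (Rk V lam r y : ℂ) * (starRingEnd ℂ) (u y))
    (fun y => ((-4 * kp V lam r y * V1 y * Rk V lam r y : ℝ) : ℂ) * (starRingEnd ℂ) (u y)
      + (Rk V lam r y : ℂ) * (starRingEnd ℂ) (u1 y))
    (cRC.mul cub) ((cR1C.mul cub).add (cRC.mul cu1b))
    (fun y hy => (dR y hy).ofReal_comp.mul (du y hy).star) (by simp [u_0]) (by simp [u_1])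
  have i1 := ibp (fun y => ((1 / Pw V lam r y : ℝ) : ℂ))
    (fun y => ((-(2 * (V y - lam) * V1 y) / Pw V lam r y ^ 2 : ℝ) : ℂ))
    (fun y => (starRingEnd ℂ) (u y) * w y * ((1 / V1 y : ℝ) : ℂ))
    (fun y => ((starRingEnd ℂ) (u1 y) * w y + (starRingEnd ℂ) (u y) * w1 y) * ((1 / V1 y : ℝ) : ℂ)
      + (starRingEnd ℂ) (u y) * w y * ((-V2 y / V1 y ^ 2 : ℝ) : ℂ)) cPiC cPi1C
    ((cub.mul hs.cw).mul ciVC) ((((cu1b.mul hs.cw).add (cub.mul hs.cw1)).mul ciVC).add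
      ((cub.mul hs.cw).mul ciV1C)) (fun y hy => (dPinv y hy).ofReal_comp)
    (fun y hy => ((du y hy).star.mul (hs.dw y hy)).mul (diV y hy).ofReal_comp)
    (by simp [u_0]) (by simp [u_1])
  have i2 := ibp (fun y => (kp V lam r y : ℂ)) (fun y => (kp1 V V1 lam r y : ℂ))
    (fun y => (starRingEnd ℂ) (u y) * u y * ((1 / V1 y : ℝ) : ℂ))
    (fun y => ((starRingEnd ℂ) (u1 y) * u y + (starRingEnd ℂ) (u y) * u1 y) * ((1 / V1 y : ℝ) : ℂ)
      + (starRingEnd ℂ) (u y) * u y * ((-V2 y / V1 y ^ 2 : ℝ) : ℂ)) ck ck1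
    ((cub.mul cu).mul ciVC) ((((cu1b.mul cu).add (cub.mul cu1)).mul ciVC).add
      ((cub.mul cu).mul ciV1C)) (fun y hy => (dkp lam hp hr y hy).ofReal_comp)
    (fun y hy => ((du y hy).star.mul (du y hy)).mul (diV y hy).ofReal_comp)
    (by simp [u_0]) (by simp [u_1])
  -- identity
  have q1 : ((nw V lam r u ^ 2 : ℝ) : ℂ) = 2 * (∫ y in (0:ℝ)..1,
      (Rk V lam r y : ℂ) * (starRingEnd ℂ) (u y) * (V2 y : ℂ) * φ y)
      + (-(r:ℂ) ^ 2) * ∫ y in (0:ℝ)..1, (kp1 V V1 lam r y : ℂ) * ((starRingEnd ℂ) (u y) * u y * ((1 / V1 y : ℝ) : ℂ)) := by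
    rw [nw, nr_sq, ← intervalIntegral.integral_ofReal]
    apply lin2 _ _ (((cRC.mul cub).mul cV2).mul hs.cφ) (ck1.mul ((cub.mul cu).mul ciVC))
    intro y hy
    have h1 : om V lam r y ^ 2 = 2 * Rk V lam r y - r ^ 2 * (kp1 V V1 lam r y * (1 / V1 y)) := by
      have hP := (Pw_pos lam V hr y).ne'
      have hv := (hV1 y hy).ne'
      rw [om_sq lam V hr, Rk, kp1]
      field_simp
      unfold Pw
      ring
    have h2 : (((om V lam r y) ^ 2 : ℝ) : ℂ) = 2 * (Rk V lam r y : ℂ)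
        - (r:ℂ) ^ 2 * ((kp1 V V1 lam r y : ℂ) * ((1 / V1 y : ℝ) : ℂ)) := by
      exact_mod_cast h1
    have h3 : ((‖(om V lam r y : ℂ) * u y‖ ^ 2 : ℝ) : ℂ) =
        ((om V lam r y ^ 2 : ℝ) : ℂ) * ((starRingEnd ℂ) (u y) * u y) := by
      rw [norm_mul, mul_pow, nC, sq_abs, conj_mul_self']; push_cast; ring
    rw [h3, h2]
    simp only [hu, Pi.mul_apply]
    ring
  have q2 : (∫ y in (0:ℝ)..1, (Rk V lam r y : ℂ) * (starRingEnd ℂ) (u y) * ((V y - lam : ℝ) : ℂ) * w y)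
      = (r:ℂ) ^ 6 / 2 * ∫ y in (0:ℝ)..1, ((1 / Pw V lam r y : ℝ) : ℂ) *
      (((starRingEnd ℂ) (u1 y) * w y + (starRingEnd ℂ) (u y) * w1 y) * ((1 / V1 y : ℝ) : ℂ)
      + (starRingEnd ℂ) (u y) * w y * ((-V2 y / V1 y ^ 2 : ℝ) : ℂ)) := by
    rw [i1, mul_neg, ← neg_mul, ← intervalIntegral.integral_const_mul]
    apply intervalIntegral.integral_congr
    intro y hy
    rw [uIcc_of_le (by norm_num)] at hy
    have h1 : Rk V lam r y * (V y - lam) = - (r ^ 6 / 2) * ((-(2 * (V y - lam) * V1 y) / Pw V lam r y ^ 2) * (1 / V1 y)) := by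
      have hP := (Pw_pos lam V hr y).ne'
      have hv := (hV1 y hy).ne'
      rw [Rk]; field_simp
    have h2 : (Rk V lam r y : ℂ) * ((V y - lam : ℝ) : ℂ) = - ((r:ℂ) ^ 6 / 2) *
        (((-(2 * (V y - lam) * V1 y) / Pw V lam r y ^ 2 : ℝ) : ℂ) * ((1 / V1 y : ℝ) : ℂ)) := by
      exact_mod_cast h1
    show (Rk V lam r y : ℂ) * (starRingEnd ℂ) (u y) * ((V y - lam : ℝ) : ℂ) * w y = _
    linear_combination ((starRingEnd ℂ) (u y) * w y) * h2
  -- bounds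
  have n1 : ‖∫ y in (0:ℝ)..1, ((1 / Pw V lam r y : ℝ) : ℂ) *
      (((starRingEnd ℂ) (u1 y) * w y + (starRingEnd ℂ) (u y) * w1 y) * ((1 / V1 y : ℝ) : ℂ)
      + (starRingEnd ℂ) (u y) * w y * ((-V2 y / V1 y ^ 2 : ℝ) : ℂ))‖ ≤
      M / r ^ 4 * (nr u1 * nr w) + M / r ^ 3 * (nw V lam r u * nr w1)
      + M ^ 3 / r ^ 3 * (nw V lam r u * nr w) := by
    rw [lin3 (A := fun y => ((1 / Pw V lam r y : ℝ) : ℂ) * ((starRingEnd ℂ) (u1 y) * w y * ((1 / V1 y : ℝ) : ℂ)))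
      (B := fun y => ((1 / Pw V lam r y : ℝ) : ℂ) * ((starRingEnd ℂ) (u y) * w1 y * ((1 / V1 y : ℝ) : ℂ)))
      (C := fun y => ((1 / Pw V lam r y : ℝ) : ℂ) * ((starRingEnd ℂ) (u y) * w y * ((-V2 y / V1 y ^ 2 : ℝ) : ℂ)))
      1 1 1 (cPiC.mul ((cu1b.mul hs.cw).mul ciVC)) (cPiC.mul ((cub.mul hs.cw1).mul ciVC))
      (cPiC.mul ((cub.mul hs.cw).mul ciV1C)) (fun y _ => by ring), one_mul, one_mul, one_mul]
    refine norm_add₃_le.trans (add_le_add (add_le_add ?_ ?_) ?_)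
    · apply csb _ u1 w _ (by positivity) cu1 hs.cw
      intro y hy
      simp only [norm_mul, nC, RCLike.norm_conj]
      calc _ ≤ 1 / r ^ 4 * (‖u1 y‖ * ‖w y‖ * M) := by
            have := hPb2 y; have := biV y hy; gcongr
        _ = _ := by ring
    · apply csb _ (fun y => (om V lam r y : ℂ) * u y) w1 _ (by positivity) (co.mul cu) hs.cw1
      intro y hy
      simp only [norm_mul, nC, RCLike.norm_conj, abs_of_nonneg (om_nonneg lam V hr y)]
      have h0 := om_nonneg lam V hr y
      calc _ ≤ om V lam r y / r ^ 3 * (‖u y‖ * ‖w1 y‖ * M) := by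
            have := hPb1 y; have := biV y hy; gcongr
        _ = _ := by ring
    · apply csb _ (fun y => (om V lam r y : ℂ) * u y) w _ (by positivity) (co.mul cu) hs.cw
      intro y hy
      simp only [norm_mul, nC, RCLike.norm_conj, abs_of_nonneg (om_nonneg lam V hr y)]
      have h0 := om_nonneg lam V hr y
      calc _ ≤ om V lam r y / r ^ 3 * (‖u y‖ * ‖w y‖ * M ^ 3) := by
            have := hPb1 y; have := biV1 y hy; gcongr
        _ = _ := by ring
  have hu_le : nr u ≤ nr u1 := nr_le_const u _ (nr_nonneg _) cu
    (fun y hy => nsup_le u u1 cu cu1 du u_0 y hy)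
  have n2 : ‖∫ y in (0:ℝ)..1, (kp V lam r y : ℂ) *
      (((starRingEnd ℂ) (u1 y) * u y + (starRingEnd ℂ) (u y) * u1 y) * ((1 / V1 y : ℝ) : ℂ)
      + (starRingEnd ℂ) (u y) * u y * ((-V2 y / V1 y ^ 2 : ℝ) : ℂ))‖ ≤
      2 * M / r * (nw V lam r u * nr u1) + M ^ 3 / r * (nw V lam r u * nr u) := by
    rw [lin2 (A := fun y => (kp V lam r y : ℂ) * (((starRingEnd ℂ) (u1 y) * u y + (starRingEnd ℂ) (u y) * u1 y) * ((1 / V1 y : ℝ) : ℂ)))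
      (B := fun y => (kp V lam r y : ℂ) * ((starRingEnd ℂ) (u y) * u y * ((-V2 y / V1 y ^ 2 : ℝ) : ℂ)))
      1 1 (ck.mul (((cu1b.mul cu).add (cub.mul cu1)).mul ciVC)) (ck.mul ((cub.mul cu).mul ciV1C))
      (fun y _ => by ring), one_mul, one_mul]
    refine (norm_add_le _ _).trans (add_le_add ?_ ?_)
    · apply csb _ (fun y => (om V lam r y : ℂ) * u y) u1 _ (by positivity) (co.mul cu) cu1
      intro y hy
      have h5 : ‖(starRingEnd ℂ) (u1 y) * u y + (starRingEnd ℂ) (u y) * u1 y‖ ≤ 2 * (‖u y‖ * ‖u1 y‖) := by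
        refine (norm_add_le _ _).trans ?_
        simp only [norm_mul, RCLike.norm_conj]; linarith
      rw [norm_mul, norm_mul, norm_mul, nC, nC, nC, abs_of_nonneg (om_nonneg lam V hr y)]
      have h0 := om_nonneg lam V hr y
      calc _ ≤ om V lam r y / r * (2 * (‖u y‖ * ‖u1 y‖) * M) := by
            have := kp_le lam V hr y; have := biV y hy; gcongr
        _ = _ := by ring
    · apply csb _ (fun y => (om V lam r y : ℂ) * u y) u _ (by positivity) (co.mul cu) cu
      intro y hy
      simp only [norm_mul, nC, RCLike.norm_conj, abs_of_nonneg (om_nonneg lam V hr y)]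
      have h0 := om_nonneg lam V hr y
      calc _ ≤ om V lam r y / r * (‖u y‖ * ‖u y‖ * M ^ 3) := by
            have := kp_le lam V hr y; have := biV1 y hy; gcongr
        _ = _ := by ring
  have n3 : ∀ h : ℝ → ℂ, ContinuousOn h (Icc 0 1) →
      ‖∫ y in (0:ℝ)..1, (Rk V lam r y : ℂ) * (starRingEnd ℂ) (u y) * h y‖ ≤ 1 / r * (nw V lam r u * nr h) := by
    intro h ch
    apply csb _ (fun y => (om V lam r y : ℂ) * u y) h _ (by positivity) (co.mul cu) ch
    intro y hy
    simp only [norm_mul, nC, RCLike.norm_conj, abs_of_nonneg (om_nonneg lam V hr y), abs_of_nonneg (Rk_nonneg (lam := lam) V hr y)]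
    calc _ ≤ om V lam r y / r * ‖u y‖ * ‖h y‖ := by
            have := Rk_le (lam := lam) V hr y; gcongr
      _ = _ := by ring
  have n4 : ‖∫ y in (0:ℝ)..1, (((-4 * kp V lam r y * V1 y * Rk V lam r y : ℝ) : ℂ) * (starRingEnd ℂ) (u y)
      + (Rk V lam r y : ℂ) * (starRingEnd ℂ) (u1 y)) * w1 y‖ ≤
      4 * M / r ^ 3 * (nw V lam r u * nr w1) + 1 / r ^ 2 * (nr u1 * nr w1) := by
    rw [lin2 (A := fun y => ((-4 * kp V lam r y * V1 y * Rk V lam r y : ℝ) : ℂ) * (starRingEnd ℂ) (u y) * w1 y)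
      (B := fun y => (Rk V lam r y : ℂ) * (starRingEnd ℂ) (u1 y) * w1 y) 1 1
      ((cR1C.mul cub).mul hs.cw1) ((cRC.mul cu1b).mul hs.cw1) (fun y _ => by ring), one_mul, one_mul]
    refine (norm_add_le _ _).trans (add_le_add ?_ ?_)
    · apply csb _ (fun y => (om V lam r y : ℂ) * u y) w1 _ (by positivity) (co.mul cu) hs.cw1
      intro y hy
      have h0 := om_nonneg lam V hr y
      have h6 : |-4 * kp V lam r y * V1 y * Rk V lam r y| ≤ 4 * (1 / r ^ 2) * M * (om V lam r y / r) := by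
        rw [abs_mul, abs_mul, abs_mul, abs_of_nonneg (Rk_nonneg (lam := lam) V hr y), abs_of_pos (hV1 y hy)]
        have := Rk_le (lam := lam) V hr y
        have := kp_le2 lam V hr y
        have := hp.hi y hy
        have := (hV1 y hy).le
        have h4 : |(-4:ℝ)| = 4 := by norm_num
        have := Rk_nonneg (lam := lam) V hr y
        rw [h4]
        gcongr
      rw [norm_mul, norm_mul, norm_mul, nC, nC, abs_of_nonneg h0, RCLike.norm_conj]
      calc _ ≤ 4 * (1 / r ^ 2) * M * (om V lam r y / r) * ‖u y‖ * ‖w1 y‖ := by gcongr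
        _ = _ := by field_simp
    · apply csb _ u1 w1 _ (by positivity) cu1 hs.cw1
      intro y hy
      simp only [norm_mul, nC, RCLike.norm_conj, abs_of_nonneg (Rk_nonneg (lam := lam) V hr y)]
      calc _ ≤ 1 / r ^ 2 * ‖u1 y‖ * ‖w1 y‖ := by
            have := Rk_le2 (lam := lam) V hr y; gcongr
        _ = _ := by ring
  have n3f := n3 f hs.cf
  have n3w := n3 w hs.cw
  -- combine
  rw [q2] at t
  have i2' : (∫ y in (0:ℝ)..1, (kp1 V V1 lam r y : ℂ) * ((starRingEnd ℂ) (u y) * u y * ((1 / V1 y : ℝ) : ℂ)))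
     = -(∫ y in (0:ℝ)..1, (kp V lam r y : ℂ) *
      (((starRingEnd ℂ) (u1 y) * u y + (starRingEnd ℂ) (u y) * u1 y) * ((1 / V1 y : ℝ) : ℂ)
      + (starRingEnd ℂ) (u y) * u y * ((-V2 y / V1 y ^ 2 : ℝ) : ℂ))) := by
    rw [i2, neg_neg]
  rw [i2'] at q1
  generalize (∫ y in (0:ℝ)..1, (Rk V lam r y : ℂ) * (starRingEnd ℂ) (u y) * (V2 y : ℂ) * φ y) = z0 at *
  generalize (∫ y in (0:ℝ)..1, ((1 / Pw V lam r y : ℝ) : ℂ) *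
      (((starRingEnd ℂ) (u1 y) * w y + (starRingEnd ℂ) (u y) * w1 y) * ((1 / V1 y : ℝ) : ℂ)
      + (starRingEnd ℂ) (u y) * w y * ((-V2 y / V1 y ^ 2 : ℝ) : ℂ))) = z1 at *
  generalize (∫ y in (0:ℝ)..1, (kp V lam r y : ℂ) *
      (((starRingEnd ℂ) (u1 y) * u y + (starRingEnd ℂ) (u y) * u1 y) * ((1 / V1 y : ℝ) : ℂ)
      + (starRingEnd ℂ) (u y) * u y * ((-V2 y / V1 y ^ 2 : ℝ) : ℂ))) = z2 at *
  generalize (∫ y in (0:ℝ)..1, (Rk V lam r y : ℂ) * (starRingEnd ℂ) (u y) * f y) = z3 at *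
  generalize (∫ y in (0:ℝ)..1, (Rk V lam r y : ℂ) * (starRingEnd ℂ) (u y) * w y) = z4 at *
  generalize (∫ y in (0:ℝ)..1, (((-4 * kp V lam r y * V1 y * Rk V lam r y : ℝ) : ℂ) * (starRingEnd ℂ) (u y)
      + (Rk V lam r y : ℂ) * (starRingEnd ℂ) (u1 y)) * w1 y) = z5 at *
  have final : ((nw V lam r u ^ 2 : ℝ) : ℂ) = (r:ℂ) ^ 6 * z1 + (-2) * z3
     + (-2) * (Complex.I * (τ : ℂ) * (r : ℂ) ^ 6 * z5)
     + (-2) * ((Complex.I * (τ : ℂ) * (r : ℂ) ^ 6 * (K : ℂ) ^ 2 - o) * z4) + (r:ℂ) ^ 2 * z2 := by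
    rw [q1]
    linear_combination (-2) * t
  have nf := congrArg norm final
  rw [nC, abs_of_nonneg (sq_nonneg _)] at nf
  have m1 := nI ((r:ℂ) ^ 6) z1 (pow_nonneg hr.le 6) (by rw [norm_pow, nC, abs_of_pos hr]) n1
  have m2 := nI ((r:ℂ) ^ 2) z2 (pow_nonneg hr.le 2) (by rw [norm_pow, nC, abs_of_pos hr]) n2
  have n2' : ‖(-2:ℂ)‖ ≤ 2 := by simp
  have m3 := nI (-2) z3 (by norm_num) n2' n3f
  have m5 := nI (-2) _ (by norm_num) n2' (nI _ _ (by positivity) (normτ hs).le n4)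
  have m4 := nI (-2) _ (by norm_num) n2' (nI _ _ (mul_nonneg (sq_nonneg r) (add_nonneg (by positivity) hs.he))
    (normKo hs) n3w)
  have tri := nf.le.trans <|
    (norm_add_le _ _).trans (add_le_add ((norm_add_le _ _).trans (add_le_add
      ((norm_add_le _ _).trans (add_le_add ((norm_add_le _ _).trans (add_le_add m1 m3)) m5)) m4)) m2)
  have hQ := nw_nonneg V lam r u
  generalize nw V lam r u = Q at *
  have hw := nr_nonneg w
  have hw1 := nr_nonneg w1
  have hU0 := nr_nonneg u1
  have g1 : r ^ 6 * (M / r ^ 4 * (nr u1 * nr w) + M / r ^ 3 * (Q * nr w1) + M ^ 3 / r ^ 3 * (Q * nr w))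
     = M * r * nr u1 * (r * nr w) + M * Q * (r ^ 3 * nr w1) + M ^ 3 * r ^ 2 * Q * (r * nr w) := by field_simp
  have g2 : r ^ 2 * (2 * M / r * (Q * nr u1) + M ^ 3 / r * (Q * nr u)) = r * Q * (2 * M * nr u1 + M ^ 3 * nr u) := by
    field_simp
  have g5 : 2 * (r ^ 6 * (4 * M / r ^ 3 * (Q * nr w1) + 1 / r ^ 2 * (nr u1 * nr w1))) =
     8 * M * Q * (r ^ 3 * nr w1) + 2 * r * nr u1 * (r ^ 3 * nr w1) := by field_simp; ring
  have g4 : 2 * (r ^ 2 * (K ^ 2 * r ^ 4 + e) * (1 / r * (Q * nr w))) = 2 * (K ^ 2 * r ^ 4 + e) * Q * (r * nr w) := by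
    field_simp
  rw [g1, g2, g5, g4] at tri
  have k1 : r * Q * (2 * M * nr u1 + M ^ 3 * nr u) ≤ r * Q * (3 * M ^ 3 * nr u1) := by
    have h7 : M ≤ M ^ 3 := by nlinarith [sq_nonneg M]
    have : M ^ 3 * nr u ≤ M ^ 3 * nr u1 := by gcongr
    have : M * nr u1 ≤ M ^ 3 * nr u1 := by gcongr
    gcongr; linarith
  have k2 : r * nr u1 * (M * (r * nr w) + 2 * (r ^ 3 * nr w1) + 3 * M ^ 3 * Q) ≤
     r * (2 * M * EE K φ φ1) * (M * (r * nr w) + 2 * (r ^ 3 * nr w1) + 3 * M ^ 3 * Q) := by gcongr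
  have g3 : 2 * (1 / r * (Q * nr f)) = 2 * (Q * (nr f / r)) := by ring
  rw [g3] at tri
  linarith
end sol

section prof
variable {M : ℝ} {V V1 V2 V3 : ℝ → ℝ}

lemma Prof.V1pos (hp : Prof M V V1 V2 V3) (y : ℝ) (hy : y ∈ Icc (0:ℝ) 1) : 0 < V1 y := by
  nlinarith [hp.lo y hy, hp.hM]

lemma Prof.ftcV (hp : Prof M V V1 V2 V3) {x y : ℝ} (hx : 0 ≤ x) (hy : y ≤ 1) (hxy : x ≤ y) :
    V y - V x ≤ M * (y - x) ∧ y - x ≤ M * (V y - V x) := by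
  rcases hxy.eq_or_lt with h | h
  · subst h; simp
  have hsub : Icc x y ⊆ Icc (0:ℝ) 1 := Icc_subset_Icc hx hy
  obtain ⟨c, hc, hd⟩ := exists_hasDerivAt_eq_slope V V1 h (hp.cV.mono hsub)
    (fun t ht => hp.dV t ⟨lt_of_le_of_lt hx ht.1, lt_of_lt_of_le ht.2 hy⟩)
  have hc' : c ∈ Icc (0:ℝ) 1 := hsub ⟨hc.1.le, hc.2.le⟩
  have h1 := hp.lo c hc'
  have h2 := hp.hi c hc'
  have h3 : 0 < y - x := by linarith
  rw [eq_div_iff h3.ne'] at hd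
  constructor
  · rw [← hd]; gcongr
  · rw [← hd]; nlinarith

lemma Prof.lip (hp : Prof M V V1 V2 V3) {x y : ℝ} (hx : x ∈ Icc (0:ℝ) 1) (hy : y ∈ Icc (0:ℝ) 1) :
    |V y - V x| ≤ M * |y - x| ∧ |y - x| ≤ M * |V y - V x| := by
  have hM := hp.hM
  rcases le_total x y with h | h
  · have := hp.ftcV hx.1 hy.2 h
    have h0 : 0 ≤ V y - V x := by nlinarith
    rw [abs_of_nonneg h0, abs_of_nonneg (by linarith)]; exact this
  · have := hp.ftcV hy.1 hx.2 h
    have h0 : 0 ≤ V x - V y := by nlinarith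
    rw [abs_sub_comm (V y), abs_sub_comm y, abs_of_nonneg h0, abs_of_nonneg (by linarith)]; exact this

lemma Prof.osc (hp : Prof M V V1 V2 V3) {x y : ℝ} (hx : x ∈ Icc (0:ℝ) 1) (hy : y ∈ Icc (0:ℝ) 1) :
    |V y - V x| ≤ M := by
  have := (hp.lip hx hy).1
  have hM := hp.hM
  have : |y - x| ≤ 1 := by rw [abs_le]; constructor <;> linarith [hx.1, hx.2, hy.1, hy.2]
  nlinarith

lemma Prof.biV (hp : Prof M V V1 V2 V3) : ∀ y ∈ Icc (0:ℝ) 1, |1 / V1 y| ≤ M := by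
  intro y hy
  have hV1 := hp.V1pos y hy
  rw [abs_of_pos (one_div_pos.2 hV1), div_le_iff₀ hV1]
  exact hp.lo y hy

lemma Prof.biV1 (hp : Prof M V V1 V2 V3) : ∀ y ∈ Icc (0:ℝ) 1, |-V2 y / V1 y ^ 2| ≤ M ^ 3 := by
  intro y hy
  have hM := hp.hM
  have : -V2 y / V1 y ^ 2 = -(V2 y * ((1 / V1 y) * (1 / V1 y))) := by
    have := (hp.V1pos y hy).ne'; field_simp
  rw [this, abs_neg, abs_mul, abs_mul]
  calc _ ≤ M * (M * M) := by
        have := hp.biV y hy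
        have := hp.b2 y hy
        gcongr
    _ = _ := by ring

lemma Prof.ciV (hp : Prof M V V1 V2 V3) : ContinuousOn (fun y => 1 / V1 y) (Icc 0 1) :=
  (continuousOn_const (c := (1:ℝ))).div hp.cV1 (fun y hy => (hp.V1pos y hy).ne')

lemma Prof.ciV1 (hp : Prof M V V1 V2 V3) : ContinuousOn (fun y => -V2 y / V1 y ^ 2) (Icc 0 1) :=
  (hp.cV2.neg).div (hp.cV1.pow 2) (fun y hy => (pow_pos (hp.V1pos y hy) 2).ne')

lemma Prof.diV (hp : Prof M V V1 V2 V3) : ∀ y ∈ Ioo (0:ℝ) 1,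
    HasDerivAt (fun y => 1 / V1 y) (-V2 y / V1 y ^ 2) y := by
  intro y hy
  have h := (hasDerivAt_const y (1:ℝ)).div (hp.dV1 y hy) (hp.V1pos y ⟨hy.1.le, hy.2.le⟩).ne'
  exact h.congr_deriv (by ring)

/-- uniform integrability of `P^(-1/4)` -/
lemma int_P4 (hp : Prof M V V1 V2 V3) {r lam A : ℝ} (hr : 0 < r) (hA : 1 ≤ A)
    (h : ∀ y ∈ Icc (0:ℝ) 1, |V y - lam| ≤ A) :
    ∫ y in (0:ℝ)..1, (Pw V lam r y) ^ (-(1/4):ℝ) ≤ 4 * M * A := by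
  have hM := hp.hM
  have hP := fun y => Pw_pos lam V hr y
  have cPp : ContinuousOn (fun y => (Pw V lam r y) ^ (-(1/4):ℝ)) (Icc 0 1) :=
    (cPw lam hp).rpow_const (fun y _ => Or.inl (hP y).ne')
  have cPp5 : ContinuousOn (fun y => (Pw V lam r y) ^ (-(1/4) - 1:ℝ)) (Icc 0 1) :=
    (cPw lam hp).rpow_const (fun y _ => Or.inl (hP y).ne')
  have cs : ContinuousOn (fun y => V y - lam) (Icc 0 1) := hp.cV.sub continuousOn_const
  have cD : ContinuousOn (fun y => V1 y * (Pw V lam r y) ^ (-(1/4):ℝ) + (V y - lam) *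
      ((2 * (V y - lam) * V1 y) * (-(1/4)) * (Pw V lam r y) ^ (-(1/4) - 1:ℝ))) (Icc 0 1) :=
    (hp.cV1.mul cPp).add (cs.mul ((((continuousOn_const.mul cs).mul hp.cV1).mul
      continuousOn_const).mul cPp5))
  have e := intervalIntegral.integral_eq_sub_of_hasDerivAt_of_le
    (f := fun y => (V y - lam) * (Pw V lam r y) ^ (-(1/4):ℝ))
    (f' := fun y => V1 y * (Pw V lam r y) ^ (-(1/4):ℝ) + (V y - lam) *
      ((2 * (V y - lam) * V1 y) * (-(1/4)) * (Pw V lam r y) ^ (-(1/4) - 1:ℝ)))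
    (zero_le_one) (cs.mul cPp)
    (fun y hy => ((hp.dV y hy).sub_const lam).mul
      ((dPw (r := r) lam hp y hy).rpow_const (Or.inl (hP y).ne'))) (ii_of_cont cD)
  have bd : ∀ y ∈ Icc (0:ℝ) 1, |(V y - lam) * (Pw V lam r y) ^ (-(1/4):ℝ)| ≤ A := by
    intro y hy
    rw [abs_mul, abs_of_pos (Real.rpow_pos_of_pos (hP y) _)]
    rcases le_total 1 (Pw V lam r y) with h1 | h1
    · have h2 : (Pw V lam r y) ^ (-(1/4):ℝ) ≤ 1 := Real.rpow_le_one_of_one_le_of_nonpos h1 (by norm_num)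
      have := h y hy
      have := mul_le_mul this h2 (Real.rpow_pos_of_pos (hP y) _).le (by linarith)
      linarith
    · have h2 : |V y - lam| ≤ (Pw V lam r y) ^ (1/2:ℝ) := by
        rw [← Real.sqrt_eq_rpow]
        apply Real.abs_le_sqrt
        unfold Pw; nlinarith [pow_pos hr 4]
      calc |V y - lam| * (Pw V lam r y) ^ (-(1/4):ℝ) ≤ (Pw V lam r y) ^ (1/2:ℝ) * (Pw V lam r y) ^ (-(1/4):ℝ) := by
            gcongr
            exact (Real.rpow_pos_of_pos (hP y) _).le
        _ = (Pw V lam r y) ^ (1/4:ℝ) := by rw [← Real.rpow_add (hP y)]; norm_num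
        _ ≤ 1 := Real.rpow_le_one (hP y).le h1 (by norm_num)
        _ ≤ A := hA
  have b0 := abs_le.1 (bd 0 (by simp))
  have b1 := abs_le.1 (bd 1 (by simp))
  have mono : ∫ y in (0:ℝ)..1, (Pw V lam r y) ^ (-(1/4):ℝ) ≤ ∫ y in (0:ℝ)..1,
    2 * M * (V1 y * (Pw V lam r y) ^ (-(1/4):ℝ) + (V y - lam) *
      ((2 * (V y - lam) * V1 y) * (-(1/4)) * (Pw V lam r y) ^ (-(1/4) - 1:ℝ))) := by
    apply intervalIntegral.integral_mono_on (by norm_num) (ii_of_cont cPp)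
      (ii_of_cont (continuousOn_const.mul cD))
    intro y hy
    show (Pw V lam r y) ^ (-(1/4):ℝ) ≤ 2 * M * (V1 y * (Pw V lam r y) ^ (-(1/4):ℝ) + (V y - lam) * ((2 * (V y - lam) * V1 y) * (-(1/4)) * (Pw V lam r y) ^ (-(1/4) - 1:ℝ)))
    have hlo := hp.lo y hy
    have hV1 := hp.V1pos y hy
    have h5 : (Pw V lam r y) ^ (-(1/4) - 1:ℝ) = (Pw V lam r y) ^ (-(1/4):ℝ) / Pw V lam r y := by
      rw [Real.rpow_sub (hP y), Real.rpow_one]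
    rw [h5]
    have h6 := Real.rpow_pos_of_pos (hP y) (-(1/4):ℝ)
    set X := (Pw V lam r y) ^ (-(1/4):ℝ)
    have h7 : (V y - lam) ^ 2 / Pw V lam r y ≤ 1 := by
      rw [div_le_one (hP y)]; unfold Pw; nlinarith [pow_pos hr 4]
    have h8 : 2 * M * (V1 y * X + (V y - lam) * (2 * (V y - lam) * V1 y * (-(1/4)) * (X / Pw V lam r y)))
       = (M * V1 y) * X * (2 - (V y - lam) ^ 2 / Pw V lam r y) := by
      have := (hP y).ne'
      field_simp; ring
    rw [h8]
    nlinarith [mul_pos (by linarith : 0 < M * V1 y) h6]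
  rw [intervalIntegral.integral_const_mul, e] at mono
  nlinarith [b0.1, b0.2, b1.1, b1.2]

lemma log_le_pow {x : ℝ} (hx : 0 ≤ x) : Real.log (1 + x) ≤ 8 * x ^ (1/8:ℝ) := by
  have h1 : Real.log (1 + x) ≤ (1 + x) ^ (1/8:ℝ) / (1/8) - 8 := by
    have := Real.log_le_sub_one_of_pos (Real.rpow_pos_of_pos (by linarith : 0 < 1 + x) (1/8:ℝ))
    rw [Real.log_rpow (by linarith)] at this
    linarith
  have h2 : (1 + x) ^ (1/8:ℝ) ≤ 1 ^ (1/8:ℝ) + x ^ (1/8:ℝ) :=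
    Real.rpow_add_le_add_rpow zero_le_one hx (by norm_num) (by norm_num)
  rw [Real.one_rpow] at h2
  linarith

lemma log_cmp_pt {P P' T : ℝ} (hP : 0 < P) (hP' : 0 < P') (h : |P - P'| ≤ T) :
    (Real.log P - Real.log P') ^ 2 ≤ 64 * T ^ (1/4:ℝ) * (P ^ (-(1/4):ℝ) + P' ^ (-(1/4):ℝ)) := by
  have hT : 0 ≤ T := (abs_nonneg _).trans h
  have key : ∀ a b : ℝ, 0 < a → a ≤ b → b - a ≤ T →
      (Real.log b - Real.log a) ^ 2 ≤ 64 * T ^ (1/4:ℝ) * a ^ (-(1/4):ℝ) := by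
    intro a b ha hab hT'
    have h1 : Real.log b - Real.log a = Real.log (1 + (b - a) / a) := by
      rw [← Real.log_div (by linarith) ha.ne']; congr 1; field_simp; ring
    have h0 : 0 ≤ (b - a) / a := div_nonneg (by linarith) ha.le
    have h2 : 0 ≤ Real.log (1 + (b - a) / a) := Real.log_nonneg (by linarith)
    have h3 := log_le_pow h0
    rw [h1]
    calc _ ≤ (8 * ((b - a) / a) ^ (1/8:ℝ)) ^ 2 := by gcongr
      _ = 64 * ((b - a) / a) ^ (1/4:ℝ) := by
        rw [mul_pow, ← Real.rpow_natCast (((b - a) / a) ^ (1/8:ℝ)), ← Real.rpow_mul h0]; norm_num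
      _ ≤ 64 * (T / a) ^ (1/4:ℝ) := by gcongr
      _ = _ := by rw [Real.div_rpow hT ha.le, Real.rpow_neg ha.le]; ring
  have q1 := Real.rpow_pos_of_pos hP (-(1/4):ℝ)
  have q2 := Real.rpow_pos_of_pos hP' (-(1/4):ℝ)
  have q3 := Real.rpow_nonneg hT (1/4:ℝ)
  rw [abs_le] at h
  rcases le_total P P' with hh | hh
  · have := key P P' hP hh (by linarith)
    nlinarith [mul_nonneg q3 q2.le]
  · have := key P' P hP' hh (by linarith)
    nlinarith [mul_nonneg q3 q1.le]

set_option maxHeartbeats 1000000 in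
lemma logCmp (hp : Prof M V V1 V2 V3) {r lam r' lam' A T : ℝ} (hr : 0 < r) (hr' : 0 < r') (hA : 1 ≤ A)
    (h : ∀ y ∈ Icc (0:ℝ) 1, |V y - lam| ≤ A) (h' : ∀ y ∈ Icc (0:ℝ) 1, |V y - lam'| ≤ A)
    (hT : ∀ y ∈ Icc (0:ℝ) 1, |Pw V lam r y - Pw V lam' r' y| ≤ T)
    (p p1 : ℝ → ℂ) (cp : ContinuousOn p (Icc 0 1)) (cp1 : ContinuousOn p1 (Icc 0 1))
    (dp : ∀ y ∈ Ioo (0:ℝ) 1, HasDerivAt p (p1 y) y) (p_0 : p 0 = 0) (p_1 : p 1 = 0) :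
    ‖(∫ y in (0:ℝ)..1, (kp V lam r y : ℂ) * p y) - ∫ y in (0:ℝ)..1, (kp V lam' r' y : ℂ) * p y‖
      ≤ 512 * M ^ 4 * A * T ^ (1/8:ℝ) * nr p1 := by
  have hM := hp.hM
  have hM0 : 0 ≤ M := by linarith
  have hT0 : 0 ≤ T := (abs_nonneg _).trans (hT 0 (by simp))
  have ck := cC (ckp (r := r) lam hp hr)
  have ck' := cC (ckp (r := r') lam' hp hr')
  have ciVC := cC hp.ciV
  have ciV1C := cC hp.ciV1
  have clog : ∀ l q : ℝ, 0 < q → ContinuousOn (fun y => Real.log (Pw V l q y)) (Icc 0 1) :=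
    fun l q hq => (cPw l hp).log (fun y _ => (Pw_pos l V hq y).ne')
  have ckr : ∀ l q : ℝ, 0 < q → ContinuousOn (fun y => 2 * kp V l q y * V1 y) (Icc 0 1) :=
    fun l q hq => (continuousOn_const.mul (ckp l hp hq)).mul hp.cV1
  have dlog : ∀ l q : ℝ, 0 < q → ∀ y ∈ Ioo (0:ℝ) 1, HasDerivAt (fun y => Real.log (Pw V l q y))
      (2 * kp V l q y * V1 y) y := fun l q hq y hy => by
    have := (dPw (r := q) l hp y hy).log (Pw_pos l V hq y).ne'
    refine this.congr_deriv ?_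
    unfold kp; ring
  set Lg : ℝ → ℝ := fun y => Real.log (Pw V lam r y) - Real.log (Pw V lam' r' y) with hLg
  have cL : ContinuousOn Lg (Icc 0 1) := (clog lam r hr).sub (clog lam' r' hr')
  have cLC := cC cL
  set b1 : ℝ → ℂ := fun y => p1 y * ((1 / V1 y : ℝ) : ℂ) + p y * ((-V2 y / V1 y ^ 2 : ℝ) : ℂ) with hb1
  have cb1 : ContinuousOn b1 (Icc 0 1) := (cp1.mul ciVC).add (cp.mul ciV1C)
  have i := ibp (fun y => (Lg y : ℂ)) (fun y => ((2 * kp V lam r y * V1 y - 2 * kp V lam' r' y * V1 y : ℝ) : ℂ))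
    (fun y => p y * ((1 / V1 y : ℝ) : ℂ)) b1 cLC (cC ((ckr lam r hr).sub (ckr lam' r' hr')))
    (cp.mul ciVC) cb1
    (fun y hy => ((dlog lam r hr y hy).sub (dlog lam' r' hr' y hy)).ofReal_comp)
    (fun y hy => (dp y hy).mul (hp.diV y hy).ofReal_comp) (by simp [p_0]) (by simp [p_1])
  have e : (∫ y in (0:ℝ)..1, ((2 * kp V lam r y * V1 y - 2 * kp V lam' r' y * V1 y : ℝ) : ℂ) * (p y * ((1 / V1 y : ℝ) : ℂ)))
    = 2 * (∫ y in (0:ℝ)..1, (kp V lam r y : ℂ) * p y) + (-2) * ∫ y in (0:ℝ)..1, (kp V lam' r' y : ℂ) * p y := by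
    apply lin2 _ _ (ck.mul cp) (ck'.mul cp)
    intro y hy
    have hv : (V1 y : ℂ) ≠ 0 := by exact_mod_cast (hp.V1pos y hy).ne'
    simp only [Pi.mul_apply]
    push_cast
    field_simp
    ring
  rw [e] at i
  have e2 : (∫ y in (0:ℝ)..1, (kp V lam r y : ℂ) * p y) - (∫ y in (0:ℝ)..1, (kp V lam' r' y : ℂ) * p y)
     = (-1/2) * ∫ y in (0:ℝ)..1, (Lg y : ℂ) * b1 y := by rw [i]; ring
  rw [e2]
  have nl : ‖∫ y in (0:ℝ)..1, (Lg y : ℂ) * b1 y‖ ≤ 1 * (nr (fun y => (Lg y : ℂ)) * nr b1) :=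
    csb _ _ _ 1 zero_le_one cLC cb1 (fun y _ => by rw [norm_mul, one_mul])
  have hp_le : nr p ≤ nr p1 := nr_le_const p _ (nr_nonneg _) cp
    (fun y hy => nsup_le p p1 cp cp1 dp p_0 y hy)
  have nb1 : nr b1 ≤ 2 * M ^ 3 * nr p1 := by
    refine (nr_add (fun y => p1 y * ((1 / V1 y : ℝ) : ℂ)) (fun y => p y * ((-V2 y / V1 y ^ 2 : ℝ) : ℂ))
      (cp1.mul ciVC) (cp.mul ciV1C)).trans ?_
    have h1 := nr_le (fun y => p1 y * ((1 / V1 y : ℝ) : ℂ)) p1 M hM0 (cp1.mul ciVC) cp1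
      (fun y hy => by rw [norm_mul, nC, mul_comm]; gcongr; exact hp.biV y hy)
    have h2 := nr_le (fun y => p y * ((-V2 y / V1 y ^ 2 : ℝ) : ℂ)) p (M ^ 3) (by positivity) (cp.mul ciV1C) cp
      (fun y hy => by rw [norm_mul, nC, mul_comm]; gcongr; exact hp.biV1 y hy)
    have h3 : M ≤ M ^ 3 := by nlinarith [sq_nonneg M]
    have h4 := nr_nonneg p1
    have h5 : M ^ 3 * nr p ≤ M ^ 3 * nr p1 := by gcongr
    have h6 : M * nr p1 ≤ M ^ 3 * nr p1 := by gcongr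
    linarith
  have nL : nr (fun y => (Lg y : ℂ)) ≤ 512 * M * A * T ^ (1/8:ℝ) := by
    apply abs_le_of_sq_le_sq' _ (by positivity) |>.2
    have c1 : ContinuousOn (fun y => (Pw V lam r y) ^ (-(1/4):ℝ)) (Icc 0 1) :=
      (cPw lam hp).rpow_const (fun y _ => Or.inl (Pw_pos lam V hr y).ne')
    have c2 : ContinuousOn (fun y => (Pw V lam' r' y) ^ (-(1/4):ℝ)) (Icc 0 1) :=
      (cPw lam' hp).rpow_const (fun y _ => Or.inl (Pw_pos lam' V hr' y).ne')
    have h1 : nr (fun y => (Lg y : ℂ)) ^ 2 ≤ ∫ y in (0:ℝ)..1, 64 * T ^ (1/4:ℝ) *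
        ((Pw V lam r y) ^ (-(1/4):ℝ) + (Pw V lam' r' y) ^ (-(1/4):ℝ)) := by
      rw [nr_sq]
      apply intervalIntegral.integral_mono_on (by norm_num) (ii_of_cont (cLC.norm.pow 2))
        (ii_of_cont (continuousOn_const.mul (c1.add c2)))
      intro y hy
      show ‖(Lg y : ℂ)‖ ^ 2 ≤ _
      rw [nC, sq_abs]
      exact log_cmp_pt (Pw_pos lam V hr y) (Pw_pos lam' V hr' y) (hT y hy)
    rw [intervalIntegral.integral_const_mul, intervalIntegral.integral_add (ii_of_cont c1) (ii_of_cont c2)] at h1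
    have h2 := int_P4 hp hr hA h
    have h3 := int_P4 hp hr' hA h'
    have h4 : (T ^ (1/8:ℝ)) ^ 2 = T ^ (1/4:ℝ) := by
      rw [← Real.rpow_natCast, ← Real.rpow_mul hT0]; norm_num
    rw [mul_pow, h4]
    have h5 := Real.rpow_nonneg hT0 (1/4:ℝ)
    have h6 : 1 ≤ M * A := by nlinarith
    calc _ ≤ 64 * T ^ (1/4:ℝ) * (4 * M * A + 4 * M * A) := by
          refine h1.trans ?_; gcongr
      _ = 512 * (M * A) * T ^ (1/4:ℝ) := by ring
      _ ≤ (512 * M * A) ^ 2 * T ^ (1/4:ℝ) := by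
        gcongr
        nlinarith
  rw [norm_mul]
  have n5 : ‖(-1/2 : ℂ)‖ = 1/2 := by simp
  rw [n5]
  have n6 := mul_le_mul nL nb1 (nr_nonneg _) (by positivity)
  calc _ ≤ 1/2 * (512 * M * A * T ^ (1/8:ℝ) * (2 * M ^ 3 * nr p1)) := by linarith
    _ = _ := by ring

lemma near_or_far (hp : Prof M V V1 V2 V3) (lam : ℝ) :
    (∀ y ∈ Icc (0:ℝ) 1, |V y - lam| ≤ 2 * M) ∨ (∀ y ∈ Icc (0:ℝ) 1, 1 ≤ |V y - lam|) := by
  by_cases h : ∀ y ∈ Icc (0:ℝ) 1, |V y - lam| ≤ 2 * M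
  · exact Or.inl h
  · right
    push Not at h
    obtain ⟨x, hx, hl⟩ := h
    intro y hy
    have h1 := hp.osc hx hy
    have h2 : |V x - lam| ≤ |V y - lam| + |V y - V x| := by
      have : V x - lam = (V y - lam) - (V y - V x) := by ring
      rw [this]; exact abs_sub _ _
    have := hp.hM
    linarith

lemma globalLog (hp : Prof M V V1 V2 V3) {r lam : ℝ} (hr : 0 < r) (hr1 : r ≤ 1)
    (p p1 : ℝ → ℂ) (cp : ContinuousOn p (Icc 0 1)) (cp1 : ContinuousOn p1 (Icc 0 1))
    (dp : ∀ y ∈ Ioo (0:ℝ) 1, HasDerivAt p (p1 y) y) (p_0 : p 0 = 0) (p_1 : p 1 = 0) :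
    ‖∫ y in (0:ℝ)..1, (kp V lam r y : ℂ) * p y‖ ≤ 1025 * M ^ 5 * nr p1 := by
  have hM := hp.hM
  have hM0 : 0 ≤ M := by linarith
  have hp1 := nr_nonneg p1
  have hM5 : 1 ≤ M ^ 5 := one_le_pow₀ hM
  have triv : ∀ q : ℝ, 0 < q → (∀ y ∈ Icc (0:ℝ) 1, |kp V lam q y| ≤ 1) →
      ‖∫ y in (0:ℝ)..1, (kp V lam q y : ℂ) * p y‖ ≤ nr p1 := by
    intro q hq hk
    have := intervalIntegral.norm_integral_le_of_norm_le_const (a := 0) (b := 1) (C := nr p1)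
      (f := fun y => (kp V lam q y : ℂ) * p y) (fun y hy => by
        rw [uIoc_of_le zero_le_one] at hy
        have hy' : y ∈ Icc (0:ℝ) 1 := ⟨hy.1.le, hy.2⟩
        rw [norm_mul, nC]
        have h1 := hk y hy'
        have h2 := nsup_le p p1 cp cp1 dp p_0 y hy'
        nlinarith [norm_nonneg (p y)])
    simpa using this
  rcases near_or_far hp lam with h | h
  · have h1 := logCmp hp hr one_pos (by linarith) h h (T := 1) (fun y hy => by
      unfold Pw
      have : r ^ 4 ≤ 1 := pow_le_one₀ hr.le hr1
      have := pow_pos hr 4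
      rw [abs_le]; constructor <;> linarith) p p1 cp cp1 dp p_0 p_1
    rw [Real.one_rpow] at h1
    have h2 := triv 1 one_pos (fun y _ => by simpa using kp_le2 lam V one_pos y)
    have h3 := norm_le_norm_sub_add (∫ y in (0:ℝ)..1, (kp V lam r y : ℂ) * p y)
      (∫ y in (0:ℝ)..1, (kp V lam 1 y : ℂ) * p y)
    nlinarith
  · have := triv r hr (fun y hy => by
      have h1 := h y hy
      have hP := Pw_pos lam V hr y
      rw [kp, abs_div, abs_of_pos hP, div_le_one hP]
      unfold Pw
      nlinarith [sq_abs (V y - lam), pow_pos hr 4])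
    nlinarith
end prof

/-- C¹ functions vanishing at the end points -/
structure H0 (a a1 : ℝ → ℂ) : Prop where
  c : ContinuousOn a (Icc 0 1)
  c1 : ContinuousOn a1 (Icc 0 1)
  d : ∀ y ∈ Ioo (0:ℝ) 1, HasDerivAt a (a1 y) y
  z0 : a 0 = 0
  z1 : a 1 = 0

lemma H0.sup {a a1 : ℝ → ℂ} (h : H0 a a1) (y : ℝ) (hy : y ∈ Icc (0:ℝ) 1) : ‖a y‖ ≤ nr a1 :=
  nsup_le a a1 h.c h.c1 h.d h.z0 y hy

lemma H0.nr {a a1 : ℝ → ℂ} (h : H0 a a1) : nr a ≤ nr a1 :=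
  nr_le_const a _ (nr_nonneg _) h.c h.sup

/-- bilinear form -/
def BJ (V V2 : ℝ → ℝ) (lam r : ℝ) (a b : ℝ → ℂ) : ℂ :=
  ∫ y in (0:ℝ)..1, (kp V lam r y : ℂ) * ((V2 y : ℂ) * (a y * (starRingEnd ℂ) (b y)))

/-- real quadratic form -/
def Jr (V V2 : ℝ → ℝ) (lam r : ℝ) (a : ℝ → ℂ) : ℝ :=
  ∫ y in (0:ℝ)..1, kp V lam r y * (V2 y * ‖a y‖ ^ 2)

lemma BJ_self (V V2 : ℝ → ℝ) (lam r : ℝ) (a : ℝ → ℂ) : BJ V V2 lam r a a = (Jr V V2 lam r a : ℂ) := by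
  unfold BJ Jr
  rw [← intervalIntegral.integral_ofReal]
  congr 1; ext y
  rw [mul_comm (a y), conj_mul_self']; push_cast; rfl

section
variable {M : ℝ} {V V1 V2 V3 : ℝ → ℝ}

def pp (V2 : ℝ → ℝ) (a b : ℝ → ℂ) (y : ℝ) : ℂ := (V2 y : ℂ) * (a y * (starRingEnd ℂ) (b y))
def pp1 (V2 V3 : ℝ → ℝ) (a a1 b b1 : ℝ → ℂ) (y : ℝ) : ℂ :=
  (V3 y : ℂ) * (a y * (starRingEnd ℂ) (b y)) +
    ((V2 y : ℂ) * (a1 y * (starRingEnd ℂ) (b y)) + (V2 y : ℂ) * (a y * (starRingEnd ℂ) (b1 y)))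

lemma cpp (hp : Prof M V V1 V2 V3) {a b : ℝ → ℂ} (ca : ContinuousOn a (Icc 0 1)) (cb : ContinuousOn b (Icc 0 1)) :
    ContinuousOn (pp V2 a b) (Icc 0 1) := (cC hp.cV2).mul (ca.mul (cconj cb))

lemma cpp1 (hp : Prof M V V1 V2 V3) {a a1 b b1 : ℝ → ℂ} (ha : H0 a a1) (hb : H0 b b1) :
    ContinuousOn (pp1 V2 V3 a a1 b b1) (Icc 0 1) :=
  ((cC hp.cV3).mul (ha.c.mul (cconj hb.c))).add
    (((cC hp.cV2).mul (ha.c1.mul (cconj hb.c))).add ((cC hp.cV2).mul (ha.c.mul (cconj hb.c1))))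

lemma dpp (hp : Prof M V V1 V2 V3) {a a1 b b1 : ℝ → ℂ} (ha : H0 a a1) (hb : H0 b b1) :
    ∀ y ∈ Ioo (0:ℝ) 1, HasDerivAt (pp V2 a b) (pp1 V2 V3 a a1 b b1 y) y := by
  intro y hy
  have := ((hp.dV2 y hy).ofReal_comp).mul ((ha.d y hy).mul ((hb.d y hy).star))
  exact this.congr_deriv (by unfold pp1; simp only [Pi.mul_apply, RCLike.star_def]; ring)

lemma npp1 (hp : Prof M V V1 V2 V3) {a a1 b b1 : ℝ → ℂ} (ha : H0 a a1) (hb : H0 b b1) (ma mb : ℝ)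
    (h0a : 0 ≤ ma) (h0b : 0 ≤ mb)
    (hma : ∀ y ∈ Icc (0:ℝ) 1, ‖a y‖ ≤ ma) (hmb : ∀ y ∈ Icc (0:ℝ) 1, ‖b y‖ ≤ mb) :
    nr (pp1 V2 V3 a a1 b b1) ≤ 2 * M * (ma * nr b1) + M * (mb * nr a1) := by
  have hM : 0 ≤ M := by linarith [hp.hM]
  have q1 := nr_add (fun y => (V3 y : ℂ) * (a y * (starRingEnd ℂ) (b y)))
    (fun y => ((V2 y : ℂ) * (a1 y * (starRingEnd ℂ) (b y)) + (V2 y : ℂ) * (a y * (starRingEnd ℂ) (b1 y))))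
    ((cC hp.cV3).mul (ha.c.mul (cconj hb.c)))
    (((cC hp.cV2).mul (ha.c1.mul (cconj hb.c))).add ((cC hp.cV2).mul (ha.c.mul (cconj hb.c1))))
  have q2 := nr_add (fun y => (V2 y : ℂ) * (a1 y * (starRingEnd ℂ) (b y)))
    (fun y => (V2 y : ℂ) * (a y * (starRingEnd ℂ) (b1 y)))
    ((cC hp.cV2).mul (ha.c1.mul (cconj hb.c))) ((cC hp.cV2).mul (ha.c.mul (cconj hb.c1)))
  have e1 := nr_le (fun y => (V3 y : ℂ) * (a y * (starRingEnd ℂ) (b y))) b (M * ma) (by positivity)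
    ((cC hp.cV3).mul (ha.c.mul (cconj hb.c))) hb.c (fun y hy => by
      simp only [norm_mul, nC, RCLike.norm_conj]
      have := hp.b3 y hy; have := hma y hy
      rw [mul_assoc]; gcongr)
  have e2 := nr_le (fun y => (V2 y : ℂ) * (a1 y * (starRingEnd ℂ) (b y))) a1 (M * mb) (by positivity)
    ((cC hp.cV2).mul (ha.c1.mul (cconj hb.c))) ha.c1 (fun y hy => by
      simp only [norm_mul, nC, RCLike.norm_conj]
      have := hp.b2 y hy; have := hmb y hy
      rw [mul_assoc, mul_comm mb]; gcongr)
  have e3 := nr_le (fun y => (V2 y : ℂ) * (a y * (starRingEnd ℂ) (b1 y))) b1 (M * ma) (by positivity)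
    ((cC hp.cV2).mul (ha.c.mul (cconj hb.c1))) hb.c1 (fun y hy => by
      simp only [norm_mul, nC, RCLike.norm_conj]
      have := hp.b2 y hy; have := hma y hy
      rw [mul_assoc]; gcongr)
  have e4 : M * ma * nr b ≤ M * ma * nr b1 := by have := hb.nr; gcongr
  have e0 : nr (pp1 V2 V3 a a1 b b1) ≤ _ := q1
  linarith

lemma BJ_cmp (hp : Prof M V V1 V2 V3) {r lam r' lam' A T : ℝ} (hr : 0 < r) (hr' : 0 < r') (hA : 1 ≤ A)
    (h : ∀ y ∈ Icc (0:ℝ) 1, |V y - lam| ≤ A) (h' : ∀ y ∈ Icc (0:ℝ) 1, |V y - lam'| ≤ A)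
    (hT : ∀ y ∈ Icc (0:ℝ) 1, |Pw V lam r y - Pw V lam' r' y| ≤ T) (hT0 : 0 ≤ T)
    {a a1 : ℝ → ℂ} (ha : H0 a a1) :
    |Jr V V2 lam r a - Jr V V2 lam' r' a| ≤ 1536 * M ^ 5 * A * T ^ (1/8:ℝ) * nr a1 ^ 2 := by
  have hM := hp.hM
  have := logCmp hp hr hr' hA h h' hT (pp V2 a a) (pp1 V2 V3 a a1 a a1) (cpp hp ha.c ha.c) (cpp1 hp ha ha)
    (dpp hp ha ha) (by simp [pp, ha.z0]) (by simp [pp, ha.z1])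
  have e := npp1 hp ha ha _ _ (nr_nonneg a1) (nr_nonneg a1) ha.sup ha.sup
  have q1 : (∫ y in (0:ℝ)..1, (kp V lam r y : ℂ) * pp V2 a a y) = (Jr V V2 lam r a : ℂ) := BJ_self _ _ _ _ _
  have q2 : (∫ y in (0:ℝ)..1, (kp V lam' r' y : ℂ) * pp V2 a a y) = (Jr V V2 lam' r' a : ℂ) := BJ_self _ _ _ _ _
  rw [q1, q2, ← Complex.ofReal_sub, nC] at this
  refine this.trans ?_
  calc _ ≤ 512 * M ^ 4 * A * T ^ (1/8:ℝ) * (2 * M * (nr a1 * nr a1) + M * (nr a1 * nr a1)) := by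
        gcongr
    _ = _ := by ring

lemma BJ_le (hp : Prof M V V1 V2 V3) {r lam : ℝ} (hr : 0 < r) (hr1 : r ≤ 1)
    {a a1 b b1 : ℝ → ℂ} (ha : H0 a a1) (hb : H0 b b1) (ma mb : ℝ)
    (h0a : 0 ≤ ma) (h0b : 0 ≤ mb)
    (hma : ∀ y ∈ Icc (0:ℝ) 1, ‖a y‖ ≤ ma) (hmb : ∀ y ∈ Icc (0:ℝ) 1, ‖b y‖ ≤ mb) :
    ‖BJ V V2 lam r a b‖ ≤ 1025 * M ^ 6 * (2 * (ma * nr b1) + mb * nr a1) := by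
  have hM := hp.hM
  have := globalLog hp (lam := lam) hr hr1 (pp V2 a b) (pp1 V2 V3 a a1 b b1) (cpp hp ha.c hb.c) (cpp1 hp ha hb)
    (dpp hp ha hb) (by simp [pp, ha.z0]) (by simp [pp, ha.z1])
  have e := npp1 hp ha hb _ _ h0a h0b hma hmb
  refine this.trans ?_
  calc _ ≤ 1025 * M ^ 5 * (2 * M * (ma * nr b1) + M * (mb * nr a1)) := by gcongr
    _ = _ := by ring

/-- Hardy -/
lemma hardy (hp : Prof M V V1 V2 V3) {r lam M' : ℝ} (hr : 0 < r) (hM' : 0 ≤ M')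
    {a a1 : ℝ → ℂ} (ha : H0 a a1) (hb : ∀ y ∈ Icc (0:ℝ) 1, ‖a y‖ ≤ M' * |V y - lam|) :
    0 ≤ nr a1 ^ 2 + Jr V V2 lam r a + 4 * M ^ 3 * M' ^ 2 * r ^ 2 := by
  have hM := hp.hM
  have ck := ckp (r := r) lam hp hr
  have ck1 := ckp1 (r := r) lam hp hr
  have P0 := Pw_pos lam V hr
  -- integration by parts
  have I := ibp (fun y => ((V1 y * kp V lam r y : ℝ) : ℂ))
    (fun y => ((V2 y * kp V lam r y + V1 y * kp1 V V1 lam r y : ℝ) : ℂ))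
    (fun y => a y * (starRingEnd ℂ) (a y))
    (fun y => a1 y * (starRingEnd ℂ) (a y) + a y * (starRingEnd ℂ) (a1 y))
    (cC (hp.cV1.mul ck)) (cC ((hp.cV2.mul ck).add (hp.cV1.mul ck1))) (ha.c.mul (cconj ha.c))
    ((ha.c1.mul (cconj ha.c)).add (ha.c.mul (cconj ha.c1)))
    (fun y hy => by
      have := ((hp.dV1 y hy).mul (dkp lam hp hr y hy)).ofReal_comp
      exact this)
    (fun y hy => by
      have := (ha.d y hy).mul ((ha.d y hy).star)
      exact this)
    (by simp [ha.z0]) (by simp [ha.z1])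
  have Ir : ∫ y in (0:ℝ)..1, (V1 y * kp V lam r y) * (2 * (a1 y * (starRingEnd ℂ) (a y)).re)
     = - ∫ y in (0:ℝ)..1, (V2 y * kp V lam r y + V1 y * kp1 V V1 lam r y) * ‖a y‖ ^ 2 := by
    apply Complex.ofReal_injective
    push_cast [← intervalIntegral.integral_ofReal]
    convert I using 2
    · ext y
      push_cast
      congr 1
      have : a y * (starRingEnd ℂ) (a1 y) = (starRingEnd ℂ) (a1 y * (starRingEnd ℂ) (a y)) := by
        simp [mul_comm]
      rw [this, Complex.add_conj]; push_cast; rfl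
    · congr 1; ext y
      rw [mul_comm (a y), conj_mul_self']; push_cast; rfl
  have cre : ContinuousOn (fun y => (a1 y * (starRingEnd ℂ) (a y)).re) (Icc 0 1) :=
    Complex.continuous_re.comp_continuousOn (ha.c1.mul (cconj ha.c))
  have cn : ContinuousOn (fun y => ‖a y‖ ^ 2) (Icc 0 1) := ha.c.norm.pow 2
  have cn1 : ContinuousOn (fun y => ‖a1 y‖ ^ 2) (Icc 0 1) := ha.c1.norm.pow 2
  have c1 : ContinuousOn (fun y => (V1 y * kp V lam r y) * (2 * (a1 y * (starRingEnd ℂ) (a y)).re)) (Icc 0 1) :=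
    (hp.cV1.mul ck).mul (continuousOn_const.mul cre)
  have c2 : ContinuousOn (fun y => (V2 y * kp V lam r y + V1 y * kp1 V V1 lam r y) * ‖a y‖ ^ 2) (Icc 0 1) :=
    ((hp.cV2.mul ck).add (hp.cV1.mul ck1)).mul cn
  have c3 : ContinuousOn (fun y => kp V lam r y * (V2 y * ‖a y‖ ^ 2)) (Icc 0 1) := ck.mul (hp.cV2.mul cn)
  have c4 : ContinuousOn (fun y => om V lam r y ^ 2) (Icc 0 1) := (com lam hp hr).pow 2
  have key : 0 ≤ ∫ y in (0:ℝ)..1, (‖a1 y‖ ^ 2 + kp V lam r y * (V2 y * ‖a y‖ ^ 2)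
      + M ^ 2 * M' ^ 2 * r ^ 2 * om V lam r y ^ 2
      - (V1 y * kp V lam r y) * (2 * (a1 y * (starRingEnd ℂ) (a y)).re)
      - (V2 y * kp V lam r y + V1 y * kp1 V V1 lam r y) * ‖a y‖ ^ 2) := by
    apply intervalIntegral.integral_nonneg (by norm_num)
    intro y hy
    have hP := P0 y
    have sq : 0 ≤ ‖a1 y - (V1 y * kp V lam r y : ℝ) * a y‖ ^ 2 := by positivity
    have ex : ‖a1 y - (V1 y * kp V lam r y : ℝ) * a y‖ ^ 2 = ‖a1 y‖ ^ 2
       - (V1 y * kp V lam r y) * (2 * (a1 y * (starRingEnd ℂ) (a y)).re) + (V1 y * kp V lam r y) ^ 2 * ‖a y‖ ^ 2 := by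
      rw [← Complex.normSq_eq_norm_sq, ← Complex.normSq_eq_norm_sq, ← Complex.normSq_eq_norm_sq]
      simp only [Complex.normSq_apply, Complex.sub_re, Complex.sub_im, Complex.mul_re, Complex.mul_im,
        Complex.ofReal_re, Complex.ofReal_im, Complex.conj_re, Complex.conj_im]
      ring
    have id : (V1 y * kp V lam r y) ^ 2 + V1 y * kp1 V V1 lam r y = V1 y ^ 2 * r ^ 4 / Pw V lam r y ^ 2 := by
      unfold kp kp1; field_simp; ring
    have def1 : V1 y ^ 2 * r ^ 4 / Pw V lam r y ^ 2 * ‖a y‖ ^ 2 ≤ M ^ 2 * M' ^ 2 * r ^ 2 * om V lam r y ^ 2 := by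
      rw [om_sq lam V hr]
      have h1 : V1 y ^ 2 ≤ M ^ 2 := pow_le_pow_left₀ (hp.V1pos y hy).le (hp.hi y hy) 2
      have h2 : ‖a y‖ ^ 2 ≤ M' ^ 2 * Pw V lam r y := by
        have := pow_le_pow_left₀ (norm_nonneg _) (hb y hy) 2
        rw [mul_pow, sq_abs] at this
        refine this.trans ?_
        unfold Pw; gcongr; nlinarith [pow_pos hr 4]
      calc V1 y ^ 2 * r ^ 4 / Pw V lam r y ^ 2 * ‖a y‖ ^ 2
          ≤ M ^ 2 * r ^ 4 / Pw V lam r y ^ 2 * (M' ^ 2 * Pw V lam r y) := by gcongr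
        _ = _ := by field_simp
    have : (V1 y * kp V lam r y) ^ 2 * ‖a y‖ ^ 2 = V1 y ^ 2 * r ^ 4 / Pw V lam r y ^ 2 * ‖a y‖ ^ 2 - V1 y * kp1 V V1 lam r y * ‖a y‖ ^ 2 := by
      rw [← id]; ring
    nlinarith
  have c5 : ContinuousOn (fun y => M ^ 2 * M' ^ 2 * r ^ 2 * om V lam r y ^ 2) (Icc 0 1) := continuousOn_const.mul c4
  have c6 : ContinuousOn (fun y => ‖a1 y‖ ^ 2 + kp V lam r y * (V2 y * ‖a y‖ ^ 2)) (Icc 0 1) := cn1.add c3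
  have c7 : ContinuousOn (fun y => ‖a1 y‖ ^ 2 + kp V lam r y * (V2 y * ‖a y‖ ^ 2)
      + M ^ 2 * M' ^ 2 * r ^ 2 * om V lam r y ^ 2) (Icc 0 1) := c6.add c5
  have c8 : ContinuousOn (fun y => ‖a1 y‖ ^ 2 + kp V lam r y * (V2 y * ‖a y‖ ^ 2)
      + M ^ 2 * M' ^ 2 * r ^ 2 * om V lam r y ^ 2
      - (V1 y * kp V lam r y) * (2 * (a1 y * (starRingEnd ℂ) (a y)).re)) (Icc 0 1) := c7.sub c1
  rw [intervalIntegral.integral_sub (ii_of_cont c8) (ii_of_cont c2),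
    intervalIntegral.integral_sub (ii_of_cont c7) (ii_of_cont c1),
    intervalIntegral.integral_add (ii_of_cont c6) (ii_of_cont c5),
    intervalIntegral.integral_add (ii_of_cont cn1) (ii_of_cont c3),
    intervalIntegral.integral_const_mul, Ir, ← nr_sq] at key
  have io := int_om lam hp hr
  have e1 : M ^ 2 * M' ^ 2 * r ^ 2 * (∫ y in (0:ℝ)..1, om V lam r y ^ 2) ≤ M ^ 2 * M' ^ 2 * r ^ 2 * (4 * M) := by gcongr
  unfold Jr
  nlinarith

/-- Hardy in the limit -/
lemma hardyLim (hp : Prof M V V1 V2 V3) {r lam lam' M' A t : ℝ} (hr : 0 < r) (hA : 1 ≤ A)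
    (h : ∀ y ∈ Icc (0:ℝ) 1, |V y - lam| ≤ A) (h' : ∀ y ∈ Icc (0:ℝ) 1, |V y - lam'| ≤ A)
    (ht : |lam - lam'| ≤ t) (hM' : 0 ≤ M')
    {a a1 : ℝ → ℂ} (ha : H0 a a1) (hb : ∀ y ∈ Icc (0:ℝ) 1, ‖a y‖ ≤ M' * |V y - lam'|) :
    0 ≤ nr a1 ^ 2 + Jr V V2 lam r a + 1536 * M ^ 5 * A * (2 * A * t + 2 * r ^ 4) ^ (1/8:ℝ) * nr a1 ^ 2 := by
  have hM := hp.hM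
  have t0 : 0 ≤ t := (abs_nonneg _).trans ht
  apply le_of_forall_pos_le_add
  intro ε hε
  -- choose the parameter
  obtain ⟨r', hr', hr'r, hr'e⟩ : ∃ r' : ℝ, 0 < r' ∧ r' ≤ r ∧ 4 * M ^ 3 * M' ^ 2 * r' ^ 2 ≤ ε := by
    set c := 4 * M ^ 3 * M' ^ 2 + 1 with hc
    have hc0 : 1 ≤ c := by rw [hc]; have : 0 ≤ 4 * M ^ 3 * M' ^ 2 := by positivity
                           linarith
    refine ⟨min r (Real.sqrt (ε / c)), lt_min hr (Real.sqrt_pos.2 (by positivity)), min_le_left _ _, ?_⟩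
    have h1 : (min r (Real.sqrt (ε / c))) ^ 2 ≤ ε / c := by
      have := pow_le_pow_left₀ (le_min hr.le (Real.sqrt_nonneg _)) (min_le_right r (Real.sqrt (ε / c))) 2
      rwa [Real.sq_sqrt (by positivity)] at this
    calc _ ≤ c * (ε / c) := by
          apply mul_le_mul _ h1 (by positivity) (by linarith)
          linarith
      _ = ε := by field_simp
  have H := hardy hp hr' hM' ha hb
  have C := BJ_cmp hp hr hr' hA h h' (T := 2 * A * t + 2 * r ^ 4) (fun y hy => by
    have e : Pw V lam r y - Pw V lam' r' y = (lam' - lam) * ((V y - lam) + (V y - lam')) + r ^ 4 - r' ^ 4 := by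
      unfold Pw; ring
    have h1 : |(lam' - lam) * ((V y - lam) + (V y - lam'))| ≤ t * (A + A) := by
      rw [abs_mul, abs_sub_comm]
      have := (abs_add_le (V y - lam) (V y - lam')).trans (add_le_add (h y hy) (h' y hy))
      gcongr
    have h2 : r' ^ 4 ≤ r ^ 4 := pow_le_pow_left₀ hr'.le hr'r 4
    have h3 : 0 < r' ^ 4 := by positivity
    rw [e, abs_le]; rw [abs_le] at h1
    constructor <;> linarith) (by positivity) ha
  have := (abs_le.1 C).1
  linarith
end

section sol
variable {M r lam K τ e : ℝ} {V V1 V2 V3 : ℝ → ℝ} {o : ℂ} {w w1 w2 φ φ1 f : ℝ → ℂ}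

lemma Sol.H0 (hs : Sol M r lam K τ e V V2 o w w1 w2 φ φ1 f) : H0 φ φ1 :=
  ⟨hs.cφ, hs.cφ1, hs.dφ, hs.φ_0, hs.φ_1⟩

/-- energy identity for the stream function -/
lemma energy (hs : Sol M r lam K τ e V V2 o w w1 w2 φ φ1 f) :
    ∫ y in (0:ℝ)..1, (starRingEnd ℂ) (φ y) * w y = -((EE K φ φ1 ^ 2 : ℝ) : ℂ) := by
  have I := ibp (fun y => (starRingEnd ℂ) (φ y)) (fun y => (starRingEnd ℂ) (φ1 y)) φ1
    (fun y => w y + (K:ℂ) ^ 2 * φ y) (cconj hs.cφ) (cconj hs.cφ1) hs.cφ1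
    (hs.cw.add (continuousOn_const.mul hs.cφ)) (fun y hy => (hs.dφ y hy).star) hs.dφ1
    (by simp [hs.φ_0]) (by simp [hs.φ_1])
  have L := lin2 (T := fun y => (starRingEnd ℂ) (φ y) * (w y + (K:ℂ) ^ 2 * φ y)) (A := fun y => (starRingEnd ℂ) (φ y) * w y)
    (B := fun y => ((‖φ y‖ ^ 2 : ℝ) : ℂ)) 1 ((K:ℂ)^2) ((cconj hs.cφ).mul hs.cw) (cC (hs.cφ.norm.pow 2))
    (fun y _ => by rw [← conj_mul_self']; ring)
  have e1 : ∫ y in (0:ℝ)..1, (starRingEnd ℂ) (φ1 y) * φ1 y = ((nr φ1 ^ 2 : ℝ) : ℂ) := by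
    rw [nr_sq, ← intervalIntegral.integral_ofReal]; congr 1; ext y; rw [conj_mul_self']
  have e2 : ∫ y in (0:ℝ)..1, ((‖φ y‖ ^ 2 : ℝ) : ℂ) = ((nr φ ^ 2 : ℝ) : ℂ) := by
    rw [nr_sq, ← intervalIntegral.integral_ofReal]
  rw [I, e1, e2] at L
  rw [EE_sq]
  push_cast at *
  linear_combination -L

lemma EJ (hp : Prof M V V1 V2 V3) (hs : Sol M r lam K τ e V V2 o w w1 w2 φ φ1 f) (he : e ≤ 1)
    (m : ℝ) (hm0 : 0 ≤ m) (hm : ∀ y ∈ Icc (0:ℝ) 1, ‖φ y‖ ≤ m) :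
    |EE K φ φ1 ^ 2 + Jr V V2 lam r φ| ≤
      2 * M * m * (nr f / r + (2 + M ^ 2) * (r * nr w) + M * (r ^ 3 * nr w1))
      + r * EE K φ φ1 * (r ^ 3 * nr w1) := by
  have hM := hp.hM
  have hr := hs.hr
  have P := pairing hp hs (fun y => (starRingEnd ℂ) (φ y)) (fun y => (starRingEnd ℂ) (φ1 y)) (cconj hs.cφ) (cconj hs.cφ1)
    (fun y hy => (hs.dφ y hy).star) (by simp [hs.φ_0]) (by simp [hs.φ_1])
  have e0 : (∫ y in (0:ℝ)..1, (V2 y : ℂ) * φ y * (starRingEnd ℂ) (φ y) * (kp V lam r y : ℂ)) = (Jr V V2 lam r φ : ℂ) := by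
    rw [← BJ_self]; unfold BJ; congr 1; ext y; ring
  rw [energy hs, e0] at P
  have e1 : -((EE K φ φ1 ^ 2 : ℝ) : ℂ) - (Jr V V2 lam r φ : ℂ) = ((-(EE K φ φ1 ^ 2 + Jr V V2 lam r φ) : ℝ) : ℂ) := by
    push_cast; ring
  rw [e1, nC, abs_neg] at P
  refine P.trans ?_
  have h1 := nw_le lam hp hr (fun y => (starRingEnd ℂ) (φ y)) m hm0 (cconj hs.cφ) (fun y hy => by
    simpa using hm y hy)
  have h2 : nr (fun y => (starRingEnd ℂ) (φ1 y)) ≤ EE K φ φ1 := by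
    refine le_trans (le_of_eq ?_) (nr1_le_EE (K := K) (φ := φ))
    simp [nr]
  have := nr_nonneg f
  have := nr_nonneg w
  have := nr_nonneg w1
  have := hs.he
  have h3 : nr f / r + (1 + e + M ^ 2) * (r * nr w) + M * (r ^ 3 * nr w1) ≤
    nr f / r + (2 + M ^ 2) * (r * nr w) + M * (r ^ 3 * nr w1) := by
      gcongr; linarith
  gcongr
end sol

lemma H0.lip {a a1 : ℝ → ℂ} (ha : H0 a a1) : ∃ N : ℝ, 0 ≤ N ∧ ∀ x ∈ Icc (0:ℝ) 1, ∀ y ∈ Icc (0:ℝ) 1,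
    ‖a y - a x‖ ≤ N * |y - x| := by
  obtain ⟨N, hN⟩ := isCompact_Icc.exists_bound_of_continuousOn ha.c1
  have hN0 : 0 ≤ N := (norm_nonneg _).trans (hN 0 (by simp))
  refine ⟨N, hN0, ?_⟩
  have key : ∀ x ∈ Icc (0:ℝ) 1, ∀ y ∈ Icc (0:ℝ) 1, x ≤ y → ‖a y - a x‖ ≤ N * |y - x| := by
    intro x hx y hy hxy
    rw [ftc0 a a1 ha.c ha.c1 ha.d x y hx hy hxy]
    apply intervalIntegral.norm_integral_le_of_norm_le_const
    intro t ht
    rw [uIoc_of_le hxy] at ht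
    exact hN t ⟨hx.1.trans ht.1.le, ht.2.trans hy.2⟩
  intro x hx y hy
  rcases le_total x y with h | h
  · exact key x hx y hy h
  · rw [norm_sub_rev, abs_sub_comm]; exact key y hy x hx h

section sol
variable {M r lam K τ e : ℝ} {V V1 V2 V3 : ℝ → ℝ} {o : ℂ} {w w1 w2 φ φ1 f : ℝ → ℂ}

lemma J_le (hp : Prof M V V1 V2 V3) (hs : Sol M r lam K τ e V V2 o w w1 w2 φ φ1 f)
    (m : ℝ) (hm0 : 0 ≤ m) (hm : ∀ y ∈ Icc (0:ℝ) 1, ‖φ y‖ ≤ m) :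
    |Jr V V2 lam r φ| ≤ 3075 * M ^ 6 * (m * EE K φ φ1) := by
  have hM := hp.hM
  have h := BJ_le hp (lam := lam) hs.hr hs.hr1 hs.H0 hs.H0 m m hm0 hm0 hm hm
  rw [BJ_self, nC] at h
  refine h.trans ?_
  have := nr1_le_EE (K := K) (φ := φ) (φ1 := φ1)
  calc _ ≤ 1025 * M ^ 6 * (2 * (m * EE K φ φ1) + m * EE K φ φ1) := by gcongr
    _ = _ := by ring

lemma coerA (hp : Prof M V V1 V2 V3) (hs : Sol M r lam K τ e V V2 o w w1 w2 φ φ1 f) :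
    EE K φ φ1 ^ 2 ≤ 2 * |EE K φ φ1 ^ 2 + Jr V V2 lam r φ| + 8 * (3075 * M ^ 6) ^ 4 * nr φ ^ 2 := by
  have hM := hp.hM
  set m := Real.sqrt (2 * (nr φ * nr φ1)) with hmd
  have n0 := nr_nonneg φ
  have n1 := nr_nonneg φ1
  have h := J_le hp hs m (Real.sqrt_nonneg _) (fun y hy => Real.le_sqrt_of_sq_le
    (nsup_sq_le φ φ1 hs.cφ hs.cφ1 hs.dφ hs.φ_0 y hy))
  have hm2 : m ^ 2 = 2 * (nr φ * nr φ1) := Real.sq_sqrt (by positivity)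
  have hE := nr1_le_EE (K := K) (φ := φ) (φ1 := φ1)
  set E := EE K φ φ1
  set J := Jr V V2 lam r φ
  set C := 3075 * M ^ 6
  have a1 : E ^ 2 ≤ |E ^ 2 + J| + |J| := by
    have := le_abs_self (E ^ 2 + J); have := neg_abs_le J; linarith
  have a2 : C * (m * E) ≤ E ^ 2 / 4 + C ^ 2 * m ^ 2 := by nlinarith [sq_nonneg (E / 2 - C * m)]
  have a3 : C ^ 2 * m ^ 2 ≤ E ^ 2 / 4 + 4 * C ^ 4 * nr φ ^ 2 := by
    rw [hm2]
    have : C ^ 2 * (2 * (nr φ * nr φ1)) ≤ C ^ 2 * (2 * (nr φ * E)) := by gcongr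
    nlinarith [sq_nonneg (E / 2 - 2 * (C ^ 2 * nr φ))]
  linarith

lemma Qlow (hp : Prof M V V1 V2 V3) (hs : Sol M r lam K τ e V V2 o w w1 w2 φ φ1 f) (yc : ℝ)
    (h0 : 0 ≤ yc) (h1 : yc + r ^ 2 ≤ 1) (hV : V yc = lam) :
    ‖(V2 yc : ℂ) * φ yc‖ ^ 2 ≤ 4 * M ^ 2 * nw V lam r (fun y => (V2 y : ℂ) * φ y) ^ 2
      + 8 * M ^ 2 * r ^ 2 * EE K φ φ1 ^ 2 := by
  have hM := hp.hM
  have hr := hs.hr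
  have hr2 : 0 < r ^ 2 := by positivity
  have cu : ContinuousOn (fun y => (V2 y : ℂ) * φ y) (Icc 0 1) := (cC hp.cV2).mul hs.cφ
  have cu1 : ContinuousOn (fun y => (V3 y : ℂ) * φ y + (V2 y : ℂ) * φ1 y) (Icc 0 1) :=
    ((cC hp.cV3).mul hs.cφ).add ((cC hp.cV2).mul hs.cφ1)
  have du : ∀ y ∈ Ioo (0:ℝ) 1, HasDerivAt (fun y => (V2 y : ℂ) * φ y) ((V3 y : ℂ) * φ y + (V2 y : ℂ) * φ1 y) y :=
    fun y hy => ((hp.dV2 y hy).ofReal_comp).mul (hs.dφ y hy)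
  have hu := u1_le hp hs
  have hc : yc ∈ Icc (0:ℝ) 1 := ⟨h0, by linarith⟩
  have cq : ContinuousOn (fun y => ‖(om V lam r y : ℂ) * ((V2 y : ℂ) * φ y)‖ ^ 2) (Icc 0 1) :=
    ((cC (com lam hp hr)).mul cu).norm.pow 2
  set E := EE K φ φ1
  have low : ∫ y in yc..(yc + r ^ 2), (1 / (2 * M ^ 2 * r ^ 2) * (‖(V2 yc : ℂ) * φ yc‖ ^ 2 / 2 - r ^ 2 * (2 * M * E) ^ 2))
     ≤ ∫ y in yc..(yc + r ^ 2), ‖(om V lam r y : ℂ) * ((V2 y : ℂ) * φ y)‖ ^ 2 := by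
    apply intervalIntegral.integral_mono_on (by linarith) (by simp)
    · apply ContinuousOn.intervalIntegrable
      rw [uIcc_of_le (by linarith)]
      exact cq.mono (Icc_subset_Icc h0 h1)
    · intro y hy
      have hy' : y ∈ Icc (0:ℝ) 1 := ⟨h0.trans hy.1, hy.2.trans h1⟩
      have g := holder _ _ cu cu1 du yc y hc hy' hy.1
      have g2 : (y - yc) * nr (fun y => (V3 y : ℂ) * φ y + (V2 y : ℂ) * φ1 y) ^ 2 ≤ r ^ 2 * (2 * M * E) ^ 2 := by
        have := nr_nonneg (fun y => (V3 y : ℂ) * φ y + (V2 y : ℂ) * φ1 y)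
        have : y - yc ≤ r ^ 2 := by linarith [hy.2]
        gcongr
      have g3 : ‖(V2 yc : ℂ) * φ yc‖ ≤ ‖(V2 y : ℂ) * φ y‖ + ‖(V2 y : ℂ) * φ y - (V2 yc : ℂ) * φ yc‖ := by
        have := norm_sub_norm_le ((V2 yc : ℂ) * φ yc) ((V2 y : ℂ) * φ y)
        rw [norm_sub_rev] at this; linarith
      have g4 : ‖(V2 yc : ℂ) * φ yc‖ ^ 2 / 2 - r ^ 2 * (2 * M * E) ^ 2 ≤ ‖(V2 y : ℂ) * φ y‖ ^ 2 := by
        have := pow_le_pow_left₀ (norm_nonneg _) g3 2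
        nlinarith [sq_nonneg (‖(V2 y : ℂ) * φ y‖ - ‖(V2 y : ℂ) * φ y - (V2 yc : ℂ) * φ yc‖)]
      have g5 : 1 / (2 * M ^ 2 * r ^ 2) ≤ om V lam r y ^ 2 := by
        rw [om_sq lam V hr, div_le_div_iff₀ (by positivity) (Pw_pos lam V hr y)]
        have l := (hp.lip hc hy').1
        rw [hV, abs_of_nonneg (by linarith [hy.1] : 0 ≤ y - yc)] at l
        have l2 : (V y - lam) ^ 2 ≤ (M * r ^ 2) ^ 2 := by
          rw [← sq_abs]
          apply pow_le_pow_left₀ (abs_nonneg _)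
          refine l.trans ?_
          have : y - yc ≤ r ^ 2 := by linarith [hy.2]
          gcongr
        unfold Pw
        have : r ^ 4 ≤ M ^ 2 * r ^ 4 := by nlinarith [pow_pos hr 4, one_le_pow₀ hM (n := 2)]
        nlinarith
      have g6 : ‖(om V lam r y : ℂ) * ((V2 y : ℂ) * φ y)‖ ^ 2 = om V lam r y ^ 2 * ‖(V2 y : ℂ) * φ y‖ ^ 2 := by
        rw [norm_mul (om V lam r y : ℂ), mul_pow, nC, sq_abs]
      rw [g6]
      calc _ ≤ 1 / (2 * M ^ 2 * r ^ 2) * ‖(V2 y : ℂ) * φ y‖ ^ 2 := by gcongr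
        _ ≤ _ := by gcongr
  have up : ∫ y in yc..(yc + r ^ 2), ‖(om V lam r y : ℂ) * ((V2 y : ℂ) * φ y)‖ ^ 2 ≤
      nw V lam r (fun y => (V2 y : ℂ) * φ y) ^ 2 := by
    unfold nw
    rw [nr_sq]
    apply intervalIntegral.integral_mono_interval h0 (by linarith) h1 _ (ii_of_cont cq)
    exact Filter.Eventually.of_forall (fun y => by positivity)
  rw [intervalIntegral.integral_const] at low
  have e1 : (yc + r ^ 2 - yc) • (1 / (2 * M ^ 2 * r ^ 2) * (‖(V2 yc : ℂ) * φ yc‖ ^ 2 / 2 - r ^ 2 * (2 * M * E) ^ 2))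
     = (‖(V2 yc : ℂ) * φ yc‖ ^ 2 / 2 - r ^ 2 * (2 * M * E) ^ 2) / (2 * M ^ 2) := by
    rw [smul_eq_mul]; field_simp; ring
  rw [e1, ] at low
  have := low.trans up
  rw [div_le_iff₀ (by positivity)] at this
  linarith

set_option maxHeartbeats 1000000 in
lemma coerB (hp : Prof M V V1 V2 V3) (hs : Sol M r lam K τ e V V2 o w w1 w2 φ φ1 f)
    (near : ∀ y ∈ Icc (0:ℝ) 1, |V y - lam| ≤ 2 * M) (yc β : ℝ) (hc : yc ∈ Icc (0:ℝ) 1) (hV : V yc = lam)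
    (hβ : 0 < β) (hβ2 : β ≤ yc * (1 - yc)) :
    nr φ ^ 2 ≤ |EE K φ φ1 ^ 2 + Jr V V2 lam r φ|
      + (3076 * M ^ 6 * (2 + 1 / β)) * (‖φ yc‖ / β) * EE K φ φ1
      + 3072 * M ^ 6 * (2 * r ^ 4) ^ (1/8:ℝ) * ((1 + 1 / β) * EE K φ φ1) ^ 2 := by
  have hM := hp.hM
  have hr := hs.hr
  have hcc : 0 < yc * (1 - yc) := by linarith
  set c := φ yc with hcd
  set d : ℝ := yc * (1 - yc) with hd
  have dη : ∀ y : ℝ, HasDerivAt (fun y : ℝ => ((y * (1 - y) / d : ℝ) : ℂ)) (((1 - 2 * y) / d : ℝ) : ℂ) y := by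
    intro y
    have h1 := (((hasDerivAt_id y).mul ((hasDerivAt_const y (1:ℝ)).sub (hasDerivAt_id y))).div_const d).ofReal_comp
    exact h1.congr_deriv (by simp; ring)
  have hψ : H0 (fun y => c * ((y * (1 - y) / d : ℝ) : ℂ)) (fun y => c * (((1 - 2 * y) / d : ℝ) : ℂ)) := by
    refine ⟨?_, ?_, ?_, by simp, by simp⟩
    · exact fun y _ => ((dη y).const_mul c).continuousAt.continuousWithinAt
    · apply continuousOn_const.mul
      apply cC
      fun_prop
    · exact fun y _ => (dη y).const_mul c
  set ψ : ℝ → ℂ := fun y => c * ((y * (1 - y) / d : ℝ) : ℂ) with hψd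
  set ψ1 : ℝ → ℂ := fun y => c * (((1 - 2 * y) / d : ℝ) : ℂ) with hpsid
  have nψ : nr ψ1 ≤ ‖c‖ / β := by
    apply nr_le_const _ _ (by positivity) hψ.c1
    intro y hy
    rw [hpsid]; simp only
    rw [norm_mul, nC, abs_div, abs_of_pos hcc, mul_div_assoc']
    have : |1 - 2 * y| ≤ 1 := by rw [abs_le]; constructor <;> linarith [hy.1, hy.2]
    apply div_le_div₀ (norm_nonneg _) _ hβ hβ2
    nlinarith [norm_nonneg c]
  have h0 : H0 (fun y => φ y - ψ y) (fun y => φ1 y - ψ1 y) :=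
    ⟨hs.cφ.sub hψ.c, hs.cφ1.sub hψ.c1, fun y hy => (hs.dφ y hy).sub (hψ.d y hy),
      by simp [hs.φ_0, hψ.z0], by simp [hs.φ_1, hψ.z1]⟩
  obtain ⟨N, hN0, hN⟩ := h0.lip
  have HL := hardyLim hp (lam := lam) (lam' := lam) (t := 0) (A := 2 * M) (M' := N * M) hr (by linarith) near near
    (by simp) (by positivity) h0 (by
      intro y hy
      have h1 := hN yc hc y hy
      have h2 : φ yc - ψ yc = 0 := by
        rw [hψd]; simp only
        rw [← hd, div_self hcc.ne']; simp [hcd]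
      simp only [h2, sub_zero] at h1
      refine h1.trans ?_
      rw [mul_assoc]
      have := (hp.lip hc hy).2
      rw [hV] at this
      gcongr)
  have B1 := BJ_le hp (lam := lam) hr hs.hr1 hs.H0 hψ _ _ (nr_nonneg _) (nr_nonneg _) hs.H0.sup hψ.sup
  have B2 := BJ_le hp (lam := lam) hr hs.hr1 hψ h0 _ _ (nr_nonneg _) (nr_nonneg _) hψ.sup h0.sup
  have hJ : (Jr V V2 lam r φ : ℂ) - Jr V V2 lam r (fun y => φ y - ψ y) = BJ V V2 lam r φ ψ + BJ V V2 lam r ψ (fun y => φ y - ψ y) := by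
    rw [← BJ_self, ← BJ_self]
    unfold BJ
    have ck := cC (ckp (r := r) lam hp hr)
    have := lin3 (T := fun y => (kp V lam r y : ℂ) * ((V2 y : ℂ) * (φ y * (starRingEnd ℂ) (φ y))))
      (A := fun y => (kp V lam r y : ℂ) * ((V2 y : ℂ) * ((φ y - ψ y) * (starRingEnd ℂ) (φ y - ψ y))))
      (B := fun y => (kp V lam r y : ℂ) * ((V2 y : ℂ) * (φ y * (starRingEnd ℂ) (ψ y))))
      (C := fun y => (kp V lam r y : ℂ) * ((V2 y : ℂ) * (ψ y * (starRingEnd ℂ) (φ y - ψ y)))) 1 1 1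
      (ck.mul (cpp hp h0.c h0.c)) (ck.mul (cpp hp hs.cφ hψ.c)) (ck.mul (cpp hp hψ.c h0.c))
      (fun y _ => by simp only [map_sub]; ring)
    rw [this]; ring
  have hJr : |Jr V V2 lam r φ - Jr V V2 lam r (fun y => φ y - ψ y)| ≤
      ‖BJ V V2 lam r φ ψ‖ + ‖BJ V V2 lam r ψ (fun y => φ y - ψ y)‖ := by
    rw [← nC]; push_cast; rw [hJ]; exact norm_add_le _ _
  have tri : nr (fun y => φ1 y - ψ1 y) ≤ nr φ1 + nr ψ1 := by
    have := nr_add φ1 (fun y => -ψ1 y) hs.cφ1 hψ.c1.neg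
    have e : nr (fun y => -ψ1 y) = nr ψ1 := by simp [nr]
    rw [e] at this
    simpa [sub_eq_add_neg] using this
  have hcE : ‖c‖ ≤ EE K φ φ1 := φ_le_EE hs yc hc
  have n1E := nr1_le_EE (K := K) (φ := φ) (φ1 := φ1)
  have hE2 := EE_sq K φ φ1
  have hKn : nr φ ^ 2 ≤ K ^ 2 * nr φ ^ 2 := by
    nlinarith [sq_nonneg (nr φ), one_le_pow₀ hs.hK (n := 2)]
  set E := EE K φ φ1
  set n0 := nr (fun y => φ1 y - ψ1 y)
  set ρ := (2 * r ^ 4) ^ (1/8:ℝ) with hρ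
  have hρ0 : 0 ≤ ρ := by positivity
  have HL' : 0 ≤ n0 ^ 2 + Jr V V2 lam r (fun y => φ y - ψ y) + 3072 * M ^ 6 * ρ * n0 ^ 2 := by
    have e : (2 * (2 * M) * 0 + 2 * r ^ 4) = 2 * r ^ 4 := by ring
    rw [e, ← hρ] at HL
    linarith
  set p := ‖c‖ / β with hpd
  have p0 : 0 ≤ p := by positivity
  have pE : p ≤ 1 / β * E := by rw [hpd, div_eq_mul_one_div, mul_comm]; gcongr
  have E0 : 0 ≤ E := EE_nonneg _ _ _
  have n00 : 0 ≤ n0 := nr_nonneg _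
  have nφ0 := nr_nonneg φ1
  have nψ0 := nr_nonneg ψ1
  have n0E : n0 ≤ E + p := by linarith
  have n0E' : n0 ≤ (1 + 1 / β) * E := by linarith
  have s1 : n0 ^ 2 ≤ nr φ1 ^ 2 + p * (2 * E + p) := by
    have : n0 ^ 2 ≤ (nr φ1 + p) ^ 2 := by gcongr; linarith
    nlinarith
  have s2 : 1025 * M ^ 6 * (2 * (nr φ1 * nr ψ1) + nr ψ1 * nr φ1) ≤ 3075 * M ^ 6 * (p * E) := by
    have : nr φ1 * nr ψ1 ≤ E * p := by gcongr
    calc _ = 3075 * M ^ 6 * (nr φ1 * nr ψ1) := by ring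
      _ ≤ 3075 * M ^ 6 * (E * p) := by gcongr
      _ = _ := by ring
  have s3 : 1025 * M ^ 6 * (2 * (nr ψ1 * n0) + n0 * nr ψ1) ≤ 3075 * M ^ 6 * (p * (E + p)) := by
    have : nr ψ1 * n0 ≤ p * (E + p) := by gcongr
    calc _ = 3075 * M ^ 6 * (nr ψ1 * n0) := by ring
      _ ≤ 3075 * M ^ 6 * (p * (E + p)) := by gcongr
  have s4 : 3072 * M ^ 6 * ρ * n0 ^ 2 ≤ 3072 * M ^ 6 * ρ * ((1 + 1 / β) * E) ^ 2 := by gcongr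
  have s5 : p * (2 * E + p) ≤ M ^ 6 * (p * (2 * E + p)) := by
    have : 1 ≤ M ^ 6 := one_le_pow₀ hM
    have : 0 ≤ p * (2 * E + p) := by positivity
    nlinarith
  have s6 : p * (2 * E + p) ≤ (2 + 1 / β) * p * E := by nlinarith
  have s7 : 3076 * M ^ 6 * (p * (2 * E + p)) ≤ 3076 * M ^ 6 * ((2 + 1 / β) * p * E) := by gcongr
  have a1 := (abs_le.1 hJr).1
  have a2 := le_abs_self (E ^ 2 + Jr V V2 lam r φ)
  nlinarith
end sol

lemma root8 {x θ : ℝ} (hx : 0 ≤ x) (hθ : 0 ≤ θ) (h : x ≤ θ ^ 8) : x ^ (1/8:ℝ) ≤ θ := by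
  have := Real.rpow_le_rpow hx h (by norm_num : (0:ℝ) ≤ 1/8)
  refine this.trans (le_of_eq ?_)
  rw [← Real.rpow_natCast, ← Real.rpow_mul hθ]; norm_num

section
variable {M : ℝ} {V V1 V2 V3 : ℝ → ℝ}

set_option maxHeartbeats 2000000 in
lemma coer (hp : Prof M V V1 V2 V3)
    (hc : ∀ a : ℝ, 0 < a → ∃ c : ℝ, 0 < c ∧ ∀ y ∈ Icc a (1 - a), c ≤ |V2 y|) :
    ∃ C r₀ : ℝ, 0 < C ∧ 0 < r₀ ∧ ∀ (r lam K τ e : ℝ) (o : ℂ) (w w1 w2 φ φ1 f : ℝ → ℂ),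
      Sol M r lam K τ e V V2 o w w1 w2 φ φ1 f → r ≤ r₀ →
      EE K φ φ1 ^ 2 ≤ C * (|EE K φ φ1 ^ 2 + Jr V V2 lam r φ| + nw V lam r (fun y => (V2 y : ℂ) * φ y) ^ 2) := by
  have hM := hp.hM
  have hM0 : 0 < M := by linarith
  set G := 8 * (3075 * M ^ 6) ^ 4 with hG
  have hG0 : 0 < G := by positivity
  have hG1 : 1 ≤ G := by
    have h1 : 1 ≤ M ^ 6 := one_le_pow₀ hM
    have h2 : 1 ≤ (3075 * M ^ 6) ^ 4 := one_le_pow₀ (by linarith)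
    linarith
  set θ := 1 / (4 * 4608 * M ^ 6 * G) with hθ
  have hθ0 : 0 < θ := by positivity
  have hθ1 : θ ≤ 1 := by
    rw [hθ, div_le_one (by positivity)]
    have h1 : 1 ≤ M ^ 6 := one_le_pow₀ hM
    nlinarith
  set t := θ ^ 8 / (12 * M) with ht
  have ht0 : 0 < t := by positivity
  have ht1 : t ≤ 1 := by
    rw [ht, div_le_one (by positivity)]
    have : θ ^ 8 ≤ 1 := pow_le_one₀ hθ0.le hθ1
    linarith
  set a := t / M with ha
  have ha0 : 0 < a := by positivity
  obtain ⟨c, c0, hcl⟩ := hc a ha0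
  set β := a * a with hβ
  have hβ0 : 0 < β := by positivity
  set A1 := G * (3076 * M ^ 6 * (2 + 1 / β)) / β with hA1
  set A2 := G * (3072 * M ^ 6 * (1 + 1 / β) ^ 2) with hA2
  have hA10 : 0 < A1 := by positivity
  have hA20 : 0 < A2 := by positivity
  set C := 2 * (2 + G) + 8 * A1 ^ 2 * M ^ 2 / c ^ 2 with hC
  obtain ⟨r₀, r0, rle⟩ : ∃ r₀ : ℝ, 0 < r₀ ∧ r₀ ≤ θ ^ 8 / 4 ∧ r₀ ≤ 1 / (16 * M ^ 3 * G) ∧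
      r₀ ≤ c ^ 2 / (64 * A1 ^ 2 * M ^ 2) ∧ r₀ ≤ (1 / (8 * A2)) ^ 8 / 2 ∧ r₀ ≤ a := by
    refine ⟨min (θ ^ 8 / 4) (min (1 / (16 * M ^ 3 * G)) (min (c ^ 2 / (64 * A1 ^ 2 * M ^ 2))
      (min ((1 / (8 * A2)) ^ 8 / 2) a))), ?_, ?_, ?_, ?_, ?_, ?_⟩
    · refine lt_min (by positivity) (lt_min (by positivity) (lt_min (by positivity) (lt_min (by positivity) ha0)))
    all_goals simp
  obtain ⟨rl1, rl2, rl3, rl4, rl5⟩ := rle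
  refine ⟨C, r₀, by positivity, r0, ?_⟩
  intro r lam K τ e o w w1 w2 φ φ1 f hs hrr
  have hr := hs.hr
  have hr1 := hs.hr1
  have r4r : r ^ 4 ≤ r := by
    calc r ^ 4 ≤ r ^ 1 := pow_le_pow_of_le_one hr.le hr1 (by norm_num)
      _ = r := pow_one r
  have r2r : r ^ 2 ≤ r := by
    calc r ^ 2 ≤ r ^ 1 := pow_le_pow_of_le_one hr.le hr1 (by norm_num)
      _ = r := pow_one r
  have hA := coerA hp hs
  have hE2 := EE_sq K φ φ1
  have hKn : nr φ ^ 2 ≤ K ^ 2 * nr φ ^ 2 := by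
    nlinarith [sq_nonneg (nr φ), one_le_pow₀ hs.hK (n := 2)]
  have hn1 : nr φ1 ^ 2 ≤ EE K φ φ1 ^ 2 := by
    have := nr1_le_EE (K := K) (φ := φ) (φ1 := φ1)
    have := nr_nonneg φ1
    gcongr
  rw [← hG] at hA
  set Q := nw V lam r (fun y => (V2 y : ℂ) * φ y)
  have E0 : 0 ≤ EE K φ φ1 := EE_nonneg _ _ _
  -- reduction: enough G * nr φ^2 ≤ G|B| + E^2/4 + ...
  have red : G * nr φ ^ 2 ≤ G * |EE K φ φ1 ^ 2 + Jr V V2 lam r φ| + EE K φ φ1 ^ 2 / 2 + 4 * A1 ^ 2 * M ^ 2 / c ^ 2 * Q ^ 2 →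
      EE K φ φ1 ^ 2 ≤ C * (|EE K φ φ1 ^ 2 + Jr V V2 lam r φ| + Q ^ 2) := by
    intro h
    have h1 : 0 ≤ 8 * A1 ^ 2 * M ^ 2 / c ^ 2 * |EE K φ φ1 ^ 2 + Jr V V2 lam r φ| := by positivity
    have h2 : 0 ≤ 2 * (2 + G) * Q ^ 2 := by positivity
    have h3 : 8 * A1 ^ 2 * M ^ 2 / c ^ 2 = 2 * (4 * A1 ^ 2 * M ^ 2 / c ^ 2) := by ring
    rw [hC, h3]; rw [h3] at h1
    rw [add_mul, mul_add, mul_add]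
    linarith only [h, h1, h2, hA]
  apply red
  have hB := le_abs_self (EE K φ φ1 ^ 2 + Jr V V2 lam r φ)
  have hZ : 0 ≤ 4 * A1 ^ 2 * M ^ 2 / c ^ 2 * Q ^ 2 := by positivity
  -- simple closing
  have simp1 : ∀ x : ℝ, 0 ≤ nr φ1 ^ 2 + Jr V V2 lam r φ + x * nr φ1 ^ 2 → 0 ≤ x → G * x ≤ 1 / 4 →
      G * nr φ ^ 2 ≤ G * |EE K φ φ1 ^ 2 + Jr V V2 lam r φ| + EE K φ φ1 ^ 2 / 2 + 4 * A1 ^ 2 * M ^ 2 / c ^ 2 * Q ^ 2 := by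
    intro x h hx hx2
    have h1 : nr φ ^ 2 ≤ |EE K φ φ1 ^ 2 + Jr V V2 lam r φ| + x * EE K φ φ1 ^ 2 := by
      have : x * nr φ1 ^ 2 ≤ x * EE K φ φ1 ^ 2 := by gcongr
      linarith
    have h2 := mul_le_mul_of_nonneg_left h1 hG0.le
    have h3 : G * x * EE K φ φ1 ^ 2 ≤ 1 / 4 * EE K φ φ1 ^ 2 := by gcongr
    rw [mul_add, ← mul_assoc] at h2
    linarith only [h2, h3, sq_nonneg (EE K φ φ1), hZ]
  rcases near_or_far hp lam with near | far
  swap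
  · apply simp1 (4 * M ^ 3 * r ^ 2) _ (by positivity)
    · have : r ^ 2 ≤ 1 / (16 * M ^ 3 * G) := by linarith
      calc G * (4 * M ^ 3 * r ^ 2) ≤ G * (4 * M ^ 3 * (1 / (16 * M ^ 3 * G))) := by gcongr
        _ = 1 / 4 := by field_simp; norm_num
    · have := hardy hp (lam := lam) hr (nr_nonneg φ1) hs.H0 (fun y hy => by
        have := hs.H0.sup y hy
        nlinarith [far y hy, nr_nonneg φ1])
      linarith
  -- near
  obtain ⟨N, hN0, hN⟩ := hs.H0.lip
  have i0 : (0:ℝ) ∈ Icc (0:ℝ) 1 := by simp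
  have i1 : (1:ℝ) ∈ Icc (0:ℝ) 1 := by simp
  have caseA : ∀ lam' : ℝ, |lam - lam'| ≤ t → (∀ y ∈ Icc (0:ℝ) 1, ‖φ y‖ ≤ N * M * |V y - lam'|) →
      G * nr φ ^ 2 ≤ G * |EE K φ φ1 ^ 2 + Jr V V2 lam r φ| + EE K φ φ1 ^ 2 / 2 + 4 * A1 ^ 2 * M ^ 2 / c ^ 2 * Q ^ 2 := by
    intro lam' hl hφ
    have H := hardyLim hp (lam := lam) (lam' := lam') (t := t) (A := 3 * M) (M' := N * M) hr (by linarith)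
      (fun y hy => (near y hy).trans (by linarith))
      (fun y hy => by
        have h1 := near y hy
        have : V y - lam' = (V y - lam) + (lam - lam') := by ring
        rw [this]
        refine (abs_add_le _ _).trans ?_
        linarith) hl (by positivity) hs.H0 hφ
    apply simp1 _ H (by positivity)
    have hρ : (2 * (3 * M) * t + 2 * r ^ 4) ^ (1/8:ℝ) ≤ θ := by
      apply root8 (by positivity) hθ0.le
      have : 2 * (3 * M) * t = θ ^ 8 / 2 := by rw [ht]; field_simp; norm_num
      rw [this]; linarith
    calc G * (1536 * M ^ 5 * (3 * M) * (2 * (3 * M) * t + 2 * r ^ 4) ^ (1/8:ℝ))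
        ≤ G * (1536 * M ^ 5 * (3 * M) * θ) := by gcongr
      _ = 1 / 4 := by rw [hθ]; field_simp; norm_num
  have bd0 : ∀ y ∈ Icc (0:ℝ) 1, ‖φ y‖ ≤ N * M * |V y - V 0| ∧ V 0 ≤ V y := by
    intro y hy
    have h1 := hN 0 i0 y hy
    rw [hs.φ_0, sub_zero] at h1
    have h2 := (hp.lip i0 hy).2
    have h3 := (hp.ftcV le_rfl hy.2 hy.1).2
    constructor
    · refine h1.trans ?_
      rw [mul_assoc]; gcongr
    · nlinarith [hy.1]
  have bd1 : ∀ y ∈ Icc (0:ℝ) 1, ‖φ y‖ ≤ N * M * |V y - V 1| ∧ V y ≤ V 1 := by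
    intro y hy
    have h1 := hN 1 i1 y hy
    rw [hs.φ_1, sub_zero] at h1
    have h2 := (hp.lip i1 hy).2
    have h3 := (hp.ftcV hy.1 le_rfl hy.2).2
    constructor
    · refine h1.trans ?_
      rw [mul_assoc]; gcongr
    · nlinarith [hy.2]
  by_cases hl0 : lam ≤ V 0 + t
  · apply caseA (min lam (V 0))
    · rcases le_total lam (V 0) with h | h
      · rw [min_eq_left h]; simpa using ht0.le
      · rw [min_eq_right h, abs_le]; constructor <;> linarith
    · intro y hy
      refine (bd0 y hy).1.trans ?_
      have h2 := (bd0 y hy).2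
      have h3 := min_le_right lam (V 0)
      rw [abs_of_nonneg (by linarith), abs_of_nonneg (by linarith)]
      gcongr
  by_cases hl1 : V 1 - t ≤ lam
  · apply caseA (max lam (V 1))
    · rcases le_total (V 1) lam with h | h
      · rw [max_eq_left h]; simpa using ht0.le
      · rw [max_eq_right h, abs_le]; constructor <;> linarith
    · intro y hy
      refine (bd1 y hy).1.trans ?_
      have h2 := (bd1 y hy).2
      have h3 := le_max_right lam (V 1)
      rw [abs_of_nonpos (by linarith), abs_of_nonpos (by linarith)]
      have : -(V y - V 1) ≤ -(V y - max lam (V 1)) := by linarith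
      gcongr
  -- interior
  push Not at hl0 hl1
  obtain ⟨yc, hyc, hVc⟩ : lam ∈ V '' Icc 0 1 :=
    intermediate_value_Icc (by norm_num) hp.cV ⟨by linarith, by linarith⟩
  have ya : a ≤ yc := by
    have := (hp.ftcV le_rfl hyc.2 hyc.1).1
    rw [ha, div_le_iff₀ hM0]; rw [hVc] at this; linarith
  have yb : yc ≤ 1 - a := by
    have := (hp.ftcV hyc.1 le_rfl hyc.2).1
    have : a ≤ 1 - yc := by
      rw [ha, div_le_iff₀ hM0]; rw [hVc] at this; linarith
    linarith
  have hβ2 : β ≤ yc * (1 - yc) := by rw [hβ]; apply mul_le_mul ya (by linarith) ha0.le hyc.1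
  have B := coerB hp hs near yc β hyc hVc hβ0 hβ2
  have Ql := Qlow hp hs yc hyc.1 (by linarith) hVc
  have hcv := hcl yc ⟨ya, yb⟩
  have Ql2 : c ^ 2 * ‖φ yc‖ ^ 2 ≤ 4 * M ^ 2 * Q ^ 2 + 8 * M ^ 2 * r ^ 2 * EE K φ φ1 ^ 2 := by
    refine le_trans ?_ Ql
    rw [norm_mul, nC, mul_pow]
    gcongr
  have h1 : A1 ^ 2 * ‖φ yc‖ ^ 2 ≤ 4 * A1 ^ 2 * M ^ 2 / c ^ 2 * Q ^ 2 + EE K φ φ1 ^ 2 / 8 := by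
    have h2 : ‖φ yc‖ ^ 2 ≤ (4 * M ^ 2 * Q ^ 2 + 8 * M ^ 2 * r ^ 2 * EE K φ φ1 ^ 2) / c ^ 2 := by
      rw [le_div_iff₀ (by positivity)]; linarith
    have h3 : A1 ^ 2 * (8 * M ^ 2) / c ^ 2 * r ^ 2 ≤ 1 / 8 := by
      have : r ^ 2 ≤ c ^ 2 / (64 * A1 ^ 2 * M ^ 2) := by linarith
      calc _ ≤ A1 ^ 2 * (8 * M ^ 2) / c ^ 2 * (c ^ 2 / (64 * A1 ^ 2 * M ^ 2)) := by gcongr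
        _ = 1 / 8 := by field_simp; norm_num
    calc A1 ^ 2 * ‖φ yc‖ ^ 2 ≤ A1 ^ 2 * ((4 * M ^ 2 * Q ^ 2 + 8 * M ^ 2 * r ^ 2 * EE K φ φ1 ^ 2) / c ^ 2) := by gcongr
      _ = 4 * A1 ^ 2 * M ^ 2 / c ^ 2 * Q ^ 2 + (A1 ^ 2 * (8 * M ^ 2) / c ^ 2 * r ^ 2) * EE K φ φ1 ^ 2 := by ring
      _ ≤ 4 * A1 ^ 2 * M ^ 2 / c ^ 2 * Q ^ 2 + 1 / 8 * EE K φ φ1 ^ 2 := by gcongr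
      _ = _ := by ring
  have h4 : (2 * r ^ 4) ^ (1/8:ℝ) ≤ 1 / (8 * A2) := by
    apply root8 (by positivity) (by positivity)
    linarith
  have h5 : A2 * (2 * r ^ 4) ^ (1/8:ℝ) * EE K φ φ1 ^ 2 ≤ 1 / 8 * EE K φ φ1 ^ 2 := by
    have : A2 * (2 * r ^ 4) ^ (1/8:ℝ) ≤ A2 * (1 / (8 * A2)) := by gcongr
    have e : A2 * (1 / (8 * A2)) = 1 / 8 := by field_simp
    rw [e] at this
    gcongr
  have h6 := mul_le_mul_of_nonneg_left B hG0.le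
  have h7 : G * (|EE K φ φ1 ^ 2 + Jr V V2 lam r φ|
      + (3076 * M ^ 6 * (2 + 1 / β)) * (‖φ yc‖ / β) * EE K φ φ1
      + 3072 * M ^ 6 * (2 * r ^ 4) ^ (1/8:ℝ) * ((1 + 1 / β) * EE K φ φ1) ^ 2)
      = G * |EE K φ φ1 ^ 2 + Jr V V2 lam r φ| + A1 * ‖φ yc‖ * EE K φ φ1 + A2 * (2 * r ^ 4) ^ (1/8:ℝ) * EE K φ φ1 ^ 2 := by
    rw [hA1, hA2]; ring
  rw [h7] at h6
  have h8 : A1 * ‖φ yc‖ * EE K φ φ1 ≤ EE K φ φ1 ^ 2 / 4 + A1 ^ 2 * ‖φ yc‖ ^ 2 := by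
    have := sq_nonneg (EE K φ φ1 / 2 - A1 * ‖φ yc‖)
    have e : (EE K φ φ1 / 2 - A1 * ‖φ yc‖) ^ 2 = EE K φ φ1 ^ 2 / 4 + A1 ^ 2 * ‖φ yc‖ ^ 2 - A1 * ‖φ yc‖ * EE K φ φ1 := by ring
    linarith only [this, e]
  linarith only [h6, h8, h5, h1]
end

section sol
variable {M r lam K τ e : ℝ} {V V1 V2 V3 : ℝ → ℝ} {o : ℂ} {w w1 w2 φ φ1 f : ℝ → ℂ}

set_option maxHeartbeats 2000000 in
lemma ImEst (hp : Prof M V V1 V2 V3) (hs : Sol M r lam K τ e V V2 o w w1 w2 φ φ1 f) (he : e ≤ 1)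
    {σ κ s : ℝ} (hσ : σ = 1 ∨ σ = -1) (hσV : ∀ y ∈ Icc (0:ℝ) 1, 0 ≤ σ * V2 y) (hκ : 0 < κ) (hκ1 : κ ≤ 1)
    (hs0 : 0 ≤ s) (hsφ : ∀ y ∈ Icc (0:ℝ) 1, κ / (σ * V2 y + κ) * ‖φ y‖ ≤ s) :
    (r ^ 3 * nr w1) ^ 2 ≤ 2 * M * (2 * M * s * (nr f / r + (2 + M ^ 2) * (r * nr w) + M * (r ^ 3 * nr w1))
      + r * ((M / κ + 1) * EE K φ φ1) * (r ^ 3 * nr w1)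
      + 1 / κ * ((nr f / r) * (r * nr w)) + M / κ ^ 2 * (r ^ 2 * ((r * nr w) * (r ^ 3 * nr w1)))
      + 1 / κ * (e * (r * nr w) ^ 2)) := by
  have hM := hp.hM
  have hr := hs.hr
  have he0 := hs.he
  have hσ2 : σ * σ = 1 := by rcases hσ with h | h <;> rw [h] <;> norm_num
  have hτ2 : τ * τ = 1 := by rcases hs.hτ with h | h <;> rw [h] <;> norm_num
  have hσa : |σ| = 1 := by rcases hσ with h | h <;> rw [h] <;> norm_num
  have hτa : |τ| = 1 := by rcases hs.hτ with h | h <;> rw [h] <;> norm_num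
  obtain ⟨q, hq⟩ : ∃ q : ℝ → ℝ, q = fun y => 1 / (σ * V2 y + κ) := ⟨_, rfl⟩
  obtain ⟨q1, hq1⟩ : ∃ q1 : ℝ → ℝ, q1 = fun y => -(σ * V3 y) / (σ * V2 y + κ) ^ 2 := ⟨_, rfl⟩
  have den : ∀ y ∈ Icc (0:ℝ) 1, 0 < σ * V2 y + κ := fun y hy => by linarith [hσV y hy]
  have cden : ContinuousOn (fun y => σ * V2 y + κ) (Icc 0 1) := (continuousOn_const.mul hp.cV2).add continuousOn_const
  have cq : ContinuousOn q (Icc 0 1) := by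
    rw [hq]; exact continuousOn_const.div cden (fun y hy => (den y hy).ne')
  have cq1 : ContinuousOn q1 (Icc 0 1) := by
    rw [hq1]; exact (continuousOn_const.mul hp.cV3).neg.div (cden.pow 2) (fun y hy => (pow_pos (den y hy) 2).ne')
  have dq : ∀ y ∈ Ioo (0:ℝ) 1, HasDerivAt q (q1 y) y := by
    intro y hy
    have hd := den y ⟨hy.1.le, hy.2.le⟩
    have := (hasDerivAt_const y (1:ℝ)).div (((hp.dV2 y hy).const_mul σ).add_const κ) hd.ne'
    rw [hq, hq1]
    exact this.congr_deriv (by ring)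
  have qpos : ∀ y ∈ Icc (0:ℝ) 1, 0 < q y := fun y hy => by rw [hq]; exact one_div_pos.2 (den y hy)
  have qle : ∀ y ∈ Icc (0:ℝ) 1, q y ≤ 1 / κ := fun y hy => by
    rw [hq]; exact one_div_le_one_div_of_le hκ (by linarith [hσV y hy])
  have qge : ∀ y ∈ Icc (0:ℝ) 1, 1 / (2 * M) ≤ q y := fun y hy => by
    rw [hq]; apply one_div_le_one_div_of_le (den y hy)
    have := hp.b2 y hy
    have h2 : σ * V2 y ≤ |V2 y| := by
      have := le_abs_self (σ * V2 y); rwa [abs_mul, hσa, one_mul] at this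
    linarith
  have q1le : ∀ y ∈ Icc (0:ℝ) 1, |q1 y| ≤ M / κ ^ 2 := fun y hy => by
    rw [hq1]; simp only
    rw [abs_div, abs_neg, abs_mul, hσa, one_mul, abs_of_pos (pow_pos (den y hy) 2)]
    have := hσV y hy
    apply div_le_div₀ (by linarith) (hp.b3 y hy) (by positivity)
    gcongr; linarith
  have qV : ∀ y ∈ Icc (0:ℝ) 1, q y * V2 y = σ * (1 - κ * q y) := fun y hy => by
    have := (den y hy).ne'
    rw [hq]; simp only; field_simp
    linear_combination (-V2 y) * hσ2
  have qθ : ∀ y, κ / (σ * V2 y + κ) = κ * q y := fun y => by rw [hq]; ring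
  have cqc := cC cq
  have cq1c := cC cq1
  have cwb := cconj hs.cw
  have cw1b := cconj hs.cw1
  -- test
  have T := testEq hp hs (fun y => (q y : ℂ) * (starRingEnd ℂ) (w y))
    (fun y => (q1 y : ℂ) * (starRingEnd ℂ) (w y) + (q y : ℂ) * (starRingEnd ℂ) (w1 y))
    (cqc.mul cwb) ((cq1c.mul cwb).add (cqc.mul cw1b))
    (fun y hy => ((dq y hy).ofReal_comp).mul ((hs.dw y hy).star)) (by simp [hs.w_0]) (by simp [hs.w_1])
  have cR1 : ContinuousOn (fun y => q y * (V y - lam) * ‖w y‖ ^ 2) (Icc 0 1) :=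
    (cq.mul (hp.cV.sub continuousOn_const)).mul (hs.cw.norm.pow 2)
  have i1 : (∫ y in (0:ℝ)..1, (q y : ℂ) * (starRingEnd ℂ) (w y) * ((V y - lam : ℝ) : ℂ) * w y)
      = ((∫ y in (0:ℝ)..1, q y * (V y - lam) * ‖w y‖ ^ 2 : ℝ) : ℂ) := by
    rw [← intervalIntegral.integral_ofReal]; congr 1; ext y
    have := conj_mul_self' (w y)
    push_cast at *
    linear_combination (q y : ℂ) * (V y - lam) * this
  have i2 : (∫ y in (0:ℝ)..1, (q y : ℂ) * (starRingEnd ℂ) (w y) * w y)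
      = ((∫ y in (0:ℝ)..1, q y * ‖w y‖ ^ 2 : ℝ) : ℂ) := by
    rw [← intervalIntegral.integral_ofReal]; congr 1; ext y
    have := conj_mul_self' (w y)
    push_cast at *
    linear_combination (q y : ℂ) * this
  have i3 := lin2 (T := fun y => ((q1 y : ℂ) * (starRingEnd ℂ) (w y) + (q y : ℂ) * (starRingEnd ℂ) (w1 y)) * w1 y)
    (A := fun y => (q1 y : ℂ) * (starRingEnd ℂ) (w y) * w1 y) (B := fun y => ((q y * ‖w1 y‖ ^ 2 : ℝ) : ℂ)) 1 1
    ((cq1c.mul cwb).mul hs.cw1) (cC (cq.mul (hs.cw1.norm.pow 2))) (fun y _ => by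
      have := conj_mul_self' (w1 y)
      push_cast at *
      linear_combination (q y : ℂ) * this)
  rw [intervalIntegral.integral_ofReal] at i3
  have i4 := lin2 (T := fun y => (q y : ℂ) * (starRingEnd ℂ) (w y) * (V2 y : ℂ) * φ y)
    (A := fun y => (starRingEnd ℂ) ((starRingEnd ℂ) (φ y) * w y))
    (B := fun y => (starRingEnd ℂ) (((κ * q y : ℝ) : ℂ) * (starRingEnd ℂ) (φ y) * w y)) (σ:ℂ) (-σ:ℂ)
    (cconj ((cconj hs.cφ).mul hs.cw)) (cconj (((cC (continuousOn_const.mul cq)).mul (cconj hs.cφ)).mul hs.cw))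
    (fun y hy => by
      have := congrArg (fun x : ℝ => (x:ℂ)) (qV y hy)
      simp only [map_mul, Complex.conj_conj, Complex.conj_ofReal]
      push_cast at *
      linear_combination (starRingEnd ℂ) (w y) * φ y * this)
  rw [intervalIntegral.intervalIntegral_conj, intervalIntegral.intervalIntegral_conj, energy hs] at i4
  -- pairing
  have dg : ∀ y ∈ Ioo (0:ℝ) 1, HasDerivAt (fun y => ((κ * q y : ℝ) : ℂ) * (starRingEnd ℂ) (φ y))
      (((κ * q1 y : ℝ) : ℂ) * (starRingEnd ℂ) (φ y) + ((κ * q y : ℝ) : ℂ) * (starRingEnd ℂ) (φ1 y)) y :=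
    fun y hy => (((dq y hy).const_mul κ).ofReal_comp).mul ((hs.dφ y hy).star)
  have ca : ContinuousOn (fun y => ((κ * q y : ℝ) : ℂ) * (starRingEnd ℂ) (φ y)) (Icc 0 1) :=
    (cC (continuousOn_const.mul cq)).mul (cconj hs.cφ)
  have ca1 : ContinuousOn (fun y => ((κ * q1 y : ℝ) : ℂ) * (starRingEnd ℂ) (φ y)) (Icc 0 1) :=
    (cC (continuousOn_const.mul cq1)).mul (cconj hs.cφ)
  have ca2 : ContinuousOn (fun y => ((κ * q y : ℝ) : ℂ) * (starRingEnd ℂ) (φ1 y)) (Icc 0 1) :=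
    (cC (continuousOn_const.mul cq)).mul (cconj hs.cφ1)
  have P := pairing hp hs _ _ ca (ca1.add ca2) dg (by simp [hs.φ_0]) (by simp [hs.φ_1])
  have i5 : (∫ y in (0:ℝ)..1, (V2 y : ℂ) * φ y * (((κ * q y : ℝ) : ℂ) * (starRingEnd ℂ) (φ y)) * (kp V lam r y : ℂ))
      = ((∫ y in (0:ℝ)..1, V2 y * (κ * q y) * kp V lam r y * ‖φ y‖ ^ 2 : ℝ) : ℂ) := by
    rw [← intervalIntegral.integral_ofReal]; congr 1; ext y
    have := conj_mul_self' (φ y)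
    push_cast at *
    linear_combination (V2 y : ℂ) * (κ * q y) * (kp V lam r y : ℂ) * this
  rw [i5] at P
  have nwg := nw_le lam hp hr (fun y => ((κ * q y : ℝ) : ℂ) * (starRingEnd ℂ) (φ y)) s hs0 ca (fun y hy => by
    rw [norm_mul, nC, RCLike.norm_conj, abs_of_nonneg (mul_nonneg hκ.le (qpos y hy).le), ← qθ]
    exact hsφ y hy)
  have ng1 : nr (fun y => ((κ * q1 y : ℝ) : ℂ) * (starRingEnd ℂ) (φ y) + ((κ * q y : ℝ) : ℂ) * (starRingEnd ℂ) (φ1 y))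
      ≤ (M / κ + 1) * EE K φ φ1 := by
    refine (nr_add _ _ ca1 ca2).trans ?_
    have h1 := nr_le _ φ (M / κ) (by positivity) ca1 hs.cφ (fun y hy => by
      rw [norm_mul, nC, RCLike.norm_conj]
      gcongr
      rw [abs_mul, abs_of_pos hκ]
      calc κ * |q1 y| ≤ κ * (M / κ ^ 2) := by have := q1le y hy; gcongr
        _ = M / κ := by field_simp)
    have h2 := nr_le _ φ1 1 (by positivity) ca2 hs.cφ1 (fun y hy => by
      rw [norm_mul, nC, RCLike.norm_conj, abs_of_nonneg (mul_nonneg hκ.le (qpos y hy).le)]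
      gcongr
      calc κ * q y ≤ κ * (1 / κ) := by have := qle y hy; gcongr
        _ = 1 := by field_simp)
    have h3 := nr_le_EE (φ := φ) (φ1 := φ1) hs.hK
    have h4 := nr1_le_EE (K := K) (φ := φ) (φ1 := φ1)
    have : M / κ * nr φ ≤ M / κ * EE K φ φ1 := by gcongr
    linarith
  -- bounds
  have b1 := csb (fun y => (q y : ℂ) * (starRingEnd ℂ) (w y) * f y) f w (1 / κ) (by positivity) hs.cf hs.cw (fun y hy => by
    rw [norm_mul, norm_mul, nC, RCLike.norm_conj, abs_of_pos (qpos y hy), mul_assoc, mul_comm ‖w y‖]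
    have := qle y hy; gcongr)
  have b2 := csb (fun y => (q1 y : ℂ) * (starRingEnd ℂ) (w y) * w1 y) w w1 (M / κ ^ 2) (by positivity) hs.cw hs.cw1 (fun y hy => by
    rw [norm_mul, norm_mul, nC, RCLike.norm_conj, mul_assoc]
    have := q1le y hy; gcongr)
  have cqw : ContinuousOn (fun y => q y * ‖w y‖ ^ 2) (Icc 0 1) := cq.mul (hs.cw.norm.pow 2)
  have cqw1 : ContinuousOn (fun y => q y * ‖w1 y‖ ^ 2) (Icc 0 1) := cq.mul (hs.cw1.norm.pow 2)
  have cw2 : ContinuousOn (fun y => ‖w y‖ ^ 2) (Icc 0 1) := (hs.cw.norm.pow 2)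
  have cw12 : ContinuousOn (fun y => ‖w1 y‖ ^ 2) (Icc 0 1) := (hs.cw1.norm.pow 2)
  have b3 : ∫ y in (0:ℝ)..1, q y * ‖w y‖ ^ 2 ≤ 1 / κ * nr w ^ 2 := by
    rw [nr_sq, ← intervalIntegral.integral_const_mul]
    apply intervalIntegral.integral_mono_on (by norm_num) (ii_of_cont cqw) ((ii_of_cont cw2).const_mul _)
    intro y hy
    have := qle y hy
    gcongr
  have b30 : 0 ≤ ∫ y in (0:ℝ)..1, q y * ‖w y‖ ^ 2 :=
    intervalIntegral.integral_nonneg (by norm_num) (fun y hy => mul_nonneg (qpos y hy).le (by positivity))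
  have b4 : 1 / (2 * M) * nr w1 ^ 2 ≤ ∫ y in (0:ℝ)..1, q y * ‖w1 y‖ ^ 2 := by
    rw [nr_sq, ← intervalIntegral.integral_const_mul]
    apply intervalIntegral.integral_mono_on (by norm_num) ((ii_of_cont cw12).const_mul _) (ii_of_cont cqw1)
    intro y hy
    have := qge y hy
    gcongr
  -- final algebra
  have n_f := nr_nonneg f
  have n_w := nr_nonneg w
  have n_w1 := nr_nonneg w1
  have fin1 : nw V lam r (fun y => ((κ * q y : ℝ) : ℂ) * (starRingEnd ℂ) (φ y)) * (nr f / r + (1 + e + M ^ 2) * (r * nr w) + M * (r ^ 3 * nr w1))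
      + r * nr (fun y => ((κ * q1 y : ℝ) : ℂ) * (starRingEnd ℂ) (φ y) + ((κ * q y : ℝ) : ℂ) * (starRingEnd ℂ) (φ1 y)) * (r ^ 3 * nr w1)
      ≤ 2 * M * s * (nr f / r + (2 + M ^ 2) * (r * nr w) + M * (r ^ 3 * nr w1))
      + r * ((M / κ + 1) * EE K φ φ1) * (r ^ 3 * nr w1) := by
    have h3 : nr f / r + (1 + e + M ^ 2) * (r * nr w) + M * (r ^ 3 * nr w1) ≤
      nr f / r + (2 + M ^ 2) * (r * nr w) + M * (r ^ 3 * nr w1) := by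
        gcongr; linarith
    gcongr
  have P2 := P.trans fin1
  rw [i1, i2, i3, i4] at T
  generalize hI1 : (∫ y in (0:ℝ)..1, q y * (V y - lam) * ‖w y‖ ^ 2) = I1 at *
  generalize hI2 : (∫ y in (0:ℝ)..1, q y * ‖w y‖ ^ 2) = I2 at *
  generalize hI3 : (∫ y in (0:ℝ)..1, q y * ‖w1 y‖ ^ 2) = I3 at *
  generalize hI4 : (∫ y in (0:ℝ)..1, (q1 y : ℂ) * (starRingEnd ℂ) (w y) * w1 y) = I4 at *
  generalize hI5 : (∫ y in (0:ℝ)..1, (q y : ℂ) * (starRingEnd ℂ) (w y) * f y) = I5 at *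
  generalize hI6 : (∫ y in (0:ℝ)..1, ((κ * q y : ℝ) : ℂ) * (starRingEnd ℂ) (φ y) * w y) = I6 at *
  generalize hI7 : (∫ y in (0:ℝ)..1, V2 y * (κ * q y) * kp V lam r y * ‖φ y‖ ^ 2) = I7 at *
  have im := congrArg Complex.im T
  have rr : ((r:ℂ) ^ 6) = ((r ^ 6 : ℝ) : ℂ) := by push_cast; rfl
  have kk : ((K:ℂ) ^ 2) = ((K ^ 2 : ℝ) : ℂ) := by push_cast; rfl
  rw [rr, kk] at im
  simp only [Complex.add_im, Complex.mul_im, Complex.mul_re, Complex.ofReal_re, Complex.ofReal_im, Complex.I_re,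
    Complex.I_im, Complex.neg_re, Complex.neg_im, Complex.sub_im, Complex.sub_re, Complex.conj_re, Complex.conj_im, Complex.add_re,
    Complex.one_re, Complex.one_im, map_neg] at im
  have p6 : |I6.im| ≤ ‖I6 - (I7:ℂ)‖ := by
    have := Complex.abs_im_le_norm (I6 - (I7:ℂ)); simpa using this
  have p5 : |I5.im| ≤ ‖I5‖ := Complex.abs_im_le_norm _
  have p4 : |I4.re| ≤ ‖I4‖ := Complex.abs_re_le_norm _
  have po : |o.im| ≤ e * r ^ 2 := (Complex.abs_im_le_norm _).trans hs.ho
  have main : r ^ 6 * I3 ≤ |I6.im| + |I5.im| + r ^ 6 * |I4.re| + |o.im| * I2 := by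
    have e1 : r ^ 6 * I3 + r ^ 6 * K ^ 2 * I2 = -(τ * σ) * I6.im - τ * I5.im - r ^ 6 * I4.re + τ * (o.im * I2) := by
      linear_combination (-τ) * im + (- r ^ 6 * I3 - r ^ 6 * K ^ 2 * I2 - r ^ 6 * I4.re) * hτ2
    have a1 : -(τ * σ) * I6.im ≤ |I6.im| := by
      refine (le_abs_self _).trans ?_
      rw [abs_mul, abs_neg, abs_mul, hσa, hτa]; simp
    have a2 : - (τ * I5.im) ≤ |I5.im| := by
      refine (le_abs_self _).trans ?_
      rw [abs_neg, abs_mul, hτa]; simp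
    have a3 : τ * (o.im * I2) ≤ |o.im| * I2 := by
      refine (le_abs_self _).trans ?_
      rw [abs_mul, abs_mul, hτa, abs_of_nonneg b30]; simp
    have a4 : - (r ^ 6 * I4.re) ≤ r ^ 6 * |I4.re| := by
      have := neg_abs_le I4.re
      nlinarith [pow_pos hr 6]
    have a5 : 0 ≤ r ^ 6 * K ^ 2 * I2 := by positivity
    linarith
  have m1 : r ^ 6 * |I4.re| ≤ M / κ ^ 2 * (r ^ 2 * ((r * nr w) * (r ^ 3 * nr w1))) := by
    calc r ^ 6 * |I4.re| ≤ r ^ 6 * (M / κ ^ 2 * (nr w * nr w1)) := by gcongr; exact p4.trans b2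
      _ = _ := by ring
  have m2 : |I5.im| ≤ 1 / κ * ((nr f / r) * (r * nr w)) := by
    refine (p5.trans b1).trans (le_of_eq ?_)
    field_simp
  have m3 : |o.im| * I2 ≤ 1 / κ * (e * (r * nr w) ^ 2) := by
    calc |o.im| * I2 ≤ e * r ^ 2 * (1 / κ * nr w ^ 2) := by gcongr
      _ = _ := by ring
  have m4 : (r ^ 3 * nr w1) ^ 2 ≤ 2 * M * (r ^ 6 * I3) := by
    calc (r ^ 3 * nr w1) ^ 2 = 2 * M * (r ^ 6 * (1 / (2 * M) * nr w1 ^ 2)) := by field_simp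
      _ ≤ _ := by gcongr
  refine m4.trans ?_
  have p6' := p6.trans P2
  have : r ^ 6 * I3 ≤ _ := main
  gcongr
  linarith
end sol

lemma quadClose {D F B : ℝ} (hD : 0 ≤ D) (hF : 0 ≤ F) (hB : 0 ≤ B)
    (h : D ^ 2 ≤ 1 / 4 * (D + F) ^ 2 + B * (F * (D + F))) : D ≤ (2 + 2 * B) * F := by
  by_contra hc
  push Not at hc
  have h1 : (2 + 2 * B) * F * D ≤ D * D := by gcongr
  have h1' : 0 < D := lt_of_le_of_lt (by positivity) hc
  have h2 : D ^ 2 ≤ (1 + 2 * B) * F ^ 2 + 2 * B * (F * D) := by nlinarith [sq_nonneg (D - F)]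
  have h3 : 2 * (F * D) ≤ (1 + 2 * B) * F ^ 2 := by nlinarith
  have h4 : F * ((2 + 2 * B) * F) ≤ F * D := by gcongr
  have h5 : (3 + 2 * B) * F ^ 2 ≤ 0 := by nlinarith
  have h6 : F ^ 2 ≤ 0 := by nlinarith [sq_nonneg F]
  have h7 : F = 0 := by nlinarith
  rw [h7] at h2
  nlinarith

set_option maxHeartbeats 1000000 in
lemma algA {M K q r e E m F X D Q J : ℝ} (hM : 1 ≤ M) (hq : 0 < q) (hqK : q ^ 2 = K) (hr : 0 < r) 
    (hKr : K * r ^ 2 ≤ M) (hmE : E = q * m) (hm : 0 ≤ m) (hF : 0 ≤ F) (hX : 0 ≤ X) (hD : 0 ≤ D)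
    (he0 : 0 ≤ e)
    (hEJ : |E ^ 2 + J| ≤ 2 * M * m * (F + (2 + M ^ 2) * X + M * D) + r * E * D)
    (hJ : |J| ≤ 3075 * M ^ 6 * (m * E))
    (hW : X ≤ 2 * (Q + F + 9 * M * D)) (hQ : Q ≤ 2 * M ^ 2 * m)
    (hIm : D ^ 2 ≤ 2 * M * (2 * M * m * (F + (2 + M ^ 2) * X + M * D) + r * ((M / 1 + 1) * E) * D
      + 1 / 1 * (F * X) + M / 1 ^ 2 * (r ^ 2 * (X * D)) + 1 / 1 * (e * X ^ 2)))
    (hK0 : 40000000 * M ^ 12 ≤ K) (hr0 : r ^ 2 ≤ 1 / (16224 * M ^ 4)) (he : e ≤ 1 / (16224 * M ^ 3)) :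
    (F + X + D) + q * E ≤ (26 * M * (3 + 104 * M ^ 2) * (1 + 14 * M ^ 3)) * F := by
  have hM0 : 0 < M := by linarith
  have hrq : r * q ≤ M := by
    refine abs_le_of_sq_le_sq' ?_ hM0.le |>.2
    nlinarith
  have hrE : r * E ≤ M * m := by rw [hmE]; nlinarith
  obtain ⟨S, hS⟩ : ∃ S, S = F + X + D := ⟨_, rfl⟩
  have hS0 : 0 ≤ S := by linarith
  have hM2 : 1 ≤ M ^ 2 := one_le_pow₀ hM
  have hMM : M ≤ M ^ 2 := by nlinarith only [hM]
  have hA : F + (2 + M ^ 2) * X + M * D ≤ 3 * M ^ 2 * S := by rw [hS]; nlinarith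
  have hDS : D ≤ S := by linarith
  have hXS : X ≤ S := by linarith
  have k1 : |E ^ 2 + J| ≤ 7 * M ^ 3 * (m * S) := by
    refine hEJ.trans ?_
    have a1 : 2 * M * m * (F + (2 + M ^ 2) * X + M * D) ≤ 2 * M * m * (3 * M ^ 2 * S) := by gcongr
    have a2 : r * E * D ≤ M * m * S := by gcongr
    have a3 : M * m * S ≤ M ^ 3 * m * S := by
      gcongr; nlinarith
    linarith only [a1,a2,a3]
  have k2 : E ^ 2 ≤ 7 * M ^ 3 * (m * S) + 3075 * M ^ 6 * (m * E) := by
    have := le_abs_self (E ^ 2 + J)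
    have := neg_abs_le J
    linarith
  have hq6 : 6150 * M ^ 6 ≤ q := by
    refine abs_le_of_sq_le_sq' ?_ hq.le |>.2
    rw [hqK]; nlinarith [pow_pos hM0 12]
  have k3 : K * m ≤ 14 * M ^ 3 * S := by
    rcases hm.eq_or_lt with h | h
    · rw [← h]; simp; positivity
    · rw [hmE] at k2
      have : q ^ 2 * m ≤ 7 * M ^ 3 * S + 3075 * M ^ 6 * (q * m) := by
        by_contra hc
        push Not at hc
        nlinarith
      have h2 : 6150 * M ^ 6 * (q * m) ≤ q * (q * m) := by gcongr
      rw [← hqK]; nlinarith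
  have hKpos : 0 < K := by rw [← hqK]; positivity
  have mS : m ≤ 14 * M ^ 3 / K * S := by
    rw [div_mul_eq_mul_div, le_div_iff₀ hKpos]; linarith
  have p5 : M ^ 5 ≤ M ^ 12 := pow_le_pow_right₀ hM (by norm_num)
  have p9 : M ^ 9 ≤ M ^ 12 := pow_le_pow_right₀ hM (by norm_num)
  have k4 : 4 * M ^ 2 * m ≤ S / 4 := by
    have : 4 * M ^ 2 * m * K ≤ S / 4 * K := by
      have h1 : 4 * M ^ 2 * (K * m) ≤ 4 * M ^ 2 * (14 * M ^ 3 * S) := by gcongr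
      have h2 : (224 * M ^ 5) * S ≤ K * S := by
        gcongr; nlinarith [pow_pos hM0 12]
      nlinarith
    exact le_of_mul_le_mul_right this hKpos
  have k5 : S ≤ 26 * M * (D + F) := by
    have : X ≤ 18 * M * (D + F) + S / 4 := by nlinarith
    nlinarith
  have k6 : D ^ 2 ≤ 2 * M * ((112 * M ^ 6 / K + M * r ^ 2 + e) * S ^ 2) + 2 * M * (F * S) := by
    refine hIm.trans ?_
    have a1 : 2 * M * m * (F + (2 + M ^ 2) * X + M * D) ≤ 2 * M * m * (3 * M ^ 2 * S) := by gcongr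
    have a2 : r * ((M / 1 + 1) * E) * D ≤ (M + 1) * (M * m) * S := by
      calc r * ((M / 1 + 1) * E) * D = (M + 1) * (r * E) * D := by ring
        _ ≤ _ := by gcongr
    have a3 : (M + 1) * (M * m) * S ≤ 2 * M ^ 3 * m * S := by
      have : (M + 1) * M ≤ 2 * M ^ 3 := by nlinarith
      calc (M + 1) * (M * m) * S = ((M + 1) * M) * (m * S) := by ring
        _ ≤ 2 * M ^ 3 * (m * S) := by gcongr
        _ = _ := by ring
    have a4 : 8 * M ^ 3 * m * S ≤ 8 * M ^ 3 * (14 * M ^ 3 / K * S) * S := by gcongr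
    have a5 : F * X ≤ F * S := by gcongr
    have a6 : r ^ 2 * (X * D) ≤ r ^ 2 * (S * S) := by gcongr
    have a7 : e * X ^ 2 ≤ e * S ^ 2 := by gcongr
    have a8 : M * (r ^ 2 * (X * D)) ≤ M * (r ^ 2 * (S * S)) := by gcongr
    have : 2 * M * m * (F + (2 + M ^ 2) * X + M * D) + r * ((M / 1 + 1) * E) * D
      + 1 / 1 * (F * X) + M / 1 ^ 2 * (r ^ 2 * (X * D)) + 1 / 1 * (e * X ^ 2) ≤ 
      (112 * M ^ 6 / K + M * r ^ 2 + e) * S ^ 2 + F * S := by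
      have e1 : 8 * M ^ 3 * (14 * M ^ 3 / K * S) * S = 112 * M ^ 6 / K * S ^ 2 := by ring
      have e2 : M / 1 ^ 2 * (r ^ 2 * (X * D)) = M * (r ^ 2 * (X * D)) := by ring
      rw [e2]
      linarith
    calc _ ≤ 2 * M * ((112 * M ^ 6 / K + M * r ^ 2 + e) * S ^ 2 + F * S) := by gcongr
      _ = _ := by ring
  have c1 : 112 * M ^ 6 / K ≤ 1 / (16224 * M ^ 3) := by
    rw [div_le_div_iff₀ hKpos (by positivity)]
    nlinarith [pow_pos hM0 12]
  have c2 : M * r ^ 2 ≤ 1 / (16224 * M ^ 3) := by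
    calc M * r ^ 2 ≤ M * (1 / (16224 * M ^ 4)) := by gcongr
      _ = _ := by field_simp
  have c3 : 112 * M ^ 6 / K + M * r ^ 2 + e ≤ 3 * (1 / (16224 * M ^ 3)) := by linarith
  have k7 : D ^ 2 ≤ 1 / 4 * (D + F) ^ 2 + 52 * M ^ 2 * (F * (D + F)) := by
    refine k6.trans ?_
    have a1 : 2 * M * ((112 * M ^ 6 / K + M * r ^ 2 + e) * S ^ 2) ≤ 2 * M * (3 * (1 / (16224 * M ^ 3)) * (26 * M * (D + F)) ^ 2) := by
      gcongr
    have a2 : 2 * M * (F * S) ≤ 2 * M * (F * (26 * M * (D + F))) := by gcongr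
    have a3 : 2 * M * (3 * (1 / (16224 * M ^ 3)) * (26 * M * (D + F)) ^ 2) = 1 / 4 * (D + F) ^ 2 := by
      field_simp; ring
    linarith
  have k8 := quadClose hD hF (by positivity) k7
  have k9 : S ≤ 26 * M * (3 + 104 * M ^ 2) * F := by
    refine k5.trans ?_
    have : D + F ≤ (3 + 104 * M ^ 2) * F := by linarith
    calc _ ≤ 26 * M * ((3 + 104 * M ^ 2) * F) := by gcongr
      _ = _ := by ring
  have k10 : q * E ≤ 14 * M ^ 3 * S := by
    rw [hmE]; calc q * (q * m) = K * m := by rw [← hqK]; ring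
      _ ≤ _ := k3
  rw [← hS]
  calc S + q * E ≤ (1 + 14 * M ^ 3) * S := by linarith
    _ ≤ (1 + 14 * M ^ 3) * (26 * M * (3 + 104 * M ^ 2) * F) := by gcongr
    _ = _ := by ring

set_option maxHeartbeats 1000000 in
lemma algB1 {M K r e E F X D Q J C K0 : ℝ} (hM : 1 ≤ M) (hC : 1 ≤ C) (hr : 0 < r) (hr1 : r ≤ 1)
    (hK1 : 1 ≤ K) (hK : K ≤ K0) (hE : 0 ≤ E)
    (hF : 0 ≤ F) (hX : 0 ≤ X) (hD : 0 ≤ D) (hQ : 0 ≤ Q) (he0 : 0 ≤ e)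
    (hc : E ^ 2 ≤ C * (|E ^ 2 + J| + Q ^ 2))
    (hEJ : |E ^ 2 + J| ≤ 2 * M * E * (F + (2 + M ^ 2) * X + M * D) + r * E * D)
    (hW : X ≤ 2 * (Q + F + 9 * M * D))
    (hQb : Q ^ 2 ≤ Q * (9 * M * D + 2 * F + (M ^ 3 * r ^ 2 + 2 * (K ^ 2 * r ^ 4) + 2 * e) * X)
      + r * (2 * M * E) * (M * X + 2 * D + 3 * M ^ 3 * Q))
    (hr0 : r * (19 * M * (M ^ 3 + 2 * K0 ^ 2) + 7680 * C * M ^ 8) ≤ 1 / 16) (he : 38 * M * e ≤ 1 / 16) :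
    E ≤ 2240 * C * M ^ 5 * (D + F) ∧ F + X + D ≤ 2240 * C * M ^ 5 * (D + F) := by
  have hM0 : 0 < M := by linarith
  obtain ⟨S, hS⟩ : ∃ S, S = F + X + D := ⟨_, rfl⟩
  obtain ⟨T, hT⟩ : ∃ T, T = Q + F + D := ⟨_, rfl⟩
  obtain ⟨G, hG⟩ : ∃ G, G = D + F := ⟨_, rfl⟩
  have hS0 : 0 ≤ S := by linarith
  have hT0 : 0 ≤ T := by linarith
  have hG0 : 0 ≤ G := by linarith
  have hM2 : 1 ≤ M ^ 2 := one_le_pow₀ hM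
  have hM3 : 1 ≤ M ^ 3 := one_le_pow₀ hM
  have hMM : M ≤ M ^ 2 := by nlinarith only [hM]
  have hA : F + (2 + M ^ 2) * X + M * D ≤ 3 * M ^ 2 * S := by rw [hS]; nlinarith
  have k1 : |E ^ 2 + J| ≤ 7 * M ^ 3 * (E * S) := by
    refine hEJ.trans ?_
    have a1 : 2 * M * E * (F + (2 + M ^ 2) * X + M * D) ≤ 2 * M * E * (3 * M ^ 2 * S) := by gcongr
    have a2 : r * E * D ≤ 1 * E * S := by gcongr; linarith
    have a3 : 1 * E * S ≤ M ^ 3 * E * S := by gcongr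
    linarith only [a1, a2, a3]
  have k2 : E ^ 2 ≤ C * (7 * M ^ 3 * (E * S) + Q ^ 2) := hc.trans (by gcongr)
  have k3 : E ≤ 8 * C * M ^ 3 * (S + Q) := by
    by_contra h
    push Not at h
    have hCM : 1 ≤ C * M ^ 3 := one_le_mul_of_one_le_of_one_le hC hM3
    have hCM' : C ≤ C * M ^ 3 := le_mul_of_one_le_right (by linarith) hM3
    have hQE : Q ≤ E := by
      have : S + Q ≤ 8 * C * M ^ 3 * (S + Q) := by
        apply le_mul_of_one_le_left (by linarith); linarith only [hCM]
      linarith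
    have hE' : 0 < E := lt_of_le_of_lt (by positivity) h
    have h1 : 8 * C * M ^ 3 * (S + Q) * E < E * E := by gcongr
    have h2 : C * Q ^ 2 ≤ C * M ^ 3 * (Q * E) := by
      calc C * Q ^ 2 ≤ (C * M ^ 3) * (Q * Q) := by rw [sq]; gcongr
        _ ≤ _ := by gcongr
    have h3 : 0 ≤ C * M ^ 3 * (Q * E) := by positivity
    have h4 : 0 ≤ C * M ^ 3 * (E * S) := by positivity
    linarith only [h1,h2,h3,h4,k2]
  have k4 : S ≤ 19 * M * T := by
    have h1 : Q ≤ M * Q := le_mul_of_one_le_left hQ hM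
    have h2 : F ≤ M * F := le_mul_of_one_le_left hF hM
    have h3 : D ≤ M * D := le_mul_of_one_le_left hD hM
    rw [hS, hT]; linarith only [h1, h2, h3, hW, hQ, hF, hD]
  have k5 : E ≤ 160 * C * M ^ 4 * T := by
    refine k3.trans ?_
    have : S + Q ≤ 20 * M * T := by
      have h1 : Q ≤ M * Q := le_mul_of_one_le_left hQ hM
      have h2 : M * Q ≤ M * T := by gcongr; linarith
      linarith only [h1, h2, k4]
    calc _ ≤ 8 * C * M ^ 3 * (20 * M * T) := by gcongr
      _ = _ := by ring
  have k6 : Q ^ 2 ≤ 9 * M * (Q * G) + 1 / 8 * T ^ 2 := by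
    refine hQb.trans ?_
    have hXT : X ≤ 19 * M * T := by linarith
    have hDT : D ≤ T := by linarith
    have hQT : Q ≤ T := by linarith
    have a1 : M ^ 3 * r ^ 2 + 2 * (K ^ 2 * r ^ 4) + 2 * e ≤ r * (M ^ 3 + 2 * K0 ^ 2) + 2 * e := by
      have b1 : r ^ 2 ≤ r := by nlinarith only [hr, hr1]
      have b2 : r ^ 4 ≤ r := by nlinarith [sq_nonneg (r ^ 2), pow_pos hr 2]
      have b3 : M ^ 3 * r ^ 2 ≤ M ^ 3 * r := by gcongr
      have b4 : K ^ 2 * r ^ 4 ≤ K0 ^ 2 * r := by gcongr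
      linarith
    have a2 : (M ^ 3 * r ^ 2 + 2 * (K ^ 2 * r ^ 4) + 2 * e) * X ≤ (r * (M ^ 3 + 2 * K0 ^ 2) + 2 * e) * (19 * M * T) := by
      gcongr
    have a3 : Q * ((M ^ 3 * r ^ 2 + 2 * (K ^ 2 * r ^ 4) + 2 * e) * X) ≤ T * ((r * (M ^ 3 + 2 * K0 ^ 2) + 2 * e) * (19 * M * T)) := by
      gcongr
    have a4 : M * X + 2 * D + 3 * M ^ 3 * Q ≤ 24 * M ^ 3 * T := by
      have c1 : M * X ≤ M * (19 * M * T) := by gcongr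
      have c2 : 3 * M ^ 3 * Q ≤ 3 * M ^ 3 * T := by gcongr
      have c3 : M ^ 2 * T ≤ M ^ 3 * T := by gcongr; norm_num
      have c4 : 1 * T ≤ M ^ 3 * T := by gcongr
      linarith only [c1, c2, c3, c4, hDT]
    have a5 : r * (2 * M * E) * (M * X + 2 * D + 3 * M ^ 3 * Q) ≤ r * (2 * M * (160 * C * M ^ 4 * T)) * (24 * M ^ 3 * T) := by
      gcongr
    have a6 : Q * (9 * M * D + 2 * F) ≤ 9 * M * (Q * G) := by
      rw [hG]
      have h1 : F ≤ M * F := le_mul_of_one_le_left hF hM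
      have h2 : 9 * M * D + 2 * F ≤ 9 * M * (D + F) := by linarith only [h1, hF]
      calc Q * (9 * M * D + 2 * F) ≤ Q * (9 * M * (D + F)) := by gcongr
        _ = _ := by ring
    have a7 : T * ((r * (M ^ 3 + 2 * K0 ^ 2) + 2 * e) * (19 * M * T)) + r * (2 * M * (160 * C * M ^ 4 * T)) * (24 * M ^ 3 * T)
      = (r * (19 * M * (M ^ 3 + 2 * K0 ^ 2) + 7680 * C * M ^ 8) + 38 * M * e) * T ^ 2 := by ring
    have a8 : (r * (19 * M * (M ^ 3 + 2 * K0 ^ 2) + 7680 * C * M ^ 8) + 38 * M * e) * T ^ 2 ≤ 1 / 8 * T ^ 2 := by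
      gcongr; linarith
    linarith
  have k7 : Q ≤ 13 * M * G := by
    by_contra h
    push Not at h
    have hQ' : 0 < Q := lt_of_le_of_lt (by positivity) h
    have h1 : 13 * M * G * Q < Q * Q := by gcongr
    have h2 : T ^ 2 ≤ 2 * Q ^ 2 + 2 * G ^ 2 := by
      rw [show T = Q + G by rw [hT, hG]; ring]; nlinarith [sq_nonneg (Q - G)]
    have h3' : G ≤ M * G := le_mul_of_one_le_left hG0 hM
    have h3 : G ≤ Q := by linarith only [h3', h, hG0]
    have h4 : G * G ≤ M * (Q * G) := by
      calc G * G ≤ Q * G := by gcongr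
        _ ≤ _ := le_mul_of_one_le_left (by positivity) hM
    have h5 : 0 ≤ M * (Q * G) := by positivity
    linarith only [h1,h2,h4,h5,k6]
  have k8 : T ≤ 14 * M * G := by
    have h1 : T = Q + G := by rw [hT, hG]; ring
    have h2 : G ≤ M * G := le_mul_of_one_le_left hG0 hM
    linarith only [h1, h2, k7]
  rw [← hS, ← hG]
  constructor
  · refine k5.trans ?_
    calc _ ≤ 160 * C * M ^ 4 * (14 * M * G) := by gcongr
      _ = _ := by ring
  · refine k4.trans ?_
    calc _ ≤ 19 * M * (14 * M * G) := by gcongr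
      _ = 266 * M ^ 2 * G := by ring
      _ ≤ 2240 * C * M ^ 5 * G := by
        have : M ^ 2 ≤ M ^ 5 := pow_le_pow_right₀ hM (by norm_num)
        have h2 : M ^ 5 ≤ C * M ^ 5 := le_mul_of_one_le_left (by positivity) hC
        gcongr
        linarith only [hC]

lemma algB2 {M r e E F X D κ η P : ℝ} (hM : 1 ≤ M) (hr : 0 < r) (hr1 : r ≤ 1) (hE : 0 ≤ E) (hP : 0 < P)
    (hF : 0 ≤ F) (hX : 0 ≤ X) (hD : 0 ≤ D) (he0 : 0 ≤ e) (hκ : 0 < κ) (hη : 0 < η)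
    (h1 : E ≤ P * (D + F)) (h2 : F + X + D ≤ P * (D + F))
    (hIm : D ^ 2 ≤ 2 * M * (2 * M * (η * E) * (F + (2 + M ^ 2) * X + M * D) + r * ((M / κ + 1) * E) * D
      + 1 / κ * (F * X) + M / κ ^ 2 * (r ^ 2 * (X * D)) + 1 / κ * (e * X ^ 2)))
    (hη1 : 12 * M ^ 4 * P ^ 2 * η ≤ 1 / 8) (hr0 : r * (2 * M * P ^ 2 * (M / κ + 1 + M / κ ^ 2)) ≤ 1 / 16)
    (he : 2 * M * P ^ 2 * (1 / κ) * e ≤ 1 / 16) :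
    D ≤ (2 + 2 * (2 * M * (1 / κ) * P)) * F := by
  have hM0 : 0 < M := by linarith
  obtain ⟨G, hG⟩ : ∃ G, G = D + F := ⟨_, rfl⟩
  obtain ⟨S, hS⟩ : ∃ S, S = F + X + D := ⟨_, rfl⟩
  rw [← hG] at h1 h2
  rw [← hS] at h2
  have hS0 : 0 ≤ S := by linarith
  have hG0 : 0 ≤ G := by linarith
  have hM2 : 1 ≤ M ^ 2 := one_le_pow₀ hM
  have hMM : M ≤ M ^ 2 := by nlinarith only [hM]
  have hA : F + (2 + M ^ 2) * X + M * D ≤ 3 * M ^ 2 * (P * G) := by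
    have : F + (2 + M ^ 2) * X + M * D ≤ 3 * M ^ 2 * S := by rw [hS]; nlinarith
    exact this.trans (by gcongr)
  have hXS : X ≤ P * G := by linarith
  have hDS : D ≤ P * G := by linarith
  apply quadClose hD hF (by positivity)
  rw [← hG]
  refine hIm.trans ?_
  have a1 : 2 * M * (η * E) * (F + (2 + M ^ 2) * X + M * D) ≤ 2 * M * (η * (P * G)) * (3 * M ^ 2 * (P * G)) := by gcongr
  have a2 : r * ((M / κ + 1) * E) * D ≤ r * ((M / κ + 1) * (P * G)) * (P * G) := by gcongr
  have a3 : 1 / κ * (F * X) ≤ 1 / κ * (F * (P * G)) := by gcongr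
  have a4 : M / κ ^ 2 * (r ^ 2 * (X * D)) ≤ M / κ ^ 2 * (r * ((P * G) * (P * G))) := by
    have : r ^ 2 ≤ r := by nlinarith only [hr, hr1]
    gcongr
  have a5 : 1 / κ * (e * X ^ 2) ≤ 1 / κ * (e * (P * G) ^ 2) := by gcongr
  have b : 2 * M * (2 * M * (η * E) * (F + (2 + M ^ 2) * X + M * D) + r * ((M / κ + 1) * E) * D
      + 1 / κ * (F * X) + M / κ ^ 2 * (r ^ 2 * (X * D)) + 1 / κ * (e * X ^ 2)) ≤
      2 * M * (2 * M * (η * (P * G)) * (3 * M ^ 2 * (P * G)) + r * ((M / κ + 1) * (P * G)) * (P * G)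
      + 1 / κ * (F * (P * G)) + M / κ ^ 2 * (r * ((P * G) * (P * G))) + 1 / κ * (e * (P * G) ^ 2)) := by
    gcongr
  refine b.trans ?_
  have c : 2 * M * (2 * M * (η * (P * G)) * (3 * M ^ 2 * (P * G)) + r * ((M / κ + 1) * (P * G)) * (P * G)
      + 1 / κ * (F * (P * G)) + M / κ ^ 2 * (r * ((P * G) * (P * G))) + 1 / κ * (e * (P * G) ^ 2))
      = (12 * M ^ 4 * P ^ 2 * η + r * (2 * M * P ^ 2 * (M / κ + 1 + M / κ ^ 2)) + 2 * M * P ^ 2 * (1 / κ) * e) * G ^ 2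
        + 2 * M * (1 / κ) * P * (F * G) := by ring
  rw [c]
  have : (12 * M ^ 4 * P ^ 2 * η + r * (2 * M * P ^ 2 * (M / κ + 1 + M / κ ^ 2)) + 2 * M * P ^ 2 * (1 / κ) * e) * G ^ 2 ≤ 1 / 4 * G ^ 2 := by
    gcongr; linarith
  linarith

section sol
variable {M r lam K τ e : ℝ} {V V1 V2 V3 : ℝ → ℝ} {o : ℂ} {w w1 w2 φ φ1 f : ℝ → ℂ}

lemma closeA (hp : Prof M V V1 V2 V3) (hs : Sol M r lam K τ e V V2 o w w1 w2 φ φ1 f)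
    {σ : ℝ} (hσ : σ = 1 ∨ σ = -1) (hσV : ∀ y ∈ Icc (0:ℝ) 1, 0 ≤ σ * V2 y)
    (hK0 : 40000000 * M ^ 12 ≤ K) (hr0 : r ^ 2 ≤ 1 / (16224 * M ^ 4)) (he : e ≤ 1 / (16224 * M ^ 3)) :
    nr f / r + r * nr w + r ^ 3 * nr w1 + √K * EE K φ φ1
      ≤ (26 * M * (3 + 104 * M ^ 2) * (1 + 14 * M ^ 3)) * (nr f / r) := by
  have hM := hp.hM
  have hr := hs.hr
  have hK := hs.hK
  have hK0' : 0 < K := by linarith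
  have hsq : 0 < √K := Real.sqrt_pos.2 hK0'
  have hE0 := EE_nonneg K φ φ1
  have he2 : e ≤ 1 / 2 := by
    refine he.trans ?_
    apply one_div_le_one_div_of_le (by norm_num)
    have : 1 ≤ M ^ 3 := one_le_pow₀ hM
    linarith
  have hm0 : 0 ≤ EE K φ φ1 / √K := by positivity
  have hm : ∀ y ∈ Icc (0:ℝ) 1, ‖φ y‖ ≤ EE K φ φ1 / √K := fun y hy => by
    rw [le_div_iff₀ hsq]
    apply abs_le_of_sq_le_sq' _ hE0 |>.2
    have := φ_sq_le hs y hy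
    rw [mul_pow, Real.sq_sqrt hK0'.le]; linarith
  refine algA hM hsq (Real.sq_sqrt hK0'.le) hr hs.hKr (m := EE K φ φ1 / √K) (by field_simp) hm0
    (div_nonneg (nr_nonneg f) hr.le) (mul_nonneg hr.le (nr_nonneg w)) (mul_nonneg (pow_pos hr 3).le (nr_nonneg w1)) hs.he
    (EJ hp hs (by linarith) _ hm0 hm) (J_le hp hs _ hm0 hm) (Wbound hp hs he2) (Q_le hp hs _ hm0 hm)
    (ImEst hp hs (by linarith) hσ hσV one_pos le_rfl hm0 ?_) hK0 hr0 he
  intro y hy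
  have h1 := hσV y hy
  refine le_trans ?_ (hm y hy)
  apply mul_le_of_le_one_left (norm_nonneg _)
  rw [div_le_one (by linarith)]; linarith

lemma thetaSmall (hc : ∀ a : ℝ, 0 < a → ∃ c, 0 < c ∧ ∀ y ∈ Icc a (1-a), c ≤ |V2 y|)
    {σ : ℝ} (hσ : σ = 1 ∨ σ = -1) (hσV : ∀ y ∈ Icc (0:ℝ) 1, 0 ≤ σ * V2 y) {η : ℝ} (hη : 0 < η) :
    ∃ κ, 0 < κ ∧ κ ≤ 1 ∧ ∀ (r lam K τ e : ℝ) (o : ℂ) (w w1 w2 φ φ1 f : ℝ → ℂ),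
      Sol M r lam K τ e V V2 o w w1 w2 φ φ1 f → ∀ y ∈ Icc (0:ℝ) 1,
        κ / (σ * V2 y + κ) * ‖φ y‖ ≤ η * EE K φ φ1 := by
  obtain ⟨c, hc0, hcV⟩ := hc (η ^ 2) (by positivity)
  refine ⟨min 1 (η * c), lt_min one_pos (by positivity), min_le_left _ _, ?_⟩
  intro r lam K τ e o w w1 w2 φ φ1 f hs y hy
  have hκ : 0 < min 1 (η * c) := lt_min one_pos (by positivity)
  have hκ2 : min 1 (η * c) ≤ η * c := min_le_right _ _
  generalize min 1 (η * c) = κ at *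
  have hE0 := EE_nonneg K φ φ1
  have hv := hσV y hy
  have hle1 : κ / (σ * V2 y + κ) ≤ 1 := by
    rw [div_le_one (by linarith)]; linarith
  have hn1 := nr1_le_EE (K := K) (φ := φ) (φ1 := φ1)
  have hn0 := nr_nonneg φ1
  have hn2 : nr φ1 ^ 2 ≤ EE K φ φ1 ^ 2 := by gcongr
  rcases le_or_gt y (η ^ 2) with h | h
  · refine (mul_le_of_le_one_left (norm_nonneg _) hle1).trans ?_
    apply abs_le_of_sq_le_sq' _ (by positivity) |>.2
    have := holder φ φ1 hs.cφ hs.cφ1 hs.dφ 0 y (by simp) hy hy.1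
    rw [hs.φ_0, sub_zero, sub_zero] at this
    refine this.trans ?_
    rw [mul_pow]; gcongr
  rcases le_or_gt (1 - η ^ 2) y with h' | h'
  · refine (mul_le_of_le_one_left (norm_nonneg _) hle1).trans ?_
    apply abs_le_of_sq_le_sq' _ (by positivity) |>.2
    have := holder φ φ1 hs.cφ hs.cφ1 hs.dφ y 1 hy (by simp) hy.2
    rw [hs.φ_1, zero_sub, norm_neg] at this
    refine this.trans ?_
    rw [mul_pow]; gcongr; linarith
  · have h1 := hcV y ⟨h.le, h'.le⟩
    have h2 : |V2 y| = σ * V2 y := by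
      rw [← abs_of_nonneg hv, abs_mul]
      rcases hσ with h | h <;> rw [h] <;> simp
    have h3 := φ_le_EE hs y hy
    have h4 : κ / (σ * V2 y + κ) ≤ η := by
      rw [div_le_iff₀ (by linarith)]
      nlinarith
    gcongr

lemma closeB (hp : Prof M V V1 V2 V3) (hc : ∀ a : ℝ, 0 < a → ∃ c, 0 < c ∧ ∀ y ∈ Icc a (1-a), c ≤ |V2 y|)
    {σ : ℝ} (hσ : σ = 1 ∨ σ = -1) (hσV : ∀ y ∈ Icc (0:ℝ) 1, 0 ≤ σ * V2 y) (K0 : ℝ) (hK0 : 1 ≤ K0) :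
    ∃ C r₀ e₀ : ℝ, 0 < C ∧ 0 < r₀ ∧ 0 < e₀ ∧ ∀ (r lam K τ e : ℝ) (o : ℂ) (w w1 w2 φ φ1 f : ℝ → ℂ),
      Sol M r lam K τ e V V2 o w w1 w2 φ φ1 f → K ≤ K0 → r ≤ r₀ → e ≤ e₀ →
      nr f / r + r * nr w + r ^ 3 * nr w1 + √K * EE K φ φ1 ≤ C * (nr f / r) := by
  have hM := hp.hM
  have hM0 : 0 < M := by linarith
  obtain ⟨C', r1, hC', hr1, hco⟩ := coer hp hc
  obtain ⟨C, hC, hCC⟩ : ∃ C, 1 ≤ C ∧ C' ≤ C := ⟨max 1 C', le_max_left _ _, le_max_right _ _⟩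
  obtain ⟨P, hP⟩ : ∃ P, P = 2240 * C * M ^ 5 := ⟨_, rfl⟩
  have hP0 : 0 < P := by rw [hP]; positivity
  obtain ⟨κ, hκ, hκ1, hθ⟩ := thetaSmall (M := M) (V := V) hc hσ hσV (η := 1 / (96 * M ^ 4 * P ^ 2)) (by positivity)
  have B0 : 0 < 19 * M * (M ^ 3 + 2 * K0 ^ 2) + 7680 * C * M ^ 8 := by positivity
  have B1 : 0 < 2 * M * P ^ 2 * (M / κ + 1 + M / κ ^ 2) := by positivity
  refine ⟨(1 + √K0) * P * (3 + 2 * (2 * M * (1 / κ) * P)), min r1 (min (1 / (16 * (19 * M * (M ^ 3 + 2 * K0 ^ 2) + 7680 * C * M ^ 8)))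
    (1 / (16 * (2 * M * P ^ 2 * (M / κ + 1 + M / κ ^ 2))))), min (1 / 2) (min (1 / (16 * (38 * M))) (1 / (16 * (2 * M * P ^ 2 * (1 / κ))))),
    by positivity, by positivity, by positivity, ?_⟩
  intro r lam K τ e o w w1 w2 φ φ1 f hs hKK hr0 he0
  have hra := hr0.trans (min_le_left _ _)
  have hrb := hr0.trans ((min_le_right _ _).trans (min_le_left _ _))
  have hrc := hr0.trans ((min_le_right _ _).trans (min_le_right _ _))
  have hea := he0.trans (min_le_left _ _)
  have heb := he0.trans ((min_le_right _ _).trans (min_le_left _ _))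
  have hec := he0.trans ((min_le_right _ _).trans (min_le_right _ _))
  rw [le_div_iff₀ (by positivity)] at hrb hrc heb hec
  have hr := hs.hr
  have hE0 := EE_nonneg K φ φ1
  have hF0 : 0 ≤ nr f / r := div_nonneg (nr_nonneg f) hr.le
  have hX0 : 0 ≤ r * nr w := mul_nonneg hr.le (nr_nonneg w)
  have hD0 : 0 ≤ r ^ 3 * nr w1 := mul_nonneg (pow_pos hr 3).le (nr_nonneg w1)
  have hQ0 := nw_nonneg V lam r (fun y => (V2 y : ℂ) * φ y)
  have hcc := hco r lam K τ e o w w1 w2 φ φ1 f hs hra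
  have hcc' : EE K φ φ1 ^ 2 ≤ C * (|EE K φ φ1 ^ 2 + Jr V V2 lam r φ| + nw V lam r (fun y => (V2 y : ℂ) * φ y) ^ 2) :=
    hcc.trans (by gcongr)
  obtain ⟨g1, g2⟩ := algB1 hM hC hr hs.hr1 hs.hK hKK hE0 hF0 hX0 hD0 hQ0 hs.he hcc'
    (EJ hp hs (by linarith) _ hE0 (φ_le_EE hs)) (Wbound hp hs hea) (Qbound hp hs) (by linarith) (by linarith)
  rw [← hP] at g1 g2
  have g3 := algB2 hM hr hs.hr1 hE0 hP0 hF0 hX0 hD0 hs.he hκ (η := 1 / (96 * M ^ 4 * P ^ 2)) (by positivity) g1 g2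
    (ImEst hp hs (by linarith) hσ hσV hκ hκ1 (by positivity) (hθ r lam K τ e o w w1 w2 φ φ1 f hs))
    (by rw [show 12 * M ^ 4 * P ^ 2 * (1 / (96 * M ^ 4 * P ^ 2)) = 1 / 8 by field_simp; norm_num]) (by linarith) (by linarith)
  have hsK : √K ≤ √K0 := Real.sqrt_le_sqrt hKK
  have h4 : √K * EE K φ φ1 ≤ √K0 * (P * (r ^ 3 * nr w1 + nr f / r)) := by gcongr
  have h5 : r ^ 3 * nr w1 + nr f / r ≤ (3 + 2 * (2 * M * (1 / κ) * P)) * (nr f / r) := by linarith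
  calc _ ≤ (1 + √K0) * P * (r ^ 3 * nr w1 + nr f / r) := by linarith
    _ ≤ (1 + √K0) * P * ((3 + 2 * (2 * M * (1 / κ) * P)) * (nr f / r)) := by gcongr
    _ = _ := by ring

/-- the closed estimate -/
lemma closeAll (hp : Prof M V V1 V2 V3) (hc : ∀ a : ℝ, 0 < a → ∃ c, 0 < c ∧ ∀ y ∈ Icc a (1-a), c ≤ |V2 y|)
    {σ : ℝ} (hσ : σ = 1 ∨ σ = -1) (hσV : ∀ y ∈ Icc (0:ℝ) 1, 0 ≤ σ * V2 y) :
    ∃ C r₀ e₀ : ℝ, 0 < C ∧ 0 < r₀ ∧ 0 < e₀ ∧ e₀ ≤ 1 ∧ ∀ (r lam K τ e : ℝ) (o : ℂ) (w w1 w2 φ φ1 f : ℝ → ℂ),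
      Sol M r lam K τ e V V2 o w w1 w2 φ φ1 f → r ≤ r₀ → e ≤ e₀ →
      nr f / r + r * nr w + r ^ 3 * nr w1 + √K * EE K φ φ1 ≤ C * (nr f / r) := by
  have hM := hp.hM
  have hM0 : 0 < M := by linarith
  obtain ⟨C, r0, e0, hC, hr0, he0, h⟩ := closeB hp hc hσ hσV (40000000 * M ^ 12) (by
    have : 1 ≤ M ^ 12 := one_le_pow₀ hM
    linarith)
  refine ⟨max C (26 * M * (3 + 104 * M ^ 2) * (1 + 14 * M ^ 3)), min r0 (1 / (16224 * M ^ 4)),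
    min 1 (min e0 (1 / (16224 * M ^ 3))), by positivity, by positivity, by positivity, min_le_left _ _, ?_⟩
  intro r lam K τ e o w w1 w2 φ φ1 f hs hr1 he1
  have hF0 : 0 ≤ nr f / r := div_nonneg (nr_nonneg f) hs.hr.le
  rcases le_or_gt K (40000000 * M ^ 12) with hK | hK
  · refine (h r lam K τ e o w w1 w2 φ φ1 f hs hK (hr1.trans (min_le_left _ _)) (he1.trans ((min_le_right _ _).trans (min_le_left _ _)))).trans ?_
    gcongr; exact le_max_left _ _
  · have a1 := hr1.trans (min_le_right _ _)
    have a2 : r ^ 2 ≤ r := by nlinarith [hs.hr, hs.hr1]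
    refine (closeA hp hs hσ hσV hK.le (a2.trans a1) (he1.trans ((min_le_right _ _).trans (min_le_right _ _)))).trans ?_
    gcongr; exact le_max_right _ _
end sol

/-- boundary data: endpoint `b`, opposite endpoint, distance `d`, profile `h`, majorant `E`. -/
structure Bd (K b b' s : ℝ) (d h h1 Ef : ℝ → ℝ) : Prop where
  ends : (b = 0 ∧ b' = 1) ∨ (b = 1 ∧ b' = 0)
  hs : s = 1 ∨ s = -1
  hd : ∀ y ∈ Icc (0:ℝ) 1, d y = |y - b|
  db : d b = 0
  dd : ∀ y, HasDerivAt d s y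
  hb' : h b' = 0
  ch : ContinuousOn h (Icc 0 1)
  ch1 : ContinuousOn h1 (Icc 0 1)
  cE : ContinuousOn Ef (Icc 0 1)
  dh : ∀ y ∈ Ioo (0:ℝ) 1, HasDerivAt h (h1 y) y
  E0 : ∀ y, 0 ≤ Ef y
  E1 : ∀ y ∈ Icc (0:ℝ) 1, Ef y ≤ 1
  nE : √K * nr (fun y => (Ef y : ℂ)) ≤ 1
  hle : ∀ y ∈ Icc (0:ℝ) 1, |h y| ≤ Ef y
  h1le : ∀ y ∈ Icc (0:ℝ) 1, |h1 y| ≤ 8 * K * Ef y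
  dhle : ∀ y ∈ Icc (0:ℝ) 1, K * (d y * |h y|) ≤ 8 * Ef y
  dh1le : ∀ y ∈ Icc (0:ℝ) 1, d y * |h1 y| ≤ 8 * Ef y

lemma quad2 {N A B : ℝ} (hN : 0 ≤ N) (hA : 0 ≤ A) (hB : 0 ≤ B) (h : N ^ 2 ≤ N * A + B ^ 2) : N ≤ A + B := by
  by_contra hc
  push Not at hc
  have h1 : 0 < N := by linarith
  have h2 : N * (A + B) < N * N := by gcongr
  have h3 : B * B ≤ N * B := by gcongr; linarith
  linarith

section sol
variable {M r lam K τ e : ℝ} {V V1 V2 V3 : ℝ → ℝ} {o : ℂ} {w w1 w2 φ φ1 f : ℝ → ℂ}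

set_option maxHeartbeats 1000000 in
lemma pairLog (hp : Prof M V V1 V2 V3) (hs : Sol M r lam K τ e V V2 o w w1 w2 φ φ1 f) (he : e ≤ 1)
    (G G1 : ℝ → ℝ) (cG : ContinuousOn G (Icc 0 1)) (cG1 : ContinuousOn G1 (Icc 0 1))
    (dG : ∀ y ∈ Ioo (0:ℝ) 1, HasDerivAt G (G1 y) y) (G_0 : G 0 = 0) (G_1 : G 1 = 0)
    {A B B' : ℝ} (hA : 0 ≤ A) (hGA : ∀ y ∈ Icc (0:ℝ) 1, |G y| ≤ A)
    (hB : r * nr (fun y => (G1 y : ℂ)) ≤ B) (hB' : nr (fun y => (G1 y : ℂ) * φ y) ≤ B' * EE K φ φ1) :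
    ‖∫ y in (0:ℝ)..1, (G y : ℂ) * w y‖ ≤ 2 * M * A * (nr f / r + (2 + M ^ 2) * (r * nr w) + M * (r ^ 3 * nr w1))
      + B * (r ^ 3 * nr w1) + 1025 * M ^ 5 * (M * (2 * A + B') * EE K φ φ1) := by
  have hM := hp.hM
  have hM0 : 0 < M := by linarith
  have hr := hs.hr
  have n_f := nr_nonneg f
  have n_w := nr_nonneg w
  have n_w1 := nr_nonneg w1
  have he0 := hs.he
  have cGc := cC cG
  have cG1c := cC cG1
  have cV2c := cC hp.cV2
  have cV3c := cC hp.cV3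
  have P := pairing hp hs (fun y => (G y : ℂ)) (fun y => (G1 y : ℂ)) cGc cG1c (fun y hy => (dG y hy).ofReal_comp)
    (by simp [G_0]) (by simp [G_1])
  have q1 : ContinuousOn (fun y => (V3 y : ℂ) * φ y * (G y : ℂ)) (Icc 0 1) := (cV3c.mul hs.cφ).mul cGc
  have q2 : ContinuousOn (fun y => (V2 y : ℂ) * φ1 y * (G y : ℂ)) (Icc 0 1) := (cV2c.mul hs.cφ1).mul cGc
  have q3 : ContinuousOn (fun y => (V2 y : ℂ) * ((G1 y : ℂ) * φ y)) (Icc 0 1) := cV2c.mul (cG1c.mul hs.cφ)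
  have q12 : ContinuousOn (fun y => (V3 y : ℂ) * φ y * (G y : ℂ) + (V2 y : ℂ) * φ1 y * (G y : ℂ)) (Icc 0 1) := q1.add q2
  have L := globalLog hp (lam := lam) hr hs.hr1 (fun y => (V2 y : ℂ) * φ y * (G y : ℂ))
    (fun y => ((V3 y : ℂ) * φ y * (G y : ℂ) + (V2 y : ℂ) * φ1 y * (G y : ℂ)) + (V2 y : ℂ) * ((G1 y : ℂ) * φ y))
    ((cV2c.mul hs.cφ).mul cGc) (q12.add q3) (fun y hy => by
      have := (((hp.dV2 y hy).ofReal_comp).mul (hs.dφ y hy)).mul ((dG y hy).ofReal_comp)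
      exact this.congr_deriv (by simp only [Pi.mul_apply]; ring)) (by simp [G_0]) (by simp [G_1])
  have N1 := nr_le _ φ (M * A) (by positivity) q1 hs.cφ (fun y hy => by
    rw [norm_mul, norm_mul, nC, nC]
    have h1 := hp.b3 y hy
    have h2 := hGA y hy
    calc |V3 y| * ‖φ y‖ * |G y| ≤ M * ‖φ y‖ * A := by gcongr
      _ = _ := by ring)
  have N2 := nr_le _ φ1 (M * A) (by positivity) q2 hs.cφ1 (fun y hy => by
    rw [norm_mul, norm_mul, nC, nC]
    have h1 := hp.b2 y hy
    have h2 := hGA y hy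
    calc |V2 y| * ‖φ1 y‖ * |G y| ≤ M * ‖φ1 y‖ * A := by gcongr
      _ = _ := by ring)
  have N3 := nr_le _ (fun y => (G1 y : ℂ) * φ y) M (by positivity) q3 (cG1c.mul hs.cφ) (fun y hy => by
    rw [norm_mul (V2 y : ℂ), nC]
    have h1 := hp.b2 y hy
    gcongr)
  have N := (nr_add _ _ q12 q3).trans (add_le_add_left (nr_add _ _ q1 q2) _)
  have h3 := nr_le_EE (φ := φ) (φ1 := φ1) hs.hK
  have h4 := nr1_le_EE (K := K) (φ := φ) (φ1 := φ1)
  have a1 : M * A * nr φ ≤ M * A * EE K φ φ1 := by gcongr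
  have a2 : M * A * nr φ1 ≤ M * A * EE K φ φ1 := by gcongr
  have a3 : M * nr (fun y => (G1 y : ℂ) * φ y) ≤ M * (B' * EE K φ φ1) := by gcongr
  have NN : nr (fun y => ((V3 y : ℂ) * φ y * (G y : ℂ) + (V2 y : ℂ) * φ1 y * (G y : ℂ)) + (V2 y : ℂ) * ((G1 y : ℂ) * φ y))
      ≤ M * (2 * A + B') * EE K φ φ1 := by linarith
  have L2 := L.trans (mul_le_mul_of_nonneg_left NN (by positivity : 0 ≤ 1025 * M ^ 5))
  have ie : (∫ y in (0:ℝ)..1, (kp V lam r y : ℂ) * ((V2 y : ℂ) * φ y * (G y : ℂ)))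
      = ∫ y in (0:ℝ)..1, (V2 y : ℂ) * φ y * (G y : ℂ) * (kp V lam r y : ℂ) := by
    congr 1; ext y; ring
  rw [ie] at L2
  have nwg := nw_le lam hp hr (fun y => (G y : ℂ)) A hA cGc (fun y hy => by rw [nC]; exact hGA y hy)
  have h5 : nr f / r + (1 + e + M ^ 2) * (r * nr w) + M * (r ^ 3 * nr w1) ≤
      nr f / r + (2 + M ^ 2) * (r * nr w) + M * (r ^ 3 * nr w1) := by
        gcongr; linarith
  have b1 : nw V lam r (fun y => (G y : ℂ)) * (nr f / r + (1 + e + M ^ 2) * (r * nr w) + M * (r ^ 3 * nr w1))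
      ≤ 2 * M * A * (nr f / r + (2 + M ^ 2) * (r * nr w) + M * (r ^ 3 * nr w1)) := by
    gcongr
  have b2 : r * nr (fun y => (G1 y : ℂ)) * (r ^ 3 * nr w1) ≤ B * (r ^ 3 * nr w1) := by gcongr
  have tri := norm_le_norm_sub_add (∫ y in (0:ℝ)..1, (G y : ℂ) * w y)
    (∫ y in (0:ℝ)..1, (V2 y : ℂ) * φ y * (G y : ℂ) * (kp V lam r y : ℂ))
  linarith

set_option maxHeartbeats 1000000 in
/-- bound on `(V - λ) w` -/
lemma sw_le (hp : Prof M V V1 V2 V3) (hs : Sol M r lam K τ e V V2 o w w1 w2 φ φ1 f) (he : e ≤ 1) :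
    nr (fun y => ((V y - lam : ℝ) : ℂ) * w y) ≤ M * nr φ + 2 * M * (r * (nr f / r + r * nr w + r ^ 3 * nr w1)) := by
  have hM := hp.hM
  have hM0 : 0 < M := by linarith
  have hr := hs.hr
  have n_f := nr_nonneg f
  have n_w := nr_nonneg w
  have n_w1 := nr_nonneg w1
  have n_φ := nr_nonneg φ
  have he0 := hs.he
  have cs : ContinuousOn (fun y => V y - lam) (Icc 0 1) := hp.cV.sub continuousOn_const
  have csc := cC cs
  have cwb := cconj hs.cw
  have cw1b := cconj hs.cw1
  have cV1c := cC hp.cV1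
  have cN : ContinuousOn (fun y => ((V y - lam : ℝ) : ℂ) * w y) (Icc 0 1) := csc.mul hs.cw
  have T := testEq hp hs (fun y => ((V y - lam : ℝ) : ℂ) * (starRingEnd ℂ) (w y))
    (fun y => (V1 y : ℂ) * (starRingEnd ℂ) (w y) + ((V y - lam : ℝ) : ℂ) * (starRingEnd ℂ) (w1 y))
    (csc.mul cwb) ((cV1c.mul cwb).add (csc.mul cw1b))
    (fun y hy => (((hp.dV y hy).sub_const lam).ofReal_comp).mul ((hs.dw y hy).star)) (by simp [hs.w_0]) (by simp [hs.w_1])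
  have i1 : (∫ y in (0:ℝ)..1, ((V y - lam : ℝ) : ℂ) * (starRingEnd ℂ) (w y) * ((V y - lam : ℝ) : ℂ) * w y)
      = ((nr (fun y => ((V y - lam : ℝ) : ℂ) * w y) ^ 2 : ℝ) : ℂ) := by
    rw [nr_sq, ← intervalIntegral.integral_ofReal]; congr 1; ext y
    have := conj_mul_self' (w y)
    rw [norm_mul, nC, mul_pow, sq_abs]
    push_cast at *
    linear_combination (V y - lam : ℂ) ^ 2 * this
  have i2 : (∫ y in (0:ℝ)..1, ((V y - lam : ℝ) : ℂ) * (starRingEnd ℂ) (w y) * w y)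
      = ((∫ y in (0:ℝ)..1, (V y - lam) * ‖w y‖ ^ 2 : ℝ) : ℂ) := by
    rw [← intervalIntegral.integral_ofReal]; congr 1; ext y
    have := conj_mul_self' (w y)
    push_cast at *
    linear_combination (V y - lam : ℂ) * this
  have i3 := lin2 (T := fun y => ((V1 y : ℂ) * (starRingEnd ℂ) (w y) + ((V y - lam : ℝ) : ℂ) * (starRingEnd ℂ) (w1 y)) * w1 y)
    (A := fun y => (V1 y : ℂ) * (starRingEnd ℂ) (w y) * w1 y) (B := fun y => (((V y - lam) * ‖w1 y‖ ^ 2 : ℝ) : ℂ)) 1 1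
    ((cV1c.mul cwb).mul hs.cw1) (cC (cs.mul (hs.cw1.norm.pow 2))) (fun y _ => by
      have := conj_mul_self' (w1 y)
      push_cast at *
      linear_combination (V y - lam : ℂ) * this)
  rw [intervalIntegral.integral_ofReal] at i3
  have b1 := csb (fun y => ((V y - lam : ℝ) : ℂ) * (starRingEnd ℂ) (w y) * (V2 y : ℂ) * φ y)
    (fun y => ((V y - lam : ℝ) : ℂ) * w y) φ M hM0.le cN hs.cφ (fun y hy => by
      simp only [norm_mul, nC, RCLike.norm_conj]
      have := hp.b2 y hy
      calc |V y - lam| * ‖w y‖ * |V2 y| * ‖φ y‖ ≤ |V y - lam| * ‖w y‖ * M * ‖φ y‖ := by gcongr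
        _ = _ := by ring)
  have b2 := csb (fun y => ((V y - lam : ℝ) : ℂ) * (starRingEnd ℂ) (w y) * f y)
    (fun y => ((V y - lam : ℝ) : ℂ) * w y) f 1 zero_le_one cN hs.cf (fun y hy => by
      simp only [norm_mul, nC, RCLike.norm_conj]; linarith)
  have b3 := csb (fun y => (V1 y : ℂ) * (starRingEnd ℂ) (w y) * w1 y) w w1 M hM0.le hs.cw hs.cw1 (fun y hy => by
      simp only [norm_mul, nC, RCLike.norm_conj]
      have := hp.hi y hy
      have h0 := hp.V1pos y hy
      rw [abs_of_pos h0, mul_assoc]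
      gcongr)
  have b4 := csb (fun y => ((V y - lam : ℝ) : ℂ) * (starRingEnd ℂ) (w y) * w y)
    (fun y => ((V y - lam : ℝ) : ℂ) * w y) w 1 zero_le_one cN hs.cw (fun y hy => by
      simp only [norm_mul, nC, RCLike.norm_conj]; linarith)
  rw [i2, nC] at b4
  rw [i1, i2, i3] at T
  have n_N := nr_nonneg (fun y => ((V y - lam : ℝ) : ℂ) * w y)
  generalize nr (fun y => ((V y - lam : ℝ) : ℂ) * w y) = N at *
  generalize (∫ y in (0:ℝ)..1, (V y - lam) * ‖w y‖ ^ 2) = I2 at *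
  generalize (∫ y in (0:ℝ)..1, (V y - lam) * ‖w1 y‖ ^ 2) = I3 at *
  generalize (∫ y in (0:ℝ)..1, (V1 y : ℂ) * (starRingEnd ℂ) (w y) * w1 y) = I4 at *
  generalize (∫ y in (0:ℝ)..1, ((V y - lam : ℝ) : ℂ) * (starRingEnd ℂ) (w y) * f y) = I5 at *
  generalize (∫ y in (0:ℝ)..1, ((V y - lam : ℝ) : ℂ) * (starRingEnd ℂ) (w y) * (V2 y : ℂ) * φ y) = I6 at *
  have re := congrArg Complex.re T
  have rr : ((r:ℂ) ^ 6) = ((r ^ 6 : ℝ) : ℂ) := by push_cast; rfl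
  have kk : ((K:ℂ) ^ 2) = ((K ^ 2 : ℝ) : ℂ) := by push_cast; rfl
  rw [rr, kk] at re
  simp only [Complex.add_im, Complex.mul_im, Complex.mul_re, Complex.ofReal_re, Complex.ofReal_im, Complex.I_re,
    Complex.I_im, Complex.sub_im, Complex.sub_re, Complex.add_re,
    Complex.one_re, Complex.one_im] at re
  have hτa : |τ| = 1 := by rcases hs.hτ with h | h <;> rw [h] <;> norm_num
  have p6 : I6.re ≤ ‖I6‖ := Complex.re_le_norm _
  have p5 : I5.re ≤ ‖I5‖ := Complex.re_le_norm _
  have p4 : |I4.im| ≤ ‖I4‖ := Complex.abs_im_le_norm _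
  have po : |o.re| ≤ e * r ^ 2 := (Complex.abs_re_le_norm _).trans hs.ho
  have e1 : N ^ 2 = I6.re + I5.re - τ * r ^ 6 * I4.im - o.re * I2 := by linear_combination re
  have e2 : -(τ * r ^ 6 * I4.im) ≤ r ^ 6 * (M * (nr w * nr w1)) := by
    refine (le_abs_self _).trans ?_
    rw [abs_neg, abs_mul, abs_mul, hτa, one_mul, abs_of_pos (pow_pos hr 6)]
    gcongr; exact p4.trans b3
  have e3 : -(o.re * I2) ≤ (1 * r ^ 2) * (1 * (N * nr w)) := by
    refine (le_abs_self _).trans ?_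
    rw [abs_neg, abs_mul]
    have : e * r ^ 2 ≤ 1 * r ^ 2 := by gcongr
    gcongr; exact po.trans this
  obtain ⟨F, hF⟩ : ∃ F, F = nr f / r := ⟨_, rfl⟩
  have hF0 : 0 ≤ F := by rw [hF]; positivity
  have hfF : nr f = r * F := by rw [hF]; field_simp
  rw [← hF]
  rw [hfF] at b2
  obtain ⟨X, hX⟩ : ∃ X, X = r * nr w := ⟨_, rfl⟩
  obtain ⟨D, hD⟩ : ∃ D, D = r ^ 3 * nr w1 := ⟨_, rfl⟩
  have hX0 : 0 ≤ X := by rw [hX]; positivity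
  have hD0 : 0 ≤ D := by rw [hD]; positivity
  rw [← hX, ← hD]
  have m1 : r ^ 6 * (M * (nr w * nr w1)) = M * (r ^ 2 * (X * D)) := by rw [hX, hD]; ring
  have m2 : (1 * r ^ 2) * (1 * (N * nr w)) = N * (r * X) := by rw [hX]; ring
  have q : N ^ 2 ≤ N * (M * nr φ + r * F + r * X) + M * (r ^ 2 * (X * D)) := by
    linarith only [e1, e2, e3, m1, m2, b1, b2, p6, p5]
  have s1 : M * (r ^ 2 * (X * D)) ≤ (M * (r * (F + X + D))) ^ 2 := by
    have h1 : X * D ≤ (F + X + D) ^ 2 := by nlinarith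
    have h2 : M ≤ M ^ 2 := by nlinarith
    calc M * (r ^ 2 * (X * D)) ≤ M ^ 2 * (r ^ 2 * (F + X + D) ^ 2) := by gcongr
      _ = _ := by ring
  have s2 : N ≤ (M * nr φ + r * F + r * X) + M * (r * (F + X + D)) := by
    have hA : 0 ≤ M * nr φ + r * F + r * X := by positivity
    have hB : 0 ≤ M * (r * (F + X + D)) := by positivity
    exact quad2 n_N hA hB (q.trans (by linarith only [s1]))
  have s3 : r * (F + X + D) ≤ M * (r * (F + X + D)) := le_mul_of_one_le_left (by positivity) hM
  have s4 : 0 ≤ r * D := by positivity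
  linarith only [s2, s3, s4]
end sol

lemma Bd.d0 {K b b' s : ℝ} {d h h1 Ef : ℝ → ℝ} (hB : Bd K b b' s d h h1 Ef) : ∀ y ∈ Icc (0:ℝ) 1, 0 ≤ d y :=
  fun y hy => by rw [hB.hd y hy]; positivity

lemma Bd.cd {K b b' s : ℝ} {d h h1 Ef : ℝ → ℝ} (hB : Bd K b b' s d h h1 Ef) : ContinuousOn d (Icc 0 1) :=
  fun y _ => (hB.dd y).continuousAt.continuousWithinAt

lemma Bd.den {K b b' s r : ℝ} {d h h1 Ef : ℝ → ℝ} (hB : Bd K b b' s d h h1 Ef) (hr : 0 < r) :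
    ∀ y ∈ Icc (0:ℝ) 1, 0 < d y + r ^ 2 := fun y hy => by have := hB.d0 y hy; positivity

lemma Bd.cbb {K b b' s r : ℝ} {d h h1 Ef : ℝ → ℝ} (hB : Bd K b b' s d h h1 Ef) (hr : 0 < r) :
    ContinuousOn (fun y => r / (d y + r ^ 2)) (Icc 0 1) :=
  continuousOn_const.div (hB.cd.add continuousOn_const) (fun y hy => (hB.den hr y hy).ne')

lemma Bd.nb {K b b' s r : ℝ} {d h h1 Ef : ℝ → ℝ} (hB : Bd K b b' s d h h1 Ef) (hr : 0 < r) :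
    nr (fun y => ((r / (d y + r ^ 2) : ℝ) : ℂ)) ≤ 1 := by
  apply abs_le_of_sq_le_sq' _ zero_le_one |>.2
  rw [nr_sq]
  have hs2 : s * s = 1 := by rcases hB.hs with h | h <;> rw [h] <;> norm_num
  have e : ∀ y : ℝ, ‖((r / (d y + r ^ 2) : ℝ) : ℂ)‖ ^ 2 = (r / (d y + r ^ 2)) ^ 2 := fun y => by
    rw [nC, sq_abs]
  simp_rw [e]
  have I := intervalIntegral.integral_eq_sub_of_hasDerivAt (a := 0) (b := 1)
    (f := fun y => -s * r ^ 2 / (d y + r ^ 2)) (f' := fun y => (r / (d y + r ^ 2)) ^ 2) (fun y hy => by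
      rw [uIcc_of_le zero_le_one] at hy
      have h0 := (hB.den hr y hy).ne'
      have := (hasDerivAt_const y (-s * r ^ 2)).div ((hB.dd y).add_const (r ^ 2)) h0
      refine this.congr_deriv ?_
      field_simp
      linear_combination (r ^ 2) * hs2) (ii_of_cont ((hB.cbb hr).pow 2))
  rw [I]
  have a0 := hB.d0 0 (by simp)
  have a1 := hB.d0 1 (by simp)
  have hr2 : 0 < r ^ 2 := by positivity
  have b0 : r ^ 2 / (d 0 + r ^ 2) ≤ 1 := by rw [div_le_one (by positivity)]; linarith
  have b1 : r ^ 2 / (d 1 + r ^ 2) ≤ 1 := by rw [div_le_one (by positivity)]; linarith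
  have c0 : 0 ≤ r ^ 2 / (d 0 + r ^ 2) := by positivity
  have c1 : 0 ≤ r ^ 2 / (d 1 + r ^ 2) := by positivity
  rcases hB.hs with h | h <;> rw [h] <;> simp only [neg_mul, neg_neg, one_mul, neg_div] <;> linarith

section sol
variable {M r lam K τ e : ℝ} {V V1 V2 V3 : ℝ → ℝ} {o : ℂ} {w w1 w2 φ φ1 f : ℝ → ℂ}
variable {b b' s : ℝ} {d h h1 Ef : ℝ → ℝ}

lemma Bd.φ_le (hB : Bd K b b' s d h h1 Ef) (hs : Sol M r lam K τ e V V2 o w w1 w2 φ φ1 f) :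
    ∀ y ∈ Icc (0:ℝ) 1, ‖φ y‖ ^ 2 ≤ d y * EE K φ φ1 ^ 2 := by
  intro y hy
  have hn1 := nr1_le_EE (K := K) (φ := φ) (φ1 := φ1)
  have hn0 := nr_nonneg φ1
  have hn2 : nr φ1 ^ 2 ≤ EE K φ φ1 ^ 2 := by gcongr
  rw [hB.hd y hy]
  rcases hB.ends with ⟨h, _⟩ | ⟨h, _⟩
  · have := holder φ φ1 hs.cφ hs.cφ1 hs.dφ 0 y (by simp) hy hy.1
    rw [hs.φ_0, sub_zero, sub_zero] at this
    rw [h, sub_zero, abs_of_nonneg hy.1]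
    refine this.trans ?_
    have := hy.1
    gcongr
  · have := holder φ φ1 hs.cφ hs.cφ1 hs.dφ y 1 hy (by simp) hy.2
    rw [hs.φ_1, zero_sub, norm_neg] at this
    have h2 : 0 ≤ 1 - y := by linarith [hy.2]
    rw [h, abs_sub_comm, abs_of_nonneg h2]
    refine this.trans ?_
    gcongr

lemma Sol.rq (hp : Prof M V V1 V2 V3) (hs : Sol M r lam K τ e V V2 o w w1 w2 φ φ1 f) : r * √K ≤ M := by
  have hM := hp.hM
  have hK := hs.hK
  apply abs_le_of_sq_le_sq' _ (by linarith) |>.2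
  rw [mul_pow, Real.sq_sqrt (by linarith)]
  nlinarith [hs.hKr]

lemma Bd.KnE (hB : Bd K b b' s d h h1 Ef) (hK : 1 ≤ K) : K * nr (fun y => (Ef y : ℂ)) ≤ √K := by
  have h1 := hB.nE
  have h2 : K = √K * √K := (Real.mul_self_sqrt (by linarith)).symm
  calc K * nr (fun y => (Ef y : ℂ)) = √K * (√K * nr (fun y => (Ef y : ℂ))) := by rw [← mul_assoc, ← h2]
    _ ≤ √K * 1 := by gcongr
    _ = _ := by ring

set_option maxHeartbeats 1000000 in
lemma Gzeta (hp : Prof M V V1 V2 V3) (hs : Sol M r lam K τ e V V2 o w w1 w2 φ φ1 f) (hB : Bd K b b' s d h h1 Ef) :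
    ∃ G G1 : ℝ → ℝ, ContinuousOn G (Icc 0 1) ∧ ContinuousOn G1 (Icc 0 1) ∧
      (∀ y ∈ Ioo (0:ℝ) 1, HasDerivAt G (G1 y) y) ∧ G 0 = 0 ∧ G 1 = 0 ∧
      (∀ y ∈ Icc (0:ℝ) 1, |G y| ≤ Ef y) ∧ r * nr (fun y => (G1 y : ℂ)) ≤ 9 * M ∧
      nr (fun y => (G1 y : ℂ) * φ y) ≤ 9 * EE K φ φ1 ∧
      (∀ y ∈ Icc (0:ℝ) 1, |h y - G y| ≤ r * (r / (d y + r ^ 2))) := by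
  have hM := hp.hM
  have hr := hs.hr
  have hK := hs.hK
  have hE0 := EE_nonneg K φ φ1
  have hsa : |s| = 1 := by rcases hB.hs with h | h <;> rw [h] <;> norm_num
  have cden : ContinuousOn (fun y => d y + r ^ 2) (Icc 0 1) := hB.cd.add continuousOn_const
  have cz : ContinuousOn (fun y => d y / (d y + r ^ 2)) (Icc 0 1) :=
    hB.cd.div cden (fun y hy => (hB.den hr y hy).ne')
  have cz1 : ContinuousOn (fun y => s * r ^ 2 / (d y + r ^ 2) ^ 2) (Icc 0 1) :=
    continuousOn_const.div (cden.pow 2) (fun y hy => (pow_pos (hB.den hr y hy) 2).ne')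
  have zle : ∀ y ∈ Icc (0:ℝ) 1, |d y / (d y + r ^ 2)| ≤ 1 := fun y hy => by
    have h0 := hB.den hr y hy
    have h1 := hB.d0 y hy
    rw [abs_of_nonneg (by positivity), div_le_one h0]; nlinarith
  have c1 : ContinuousOn (fun y => h1 y * (d y / (d y + r ^ 2))) (Icc 0 1) := hB.ch1.mul cz
  have c2 : ContinuousOn (fun y => h y * (s * r ^ 2 / (d y + r ^ 2) ^ 2)) (Icc 0 1) := hB.ch.mul cz1
  have hle1 : ∀ y ∈ Icc (0:ℝ) 1, |h y| ≤ 1 := fun y hy => (hB.hle y hy).trans (hB.E1 y hy)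
  have n1 := nr_le (fun y => ((h1 y * (d y / (d y + r ^ 2)) : ℝ) : ℂ)) (fun y => (Ef y : ℂ)) (8 * K) (by positivity)
    (cC c1) (cC hB.cE) (fun y hy => by
      rw [nC, nC, abs_mul, abs_of_nonneg (hB.E0 y)]
      have a1 := zle y hy
      have a2 := hB.h1le y hy
      have a3 := hB.E0 y
      calc |h1 y| * |d y / (d y + r ^ 2)| ≤ (8 * K * Ef y) * 1 := by gcongr
        _ = _ := by ring)
  have n2 := nr_le (fun y => ((h y * (s * r ^ 2 / (d y + r ^ 2) ^ 2) : ℝ) : ℂ)) (fun y => ((r / (d y + r ^ 2) : ℝ) : ℂ)) (1 / r) (by positivity)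
    (cC c2) (cC (hB.cbb hr)) (fun y hy => by
      have h0 := hB.den hr y hy
      have hd0 := hB.d0 y hy
      have a1 := hle1 y hy
      rw [nC, nC, abs_mul, abs_div, abs_mul, hsa, abs_of_pos (show 0 < r ^ 2 by positivity), abs_of_pos (pow_pos h0 2), abs_of_pos (show 0 < r / (d y + r ^ 2) by positivity)]
      calc |h y| * (1 * r ^ 2 / (d y + r ^ 2) ^ 2) ≤ 1 * (1 * r ^ 2 / (d y + r ^ 2) ^ 2) := by gcongr
        _ = r ^ 2 / (d y + r ^ 2) * (1 / (d y + r ^ 2)) := by field_simp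
        _ ≤ 1 * (1 / (d y + r ^ 2)) := by
          gcongr; rw [div_le_one h0]; linarith
        _ = _ := by field_simp)
  have n3 := nr_le (fun y => ((h1 y * (d y / (d y + r ^ 2)) : ℝ) : ℂ) * φ y) φ (8 * K) (by positivity)
    ((cC c1).mul hs.cφ) hs.cφ (fun y hy => by
      rw [norm_mul, nC, abs_mul]
      have a1 := zle y hy
      have a2 := hB.h1le y hy
      have a3 := hB.E0 y
      have a4 := hB.E1 y hy
      calc |h1 y| * |d y / (d y + r ^ 2)| * ‖φ y‖ ≤ (8 * K * Ef y) * 1 * ‖φ y‖ := by gcongr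
        _ ≤ (8 * K * 1) * 1 * ‖φ y‖ := by gcongr
        _ = _ := by ring)
  have n4 := nr_le (fun y => ((h y * (s * r ^ 2 / (d y + r ^ 2) ^ 2) : ℝ) : ℂ) * φ y) (fun y => ((r / (d y + r ^ 2) : ℝ) : ℂ)) (EE K φ φ1) hE0
    ((cC c2).mul hs.cφ) (cC (hB.cbb hr)) (fun y hy => by
      have h0 := hB.den hr y hy
      have hd0 := hB.d0 y hy
      have a1 := hle1 y hy
      have a2 := hB.φ_le hs y hy
      rw [norm_mul, nC, nC, abs_mul, abs_div, abs_mul, hsa, abs_of_pos (show 0 < r ^ 2 by positivity), abs_of_pos (pow_pos h0 2), abs_of_pos (show 0 < r / (d y + r ^ 2) by positivity)]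
      have a3 : ‖φ y‖ ≤ √(d y) * EE K φ φ1 := by
        apply abs_le_of_sq_le_sq' _ (by positivity) |>.2
        rw [mul_pow, Real.sq_sqrt hd0]; exact a2
      have a4 : r * √(d y) ≤ d y + r ^ 2 := by
        nlinarith [Real.sq_sqrt hd0, sq_nonneg (r - √(d y)), sq_nonneg r]
      calc |h y| * (1 * r ^ 2 / (d y + r ^ 2) ^ 2) * ‖φ y‖ ≤ 1 * (1 * r ^ 2 / (d y + r ^ 2) ^ 2) * (√(d y) * EE K φ φ1) := by gcongr
        _ = (r / (d y + r ^ 2) ^ 2 * EE K φ φ1) * (r * √(d y)) := by ring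
        _ ≤ (r / (d y + r ^ 2) ^ 2 * EE K φ φ1) * (d y + r ^ 2) := by gcongr
        _ = _ := by field_simp)
  have nb := hB.nb hr
  have KnE := hB.KnE hK
  have rq := hs.rq hp
  have Kφ := Knr_le_EE (K := K) (φ := φ) (φ1 := φ1) (by linarith)
  refine ⟨fun y => h y * (d y / (d y + r ^ 2)), fun y => h1 y * (d y / (d y + r ^ 2)) + h y * (s * r ^ 2 / (d y + r ^ 2) ^ 2),
    hB.ch.mul cz, c1.add c2, ?_, ?_, ?_, ?_, ?_, ?_, ?_⟩
  · intro y hy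
    have h0 := hB.den hr y ⟨hy.1.le, hy.2.le⟩
    have := (hB.dh y hy).mul ((hB.dd y).div ((hB.dd y).add_const (r ^ 2)) h0.ne')
    refine this.congr_deriv ?_
    simp only [Pi.div_apply]
    field_simp
    ring
  · rcases hB.ends with ⟨hb, hb'⟩ | ⟨hb, hb'⟩
    · have := hB.db; rw [hb] at this; simp [this]
    · have := hB.hb'; rw [hb'] at this; simp [this]
  · rcases hB.ends with ⟨hb, hb'⟩ | ⟨hb, hb'⟩
    · have := hB.hb'; rw [hb'] at this; simp [this]
    · have := hB.db; rw [hb] at this; simp [this]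
  · intro y hy
    simp only [abs_mul]
    have a1 := zle y hy
    have a2 := hB.hle y hy
    have a3 := hB.E0 y
    calc |h y| * |d y / (d y + r ^ 2)| ≤ Ef y * 1 := by gcongr
      _ = _ := by ring
  · have := nr_add (fun y => ((h1 y * (d y / (d y + r ^ 2)) : ℝ) : ℂ)) (fun y => ((h y * (s * r ^ 2 / (d y + r ^ 2) ^ 2) : ℝ) : ℂ)) (cC c1) (cC c2)
    simp only [← Complex.ofReal_add] at this
    have h2 : 8 * K * nr (fun y => (Ef y : ℂ)) ≤ 8 * √K := by linarith
    have h3 : 1 / r * nr (fun y => ((r / (d y + r ^ 2) : ℝ) : ℂ)) ≤ 1 / r * 1 := by gcongr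
    calc _ ≤ r * (8 * √K + 1 / r * 1) := by
            gcongr; linarith
      _ = 8 * (r * √K) + 1 := by field_simp
      _ ≤ _ := by linarith
  · have := nr_add (fun y => ((h1 y * (d y / (d y + r ^ 2)) : ℝ) : ℂ) * φ y) (fun y => ((h y * (s * r ^ 2 / (d y + r ^ 2) ^ 2) : ℝ) : ℂ) * φ y) ((cC c1).mul hs.cφ) ((cC c2).mul hs.cφ)
    simp only [← add_mul, ← Complex.ofReal_add] at this
    have h3 : EE K φ φ1 * nr (fun y => ((r / (d y + r ^ 2) : ℝ) : ℂ)) ≤ EE K φ φ1 * 1 := by gcongr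
    linarith
  · intro y hy
    have h0 := hB.den hr y hy
    have e : h y - h y * (d y / (d y + r ^ 2)) = h y * (r * (r / (d y + r ^ 2))) := by field_simp; ring
    have a1 := hle1 y hy
    simp only
    rw [e, abs_mul, abs_of_pos (show 0 < r * (r / (d y + r ^ 2)) by positivity)]
    apply mul_le_of_le_one_left (by positivity) a1

set_option maxHeartbeats 2000000 in
lemma coefBound (hp : Prof M V V1 V2 V3) (hs : Sol M r lam K τ e V V2 o w w1 w2 φ φ1 f) (he : e ≤ 1)
    (hB : Bd K b b' s d h h1 Ef) :
    (1 + K * |lam - V b|) * ‖∫ y in (0:ℝ)..1, (h y : ℂ) * w y‖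
      ≤ 40000 * M ^ 7 * (nr f / r + r * nr w + r ^ 3 * nr w1 + EE K φ φ1) := by
  have hM := hp.hM
  have hM0 : 0 < M := by linarith
  have hr := hs.hr
  have hK := hs.hK
  have hK0 : 0 < K := by linarith
  have hE0 := EE_nonneg K φ φ1
  have n_f := nr_nonneg f
  have n_w := nr_nonneg w
  have n_w1 := nr_nonneg w1
  have n_φ := nr_nonneg φ
  have nb := hB.nb hr
  have KnE := hB.KnE hK
  have rq := hs.rq hp
  have Kφ := Knr_le_EE (K := K) (φ := φ) (φ1 := φ1) (by linarith)
  have nE0 := nr_nonneg (fun y => (Ef y : ℂ))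
  obtain ⟨G, G1, cG, cG1, dG, G_0, G_1, hGE, hG1, hG1φ, hhG⟩ := Gzeta hp hs hB
  have hGA : ∀ y ∈ Icc (0:ℝ) 1, |G y| ≤ 1 := fun y hy => (hGE y hy).trans (hB.E1 y hy)
  have chc := cC hB.ch
  have cGc := cC cG
  have cs : ContinuousOn (fun y => V y - lam) (Icc 0 1) := hp.cV.sub continuousOn_const
  have csc := cC cs
  have cN : ContinuousOn (fun y => ((V y - lam : ℝ) : ℂ) * w y) (Icc 0 1) := csc.mul hs.cw
  have bbn : ∀ y ∈ Icc (0:ℝ) 1, ‖((r / (d y + r ^ 2) : ℝ) : ℂ)‖ = r / (d y + r ^ 2) := fun y hy => by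
    have := hB.den hr y hy
    rw [nC, abs_of_pos (by positivity)]
  -- unweighted
  have P1 := pairLog hp hs he G G1 cG cG1 dG G_0 G_1 zero_le_one hGA hG1 hG1φ
  have U1 := csb (fun y => ((h y - G y : ℝ) : ℂ) * w y) (fun y => ((r / (d y + r ^ 2) : ℝ) : ℂ)) w r hr.le (cC (hB.cbb hr)) hs.cw (fun y hy => by
    rw [bbn y hy, norm_mul, nC, ← mul_assoc]
    have := hhG y hy
    gcongr)
  have I1 := lin2 (T := fun y => (h y : ℂ) * w y) (A := fun y => ((h y - G y : ℝ) : ℂ) * w y) (B := fun y => (G y : ℂ) * w y) 1 1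
    ((cC (hB.ch.sub cG)).mul hs.cw) (cGc.mul hs.cw) (fun y _ => by push_cast; ring)
  -- weighted, second
  obtain ⟨H, hH⟩ : ∃ H : ℝ → ℝ, H = fun y => K * h y * (V y - V b) := ⟨_, rfl⟩
  obtain ⟨H1, hH1⟩ : ∃ H1 : ℝ → ℝ, H1 = fun y => K * h1 y * (V y - V b) + K * h y * V1 y := ⟨_, rfl⟩
  have bI : b ∈ Icc (0:ℝ) 1 := by rcases hB.ends with ⟨hb, _⟩ | ⟨hb, _⟩ <;> rw [hb] <;> simp
  have Ud : ∀ y ∈ Icc (0:ℝ) 1, |V y - V b| ≤ M * d y := fun y hy => by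
    rw [hB.hd y hy]; exact (hp.lip bI hy).1
  have cH : ContinuousOn H (Icc 0 1) := by
    rw [hH]; exact (continuousOn_const.mul hB.ch).mul (hp.cV.sub continuousOn_const)
  have cH1 : ContinuousOn H1 (Icc 0 1) := by
    rw [hH1]; exact ((continuousOn_const.mul hB.ch1).mul (hp.cV.sub continuousOn_const)).add ((continuousOn_const.mul hB.ch).mul hp.cV1)
  have dH : ∀ y ∈ Ioo (0:ℝ) 1, HasDerivAt H (H1 y) y := fun y hy => by
    rw [hH, hH1]
    exact ((hB.dh y hy).const_mul K).mul ((hp.dV y hy).sub_const (V b))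
  have H_0 : H 0 = 0 := by
    rw [hH]
    rcases hB.ends with ⟨hb, hb'⟩ | ⟨hb, hb'⟩
    · simp [hb]
    · have := hB.hb'; rw [hb'] at this; simp [this]
  have H_1 : H 1 = 0 := by
    rw [hH]
    rcases hB.ends with ⟨hb, hb'⟩ | ⟨hb, hb'⟩
    · have := hB.hb'; rw [hb'] at this; simp [this]
    · simp [hb]
  have HA : ∀ y ∈ Icc (0:ℝ) 1, |H y| ≤ 8 * M := fun y hy => by
    rw [hH]; simp only
    rw [abs_mul, abs_mul, abs_of_pos hK0]
    have a1 := Ud y hy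
    have a2 := hB.dhle y hy
    have a3 := hB.E1 y hy
    calc K * |h y| * |V y - V b| ≤ K * |h y| * (M * d y) := by gcongr
      _ = M * (K * (d y * |h y|)) := by ring
      _ ≤ M * (8 * 1) := mul_le_mul_of_nonneg_left (by linarith) hM0.le
      _ = _ := by ring
  have H1A : ∀ y ∈ Icc (0:ℝ) 1, |H1 y| ≤ 9 * M * K * Ef y := fun y hy => by
    rw [hH1]; simp only
    have a1 := Ud y hy
    have a2 := hB.dh1le y hy
    have a3 := hB.hle y hy
    have a4 := hp.hi y hy
    have a5 := hp.V1pos y hy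
    have a6 := hB.E0 y
    refine (abs_add_le _ _).trans ?_
    rw [abs_mul, abs_mul, abs_mul, abs_mul, abs_of_pos hK0, abs_of_pos a5]
    have q1 : K * |h1 y| * |V y - V b| ≤ K * M * (8 * Ef y) := by
      calc K * |h1 y| * |V y - V b| ≤ K * |h1 y| * (M * d y) := by gcongr
        _ = K * M * (d y * |h1 y|) := by ring
        _ ≤ _ := by gcongr
    have q2 : K * |h y| * V1 y ≤ K * Ef y * M := by gcongr
    linarith
  have nH1 := nr_le (fun y => (H1 y : ℂ)) (fun y => (Ef y : ℂ)) (9 * M * K) (by positivity) (cC cH1) (cC hB.cE) (fun y hy => by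
    rw [nC, nC, abs_of_nonneg (hB.E0 y)]; exact H1A y hy)
  have nH1φ := nr_le (fun y => (H1 y : ℂ) * φ y) φ (9 * M * K) (by positivity) ((cC cH1).mul hs.cφ) hs.cφ (fun y hy => by
    rw [norm_mul, nC]
    have a1 := H1A y hy
    have a2 := hB.E1 y hy
    have a3 : 9 * M * K * Ef y ≤ 9 * M * K * 1 := by gcongr
    gcongr; linarith)
  have rH1 : r * nr (fun y => (H1 y : ℂ)) ≤ 9 * M ^ 2 := by
    calc r * nr (fun y => (H1 y : ℂ)) ≤ r * (9 * M * K * nr (fun y => (Ef y : ℂ))) := by gcongr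
      _ = 9 * M * (r * (K * nr (fun y => (Ef y : ℂ)))) := by ring
      _ ≤ 9 * M * (r * √K) := by gcongr
      _ ≤ 9 * M * M := by gcongr
      _ = _ := by ring
  have H1φ : nr (fun y => (H1 y : ℂ) * φ y) ≤ 9 * M * EE K φ φ1 := by
    refine nH1φ.trans ?_
    calc 9 * M * K * nr φ = 9 * M * (K * nr φ) := by ring
      _ ≤ _ := by gcongr
  have P2 := pairLog hp hs he H H1 cH cH1 dH H_0 H_1 (show 0 ≤ 8 * M by positivity) HA rH1 H1φ
  -- weighted, first
  have SW := sw_le hp hs he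
  have n_N := nr_nonneg (fun y => ((V y - lam : ℝ) : ℂ) * w y)
  have W1 := csb (fun y => ((h y - G y : ℝ) : ℂ) * (((V y - lam : ℝ) : ℂ) * w y)) (fun y => ((r / (d y + r ^ 2) : ℝ) : ℂ))
    (fun y => ((V y - lam : ℝ) : ℂ) * w y) r hr.le (cC (hB.cbb hr)) cN (fun y hy => by
    rw [bbn y hy, norm_mul ((h y - G y : ℝ) : ℂ), nC (h y - G y), ← mul_assoc]
    have := hhG y hy
    gcongr)
  have T := testEq hp hs (fun y => (G y : ℂ)) (fun y => (G1 y : ℂ)) cGc (cC cG1) (fun y hy => (dG y hy).ofReal_comp)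
    (by simp [G_0]) (by simp [G_1])
  have t1 := csb (fun y => (G y : ℂ) * (V2 y : ℂ) * φ y) (fun _ => 1) φ M hM0.le continuousOn_const hs.cφ (fun y hy => by
    rw [norm_mul, norm_mul, nC, nC, norm_one, one_mul]
    have a1 := hGA y hy
    have a2 := hp.b2 y hy
    calc |G y| * |V2 y| * ‖φ y‖ ≤ 1 * M * ‖φ y‖ := by gcongr
      _ = _ := by ring)
  have n1 : nr (fun _ => (1:ℂ)) ≤ 1 := nr_le_const _ 1 zero_le_one continuousOn_const (fun y _ => by simp)
  have GE : ∀ y ∈ Icc (0:ℝ) 1, ‖(G y : ℂ)‖ ≤ ‖(Ef y : ℂ)‖ := fun y hy => by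
    rw [nC, nC, abs_of_nonneg (hB.E0 y)]; exact hGE y hy
  have t2 := csb (fun y => (G y : ℂ) * f y) (fun y => (Ef y : ℂ)) f 1 zero_le_one (cC hB.cE) hs.cf (fun y hy => by
    rw [norm_mul, one_mul]
    have := GE y hy
    gcongr)
  have t3 := csb (fun y => (G1 y : ℂ) * w1 y) (fun y => (G1 y : ℂ)) w1 1 zero_le_one (cC cG1) hs.cw1 (fun y hy => by
    rw [norm_mul, one_mul])
  have t4 := csb (fun y => (G y : ℂ) * w y) (fun y => (Ef y : ℂ)) w 1 zero_le_one (cC hB.cE) hs.cw (fun y hy => by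
    rw [norm_mul, one_mul]
    have := GE y hy
    gcongr)
  have no := normKo hs
  have K4 := Kr4 hs
  have I2 := lin3 (T := fun y => (h y : ℂ) * w y * ((K * (lam - V b) : ℝ) : ℂ)) (A := fun y => (H y : ℂ) * w y)
    (B := fun y => ((h y - G y : ℝ) : ℂ) * (((V y - lam : ℝ) : ℂ) * w y))
    (C := fun y => (G y : ℂ) * ((V y - lam : ℝ) : ℂ) * w y) 1 (-(K:ℂ)) (-(K:ℂ))
    ((cC cH).mul hs.cw) ((cC (hB.ch.sub cG)).mul cN) ((cGc.mul csc).mul hs.cw) (fun y _ => by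
      rw [hH]; push_cast; ring)
  rw [intervalIntegral.integral_mul_const] at I2
  generalize (∫ y in (0:ℝ)..1, (h y : ℂ) * w y) = c at *
  generalize (∫ y in (0:ℝ)..1, (H y : ℂ) * w y) = J1 at *
  generalize (∫ y in (0:ℝ)..1, ((h y - G y : ℝ) : ℂ) * (((V y - lam : ℝ) : ℂ) * w y)) = J2 at *
  generalize (∫ y in (0:ℝ)..1, (G y : ℂ) * ((V y - lam : ℝ) : ℂ) * w y) = J3 at *
  generalize (∫ y in (0:ℝ)..1, (G y : ℂ) * (V2 y : ℂ) * φ y) = J4 at *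
  generalize (∫ y in (0:ℝ)..1, (G y : ℂ) * f y) = J5 at *
  generalize (∫ y in (0:ℝ)..1, (G1 y : ℂ) * w1 y) = J6 at *
  generalize (∫ y in (0:ℝ)..1, (G y : ℂ) * w y) = J7 at *
  generalize (∫ y in (0:ℝ)..1, ((h y - G y : ℝ) : ℂ) * w y) = J8 at *
  generalize nr (fun y => ((V y - lam : ℝ) : ℂ) * w y) = N at *
  have nG10 := nr_nonneg (fun y => (G1 y : ℂ))
  generalize nr (fun y => (G1 y : ℂ)) = NG1 at *
  generalize nr (fun y => (Ef y : ℂ)) = NE at *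
  have nbb := nr_nonneg (fun y => ((r / (d y + r ^ 2) : ℝ) : ℂ))
  generalize nr (fun y => ((r / (d y + r ^ 2) : ℝ) : ℂ)) = NB at *
  have n10 := nr_nonneg (fun _ => (1:ℂ))
  generalize nr (fun _ => (1:ℂ)) = N1 at *
  obtain ⟨F, hF⟩ : ∃ F, F = nr f / r := ⟨_, rfl⟩
  have hF0 : 0 ≤ F := by rw [hF]; positivity
  have hfF : nr f = r * F := by rw [hF]; field_simp
  obtain ⟨X, hX⟩ : ∃ X, X = r * nr w := ⟨_, rfl⟩
  obtain ⟨D, hD⟩ : ∃ D, D = r ^ 3 * nr w1 := ⟨_, rfl⟩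
  have hX0 : 0 ≤ X := by rw [hX]; positivity
  have hD0 : 0 ≤ D := by rw [hD]; positivity
  obtain ⟨S, hS⟩ : ∃ S, S = F + X + D := ⟨_, rfl⟩
  have hS0 : 0 ≤ S := by rw [hS]; positivity
  rw [hfF] at t2
  simp only [← hF, ← hX, ← hD] at P1 P2 SW ⊢
  simp only [← hS] at SW ⊢
  have hFS : F ≤ S := by linarith only [hS, hX0, hD0]
  have hXS : X ≤ S := by linarith only [hS, hF0, hD0]
  have hDS : D ≤ S := by linarith only [hS, hX0, hF0]
  have hM2 : 1 ≤ M ^ 2 := one_le_pow₀ hM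
  have hA : F + (2 + M ^ 2) * X + M * D ≤ 3 * M ^ 2 * S := by
    have a1 : F ≤ M ^ 2 * F := le_mul_of_one_le_left hF0 hM2
    have a2 : X ≤ M ^ 2 * X := le_mul_of_one_le_left hX0 hM2
    have a3 : M * D ≤ M ^ 2 * D := by gcongr; nlinarith only [hM]
    have a4 : 0 ≤ M ^ 2 * F := by positivity
    have a5 : 0 ≤ M ^ 2 * D := by positivity
    rw [hS]; linarith only [a1, a2, a3, a4, a5]
  generalize EE K φ φ1 = E at *
  -- powers
  have m17 : M ≤ M ^ 7 := le_self_pow₀ hM (by norm_num)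
  have m27 : M ^ 2 ≤ M ^ 7 := pow_le_pow_right₀ hM (by norm_num)
  have m37 : M ^ 3 ≤ M ^ 7 := pow_le_pow_right₀ hM (by norm_num)
  have m47 : M ^ 4 ≤ M ^ 7 := pow_le_pow_right₀ hM (by norm_num)
  have m67 : M ^ 6 ≤ M ^ 7 := pow_le_pow_right₀ hM (by norm_num)
  have m07 : 1 ≤ M ^ 7 := one_le_pow₀ hM
  -- J7 bound
  have B7 : ‖J7‖ ≤ 15 * (M ^ 7 * S) + 11275 * (M ^ 7 * E) := by
    refine P1.trans ?_
    have a1 : 2 * M * 1 * (F + (2 + M ^ 2) * X + M * D) ≤ 2 * M * 1 * (3 * M ^ 2 * S) := by gcongr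
    have a2 : 9 * M * D ≤ 9 * (M ^ 7 * S) := by
      calc 9 * M * D ≤ 9 * M ^ 7 * S := by gcongr
        _ = _ := by ring
    have a3 : M ^ 3 * S ≤ M ^ 7 * S := by gcongr
    have a4 : M ^ 6 * E ≤ M ^ 7 * E := by gcongr
    linarith only [a1, a2, a3, a4]
  have B8 : ‖J8‖ ≤ M ^ 7 * S := by
    refine U1.trans ?_
    calc r * (NB * nr w) ≤ r * (1 * nr w) := by gcongr
      _ = X := by rw [hX]; ring
      _ ≤ 1 * S := by linarith only [hXS]
      _ ≤ _ := by gcongr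
  have Bc : ‖c‖ ≤ 16 * (M ^ 7 * S) + 11275 * (M ^ 7 * E) := by
    rw [I1, one_mul, one_mul]
    refine (norm_add_le _ _).trans ?_
    linarith only [B7, B8]
  have B1 : ‖J1‖ ≤ 57 * (M ^ 7 * S) + 25625 * (M ^ 7 * E) := by
    refine P2.trans ?_
    have a1 : 2 * M * (8 * M) * (F + (2 + M ^ 2) * X + M * D) ≤ 2 * M * (8 * M) * (3 * M ^ 2 * S) := by gcongr
    have a2 : 9 * M ^ 2 * D ≤ 9 * (M ^ 7 * S) := by
      calc 9 * M ^ 2 * D ≤ 9 * M ^ 7 * S := by gcongr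
        _ = _ := by ring
    have a3 : M ^ 4 * S ≤ M ^ 7 * S := by gcongr
    linarith only [a1, a2, a3]
  have Kr2 := hs.hKr
  have B2 : K * ‖J2‖ ≤ M ^ 7 * E + 2 * (M ^ 7 * S) := by
    calc K * ‖J2‖ ≤ K * (r * (1 * (M * nr φ + 2 * M * (r * S)))) := by
          gcongr
          refine W1.trans ?_
          gcongr
      _ = r * M * (K * nr φ) + 2 * M * (K * r ^ 2) * S := by ring
      _ ≤ 1 * M * E + 2 * M * M * S := by
          gcongr; exact hs.hr1
      _ = M * E + 2 * (M ^ 2 * S) := by ring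
      _ ≤ _ := by gcongr
  have b4 : K * ‖J4‖ ≤ M ^ 7 * E := by
    calc K * ‖J4‖ ≤ K * (M * (1 * nr φ)) := by
          gcongr; exact t1.trans (by gcongr)
      _ = M * (K * nr φ) := by ring
      _ ≤ _ := by gcongr
  have b5 : K * ‖J5‖ ≤ M ^ 7 * S := by
    calc K * ‖J5‖ ≤ K * (1 * (NE * (r * F))) := by gcongr
      _ = (K * NE) * r * F := by ring
      _ ≤ √K * r * F := by gcongr
      _ = r * √K * F := by ring
      _ ≤ M * F := by gcongr
      _ ≤ _ := by gcongr
  have b6 : K * (r ^ 6 * ‖J6‖) ≤ 9 * (M ^ 7 * S) := by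
    calc K * (r ^ 6 * ‖J6‖) ≤ K * (r ^ 6 * (1 * (NG1 * nr w1))) := by gcongr
      _ = (K * r ^ 2) * (r * NG1) * D := by rw [hD]; ring
      _ ≤ M * (9 * M) * S := by gcongr
      _ = 9 * (M ^ 2 * S) := by ring
      _ ≤ _ := by gcongr
  have b7 : K * (‖Complex.I * ↑τ * ↑r ^ 6 * ↑K ^ 2 - o‖ * ‖J7‖) ≤ 2 * (M ^ 7 * S) := by
    calc K * (‖Complex.I * ↑τ * ↑r ^ 6 * ↑K ^ 2 - o‖ * ‖J7‖) ≤ K * ((r ^ 2 * (M ^ 2 + 1)) * (1 * (NE * nr w))) := by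
          gcongr
          refine no.trans ?_
          gcongr
      _ = (K * NE) * r * (M ^ 2 + 1) * X := by rw [hX]; ring
      _ ≤ √K * r * (M ^ 2 + 1) * X := by gcongr
      _ = r * √K * (M ^ 2 + 1) * X := by ring
      _ ≤ M * (2 * M ^ 2) * S := by gcongr; linarith only [hM2]
      _ = 2 * (M ^ 3 * S) := by ring
      _ ≤ _ := by gcongr
  have B3 : K * ‖J3‖ ≤ 12 * (M ^ 7 * S) + M ^ 7 * E := by
    have h6 : ‖Complex.I * ↑τ * ↑r ^ 6 * J6‖ = r ^ 6 * ‖J6‖ := by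
      have hτa : |τ| = 1 := by rcases hs.hτ with h | h <;> rw [h] <;> norm_num
      rw [norm_mul, norm_mul, norm_mul, norm_pow, nC, nC, Complex.norm_I, hτa, abs_of_pos hr]; ring
    have : ‖J3‖ ≤ ‖J4‖ + ‖J5‖ + r ^ 6 * ‖J6‖ + ‖Complex.I * ↑τ * ↑r ^ 6 * ↑K ^ 2 - o‖ * ‖J7‖ := by
      rw [T, ← h6, ← norm_mul]
      exact (norm_add_le _ _).trans (add_le_add_left ((norm_add_le _ _).trans (add_le_add_left (norm_add_le _ _) _)) _)
    calc K * ‖J3‖ ≤ K * (‖J4‖ + ‖J5‖ + r ^ 6 * ‖J6‖ + ‖Complex.I * ↑τ * ↑r ^ 6 * ↑K ^ 2 - o‖ * ‖J7‖) := by gcongr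
      _ = K * ‖J4‖ + K * ‖J5‖ + K * (r ^ 6 * ‖J6‖) + K * (‖Complex.I * ↑τ * ↑r ^ 6 * ↑K ^ 2 - o‖ * ‖J7‖) := by ring
      _ ≤ _ := by linarith only [b4, b5, b6, b7]
  have fin : K * |lam - V b| * ‖c‖ ≤ ‖J1‖ + K * ‖J2‖ + K * ‖J3‖ := by
    have h1 : K * |lam - V b| * ‖c‖ = ‖c * ((K * (lam - V b) : ℝ) : ℂ)‖ := by
      rw [norm_mul, nC, abs_mul, abs_of_pos hK0]; ring
    rw [h1, I2]
    refine (norm_add_le _ _).trans (add_le_add ((norm_add_le _ _).trans (add_le_add ?_ ?_)) ?_)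
    · rw [one_mul]
    · rw [norm_mul, norm_neg, nC, abs_of_pos hK0]
    · rw [norm_mul, norm_neg, nC, abs_of_pos hK0]
  have p1 : 0 ≤ M ^ 7 * S := by positivity
  have p2 : 0 ≤ M ^ 7 * E := by positivity
  linarith only [fin, Bc, B1, B2, B3, p1, p2]
end sol

lemma mkBd {K b b' s : ℝ} {d : ℝ → ℝ} (hK : 1 ≤ K) (ends : (b = 0 ∧ b' = 1) ∨ (b = 1 ∧ b' = 0))
    (hs : s = 1 ∨ s = -1) (hd : ∀ y ∈ Icc (0:ℝ) 1, d y = |y - b|) (db : d b = 0) (db' : d b' = 1)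
    (dd : ∀ y, HasDerivAt d s y) (h01 : (d 0 = 0 ∧ d 1 = 1 ∧ s = 1) ∨ (d 0 = 1 ∧ d 1 = 0 ∧ s = -1)) :
    Bd K b b' s d (fun y => Real.sinh (K * (1 - d y)) / Real.sinh K)
      (fun y => Real.cosh (K * (1 - d y)) * (K * (-s)) / Real.sinh K) (fun y => Real.exp (-(K * d y / 2))) := by
  have hK0 : 0 < K := by linarith
  have cd : Continuous d := continuous_iff_continuousAt.2 fun y => (dd y).continuousAt
  have hd0 : ∀ y ∈ Icc (0:ℝ) 1, 0 ≤ d y := fun y hy => by rw [hd y hy]; exact abs_nonneg _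
  have hd1 : ∀ y ∈ Icc (0:ℝ) 1, d y ≤ 1 := fun y hy => by
    rw [hd y hy, abs_le]
    rcases ends with ⟨h, _⟩ | ⟨h, _⟩ <;> rw [h] <;> constructor <;> linarith [hy.1, hy.2]
  have sK : 0 < Real.sinh K := Real.sinh_pos_iff.2 hK0
  have sK4 : Real.exp K ≤ 4 * Real.sinh K := by
    rw [Real.sinh_eq]
    have a1 : K + 1 ≤ Real.exp K := Real.add_one_le_exp K
    have a2 : Real.exp (-K) * Real.exp K = 1 := by rw [← Real.exp_add]; simp
    have a3 : 0 < Real.exp (-K) := Real.exp_pos _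
    nlinarith
  have U : ∀ y, Real.exp (-(K * d y / 2)) ^ 2 = Real.exp (-(K * d y)) := fun y => by
    rw [sq, ← Real.exp_add]; ring_nf
  have hu1 : ∀ y ∈ Icc (0:ℝ) 1, Real.exp (-(K * d y / 2)) ≤ 1 := fun y hy => by
    rw [Real.exp_le_one_iff]
    have := mul_nonneg hK0.le (hd0 y hy)
    linarith
  have hu2 : ∀ y ∈ Icc (0:ℝ) 1, Real.exp (-(K * d y)) ≤ Real.exp (-(K * d y / 2)) := fun y hy => by
    rw [Real.exp_le_exp]
    have := mul_nonneg hK0.le (hd0 y hy)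
    linarith
  have hu3 : ∀ y ∈ Icc (0:ℝ) 1, (K * d y) * Real.exp (-(K * d y)) ≤ 2 * Real.exp (-(K * d y / 2)) := fun y hy => by
    rw [← U]
    have a0 := mul_nonneg hK0.le (hd0 y hy)
    have a1 := Real.add_one_le_exp (K * d y / 2)
    have a2 : Real.exp (-(K * d y / 2)) * Real.exp (K * d y / 2) = 1 := by rw [← Real.exp_add]; simp
    have a3 : 0 < Real.exp (-(K * d y / 2)) := Real.exp_pos _
    have a4 : Real.exp (-(K * d y / 2)) * (K * d y / 2) ≤ 1 := by
      rw [← a2]; gcongr; linarith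
    have a5 : Real.exp (-(K * d y / 2)) * (Real.exp (-(K * d y / 2)) * (K * d y / 2)) ≤ Real.exp (-(K * d y / 2)) * 1 := by
      gcongr
    nlinarith only [a5]
  have Hh : ∀ y ∈ Icc (0:ℝ) 1, |Real.sinh (K * (1 - d y)) / Real.sinh K| ≤ Real.exp (-(K * d y)) := fun y hy => by
    have a0 := mul_nonneg hK0.le (hd0 y hy)
    have a1 : 0 ≤ Real.sinh (K * (1 - d y)) := Real.sinh_nonneg_iff.2 (mul_nonneg hK0.le (by linarith [hd1 y hy]))
    rw [abs_of_nonneg (div_nonneg a1 sK.le), div_le_iff₀ sK, Real.sinh_eq, Real.sinh_eq]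
    have e1 : Real.exp (K * (1 - d y)) = Real.exp (-(K * d y)) * Real.exp K := by rw [← Real.exp_add]; ring_nf
    have e2 : Real.exp (-(K * (1 - d y))) = Real.exp (K * d y) * Real.exp (-K) := by rw [← Real.exp_add]; ring_nf
    have e3 : Real.exp (-(K * d y)) * Real.exp (-K) ≤ Real.exp (K * d y) * Real.exp (-K) := by
      gcongr; linarith
    rw [e1, e2]; linarith
  have Hh1 : ∀ y ∈ Icc (0:ℝ) 1, |Real.cosh (K * (1 - d y)) * (K * (-s)) / Real.sinh K| ≤ 4 * K * Real.exp (-(K * d y)) := fun y hy => by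
    have a1 : 0 ≤ K * (1 - d y) := mul_nonneg hK0.le (by linarith [hd1 y hy])
    have s1 : |s| = 1 := by rcases hs with h | h <;> rw [h] <;> simp
    rw [abs_div, abs_mul, abs_mul, abs_neg, s1, abs_of_pos hK0, abs_of_pos sK, abs_of_pos (Real.cosh_pos _), mul_one,
      div_le_iff₀ sK]
    have e1 : Real.exp (K * (1 - d y)) = Real.exp (-(K * d y)) * Real.exp K := by rw [← Real.exp_add]; ring_nf
    have e2 : Real.cosh (K * (1 - d y)) ≤ Real.exp (K * (1 - d y)) := by
      rw [Real.cosh_eq]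
      have : Real.exp (-(K * (1 - d y))) ≤ Real.exp (K * (1 - d y)) := Real.exp_le_exp.2 (by linarith)
      linarith
    calc Real.cosh (K * (1 - d y)) * K ≤ (Real.exp (-(K * d y)) * Real.exp K) * K := by rw [← e1]; gcongr
      _ ≤ (Real.exp (-(K * d y)) * (4 * Real.sinh K)) * K := by gcongr
      _ = _ := by ring
  refine ⟨ends, hs, hd, db, dd, by simp [db'], ?_, ?_, ?_, ?_, fun y => (Real.exp_pos _).le, hu1, ?_, ?_, ?_, ?_, ?_⟩
  · exact ((Real.continuous_sinh.comp (continuous_const.mul (continuous_const.sub cd))).div_const _).continuousOn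
  · exact (((Real.continuous_cosh.comp (continuous_const.mul (continuous_const.sub cd))).mul continuous_const).div_const _).continuousOn
  · exact (Real.continuous_exp.comp ((continuous_const.mul cd).div_const _).neg).continuousOn
  · intro y _
    exact (((dd y).const_sub 1).const_mul K).sinh.div_const _
  · have e : ∀ y : ℝ, ‖((Real.exp (-(K * d y / 2)) : ℝ) : ℂ)‖ ^ 2 = Real.exp (-(K * d y)) := fun y => by
      rw [nC, sq_abs, U]
    have I := intervalIntegral.integral_eq_sub_of_hasDerivAt (a := 0) (b := 1)
      (f := fun y => -s * Real.exp (-(K * d y)) / K) (f' := fun y => Real.exp (-(K * d y))) (fun y hy => by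
        have := ((((dd y).const_mul K).neg.exp).const_mul (-s)).div_const K
        refine this.congr_deriv ?_
        have s2 : s * s = 1 := by rcases hs with h | h <;> rw [h] <;> norm_num
        show -s * (Real.exp (-(K * d y)) * -(K * s)) / K = Real.exp (-(K * d y))
        rw [show -s * (Real.exp (-(K * d y)) * -(K * s)) / K = Real.exp (-(K * d y)) * (s * s) by field_simp, s2, mul_one])
        ((show Continuous (fun y => Real.exp (-(K * d y))) by fun_prop).intervalIntegrable 0 1)
    have hN : nr (fun y => ((Real.exp (-(K * d y / 2)) : ℝ) : ℂ)) ^ 2 ≤ 1 / K := by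
      rw [nr_sq]; simp_rw [e]; rw [I]
      have p := Real.exp_pos (-K)
      have : 0 < Real.exp (-K) / K := by positivity
      rcases h01 with ⟨a, b, c⟩ | ⟨a, b, c⟩ <;> rw [a, b, c] <;> simp [neg_div] <;> linarith
    apply abs_le_of_sq_le_sq' _ zero_le_one |>.2
    rw [mul_pow, Real.sq_sqrt hK0.le]
    calc _ ≤ K * (1 / K) := by gcongr
      _ = 1 ^ 2 := by field_simp
  · intro y hy; exact (Hh y hy).trans (hu2 y hy)
  · intro y hy
    have := Hh1 y hy
    have a := hu2 y hy
    have b := Real.exp_pos (-(K * d y / 2))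
    calc _ ≤ 4 * K * Real.exp (-(K * d y)) := this
      _ ≤ 4 * K * Real.exp (-(K * d y / 2)) := by gcongr
      _ ≤ _ := by gcongr; norm_num
  · intro y hy
    have b := Real.exp_pos (-(K * d y / 2))
    have a0 := hd0 y hy
    calc K * (d y * |Real.sinh (K * (1 - d y)) / Real.sinh K|) ≤ K * (d y * Real.exp (-(K * d y))) := by
          have := Hh y hy; gcongr
      _ = K * d y * Real.exp (-(K * d y)) := by ring
      _ ≤ _ := hu3 y hy
      _ ≤ _ := by linarith
  · intro y hy
    have a0 := hd0 y hy
    calc d y * |Real.cosh (K * (1 - d y)) * (K * (-s)) / Real.sinh K| ≤ d y * (4 * K * Real.exp (-(K * d y))) := by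
          have := Hh1 y hy; gcongr
      _ = 4 * (K * d y * Real.exp (-(K * d y))) := by ring
      _ ≤ 4 * (2 * Real.exp (-(K * d y / 2))) := by have := hu3 y hy; gcongr
      _ = _ := by ring

lemma Bd0 {K : ℝ} (hK : 1 ≤ K) : Bd K 0 1 1 (fun y => y) (fun y => Real.sinh (K * (1 - y)) / Real.sinh K)
      (fun y => Real.cosh (K * (1 - y)) * (K * (-1)) / Real.sinh K) (fun y => Real.exp (-(K * y / 2))) :=
  mkBd hK (Or.inl ⟨rfl, rfl⟩) (Or.inl rfl) (fun y hy => by rw [sub_zero, abs_of_nonneg hy.1]) rfl rfl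
    (fun y => hasDerivAt_id y) (Or.inl ⟨rfl, rfl, rfl⟩)

lemma Bd1 {K : ℝ} (hK : 1 ≤ K) : Bd K 1 0 (-1) (fun y => 1 - y) (fun y => Real.sinh (K * (1 - (1 - y))) / Real.sinh K)
      (fun y => Real.cosh (K * (1 - (1 - y))) * (K * (- -1)) / Real.sinh K) (fun y => Real.exp (-(K * (1 - y) / 2))) :=
  mkBd hK (Or.inr ⟨rfl, rfl⟩) (Or.inr rfl) (fun y hy => by rw [abs_sub_comm, abs_of_nonneg (by linarith [hy.2])]) (by simp) (by simp)
    (fun y => (hasDerivAt_id y).const_sub 1) (Or.inr ⟨by simp, by simp, rfl⟩)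

lemma icc_ud : UniqueDiffOn ℝ (Icc (0:ℝ) 1) := uniqueDiffOn_Icc zero_lt_one

lemma dIR_cd {n : ℕ} {V : ℝ → ℝ} (h : ContDiffOn ℝ ((n + 1 : ℕ) : WithTop ℕ∞) V (Icc 0 1)) :
    ContDiffOn ℝ (n : WithTop ℕ∞) (dIR V) (Icc 0 1) :=
  h.derivWithin icc_ud (by norm_cast)

lemma dI_cd {n : ℕ} {V : ℝ → ℂ} (h : ContDiffOn ℝ ((n + 1 : ℕ) : WithTop ℕ∞) V (Icc 0 1)) :
    ContDiffOn ℝ (n : WithTop ℕ∞) (dI V) (Icc 0 1) :=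
  h.derivWithin icc_ud (by norm_cast)

lemma dIR_hd {n : ℕ} {V : ℝ → ℝ} (h : ContDiffOn ℝ ((n + 1 : ℕ) : WithTop ℕ∞) V (Icc 0 1)) :
    ∀ y ∈ Ioo (0:ℝ) 1, HasDerivAt V (dIR V y) y := fun y hy =>
  ((h.differentiableOn (by norm_cast) y (Ioo_subset_Icc_self hy)).hasDerivWithinAt).hasDerivAt
    (Icc_mem_nhds hy.1 hy.2)

lemma dI_hd {n : ℕ} {V : ℝ → ℂ} (h : ContDiffOn ℝ ((n + 1 : ℕ) : WithTop ℕ∞) V (Icc 0 1)) :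
    ∀ y ∈ Ioo (0:ℝ) 1, HasDerivAt V (dI V y) y := fun y hy =>
  ((h.differentiableOn (by norm_cast) y (Ioo_subset_Icc_self hy)).hasDerivWithinAt).hasDerivAt
    (Icc_mem_nhds hy.1 hy.2)

lemma bdd_of_cont {g : ℝ → ℝ} (h : ContinuousOn g (Icc 0 1)) : ∃ B, ∀ y ∈ Icc (0:ℝ) 1, |g y| ≤ B := by
  obtain ⟨B, hB⟩ := isCompact_Icc.exists_bound_of_continuousOn h
  exact ⟨B, fun y hy => by simpa using hB y hy⟩

lemma ext_Icc {E : Type*} [TopologicalSpace E] [T2Space E] {f g : ℝ → E} (hf : ContinuousOn f (Icc 0 1))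
    (hg : ContinuousOn g (Icc 0 1)) (h : ∀ y ∈ Ioo (0:ℝ) 1, f y = g y) : ∀ y ∈ Icc (0:ℝ) 1, f y = g y := by
  have : EqOn f g (Ioo 0 1) := h
  exact this.of_subset_closure hf hg Ioo_subset_Icc_self (by rw [closure_Ioo (by norm_num)])

lemma nonneg_Icc {g : ℝ → ℝ} (hg : ContinuousOn g (Icc 0 1)) (h : ∀ y ∈ Ioo (0:ℝ) 1, 0 < g y) :
    ∀ y ∈ Icc (0:ℝ) 1, 0 ≤ g y := fun y hy => by
  have := ext_Icc hg hg.abs (fun y hy => (abs_of_pos (h y hy)).symm) y hy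
  rw [this]; exact abs_nonneg _

lemma shearData {V : ℝ → ℝ} (hV : GoodShear V) : ∃ M : ℝ, Prof M V (dIR V) (dIR (dIR V)) (dIR (dIR (dIR V))) ∧
    supDV V ≤ M ∧ (∃ σ : ℝ, (σ = 1 ∨ σ = -1) ∧ ∀ y ∈ Icc (0:ℝ) 1, 0 ≤ σ * dIR (dIR V) y) ∧
    (∀ a : ℝ, 0 < a → ∃ c, 0 < c ∧ ∀ y ∈ Icc a (1-a), c ≤ |dIR (dIR V) y|) := by
  obtain ⟨h4, ⟨c0, hc0, hlo⟩, hsg⟩ := hV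
  have h4' : ContDiffOn ℝ ((3 + 1 : ℕ) : WithTop ℕ∞) V (Icc 0 1) := by exact_mod_cast h4
  have h3 : ContDiffOn ℝ ((2 + 1 : ℕ) : WithTop ℕ∞) (dIR V) (Icc 0 1) := dIR_cd h4'
  have h2 : ContDiffOn ℝ ((1 + 1 : ℕ) : WithTop ℕ∞) (dIR (dIR V)) (Icc 0 1) := dIR_cd h3
  have h1 : ContDiffOn ℝ ((1 : ℕ) : WithTop ℕ∞) (dIR (dIR (dIR V))) (Icc 0 1) := dIR_cd h2
  obtain ⟨B1, hB1⟩ := bdd_of_cont h3.continuousOn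
  obtain ⟨B2, hB2⟩ := bdd_of_cont h2.continuousOn
  obtain ⟨B3, hB3⟩ := bdd_of_cont h1.continuousOn
  obtain ⟨M, hM1, hMB1, hMB2, hMB3, hMc⟩ : ∃ M : ℝ, 1 ≤ M ∧ B1 ≤ M ∧ B2 ≤ M ∧ B3 ≤ M ∧ 1 / c0 ≤ M := by
    refine ⟨1 + |B1| + |B2| + |B3| + 1 / c0, ?_, ?_, ?_, ?_, ?_⟩ <;>
      linarith [abs_nonneg B1, abs_nonneg B2, abs_nonneg B3, le_abs_self B1, le_abs_self B2, le_abs_self B3,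
        one_div_pos.2 hc0]
  have hi : ∀ y ∈ Icc (0:ℝ) 1, dIR V y ≤ M := fun y hy => (le_abs_self _).trans ((hB1 y hy).trans hMB1)
  refine ⟨M, ⟨hM1, h4'.continuousOn, h3.continuousOn, h2.continuousOn, h1.continuousOn, dIR_hd h4', dIR_hd h3,
    dIR_hd h2, ?_, hi, fun y hy => (hB2 y hy).trans hMB2, fun y hy => (hB3 y hy).trans hMB3⟩, ?_, ?_, ?_⟩
  · intro y hy
    have a := hlo y hy
    have b : 1 ≤ M * c0 := by rwa [div_le_iff₀ hc0] at hMc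
    refine b.trans ?_
    gcongr
  · refine csSup_le ((nonempty_Icc.2 zero_le_one).image _) ?_
    rintro _ ⟨y, hy, rfl⟩
    exact hi y hy
  · rcases hsg with h | h
    · exact ⟨1, Or.inl rfl, fun y hy => by rw [one_mul]; exact nonneg_Icc h2.continuousOn h y hy⟩
    · exact ⟨-1, Or.inr rfl, fun y hy => by
        rw [neg_one_mul]
        exact nonneg_Icc h2.continuousOn.neg (fun z hz => by simpa using h z hz) y hy⟩
  · intro a ha
    have hne : ∀ y ∈ Icc a (1 - a), 0 < |dIR (dIR V) y| := fun y hy => by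
      have hy' : y ∈ Ioo (0:ℝ) 1 := ⟨by linarith [hy.1], by linarith [hy.2]⟩
      rw [abs_pos]
      rcases hsg with h | h
      · exact (h y hy').ne'
      · exact (h y hy').ne
    have hc : ContinuousOn (fun y => |dIR (dIR V) y|) (Icc a (1 - a)) :=
      (h2.continuousOn.mono (Icc_subset_Icc ha.le (by linarith))).abs
    by_cases he : (Icc a (1 - a)).Nonempty
    · obtain ⟨x, hx, hmin⟩ := isCompact_Icc.exists_isMinOn he hc
      exact ⟨_, hne x hx, fun y hy => hmin hy⟩
    · exact ⟨1, one_pos, fun y hy => (he ⟨y, hy⟩).elim⟩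

lemma L2_nr (F : ℝ → ℂ) : L2 F = nr F := by
  unfold L2 nr
  rw [intervalIntegral.integral_of_le zero_le_one, integral_Ioc_eq_integral_Ioo]

lemma sinh_abs_ratio (k x : ℝ) : Real.sinh (k * x) / Real.sinh k = Real.sinh (|k| * x) / Real.sinh |k| := by
  rcases abs_cases k with ⟨h, _⟩ | ⟨h, _⟩ <;> rw [h]
  rw [neg_mul, Real.sinh_neg, Real.sinh_neg, neg_div_neg_eq]

lemma coefA_eq (k : ℤ) (w : ℝ → ℂ) : coefA k w = ∫ y in (0:ℝ)..1,
    ((Real.sinh (|(k:ℝ)| * (1 - y)) / Real.sinh |(k : ℝ)| : ℝ) : ℂ) * w y := by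
  unfold coefA
  rw [intervalIntegral.integral_of_le zero_le_one, integral_Ioc_eq_integral_Ioo]
  simp_rw [sinh_abs_ratio (k:ℝ)]

lemma coefB_eq (k : ℤ) (w : ℝ → ℂ) : coefB k w = ∫ y in (0:ℝ)..1,
    ((Real.sinh (|(k:ℝ)| * (1 - (1 - y))) / Real.sinh |(k : ℝ)| : ℝ) : ℂ) * w y := by
  unfold coefB
  rw [intervalIntegral.integral_of_le zero_le_one, integral_Ioc_eq_integral_Ioo]
  simp_rw [sinh_abs_ratio (k:ℝ), sub_sub_cancel]

lemma rp6 {x : ℝ} (hx : 0 < x) : (x ^ ((1:ℝ)/6)) ^ 6 = x := by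
  rw [← Real.rpow_natCast, ← Real.rpow_mul hx.le]; norm_num

lemma scal {ν K : ℝ} (hν : 0 < ν) (hK : 0 < K) :
    ν ^ (-(1:ℝ)/6) * K ^ (-(5:ℝ)/6) = 1 / (K * (ν / K) ^ ((1:ℝ)/6)) := by
  rw [Real.div_rpow hν.le hK.le, eq_div_iff (by positivity)]
  have a : ν ^ (-(1:ℝ)/6) * ν ^ ((1:ℝ)/6) = 1 := by rw [← Real.rpow_add hν]; norm_num
  have b : K ^ (-(5:ℝ)/6) * K = K ^ ((1:ℝ)/6) := by
    nth_rewrite 2 [← Real.rpow_one K]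
    rw [← Real.rpow_add hK]; norm_num
  have c : 0 < K ^ ((1:ℝ)/6) := by positivity
  calc ν ^ (-(1:ℝ)/6) * K ^ (-(5:ℝ)/6) * (K * (ν ^ ((1:ℝ)/6) / K ^ ((1:ℝ)/6)))
      = (ν ^ (-(1:ℝ)/6) * ν ^ ((1:ℝ)/6)) * ((K ^ (-(5:ℝ)/6) * K) / K ^ ((1:ℝ)/6)) := by ring
    _ = 1 := by rw [a, b, div_self c.ne', one_mul]

lemma pw34 {x : ℝ} (hx : 0 ≤ x) : (1 + x) ^ ((3:ℝ)/4) ≤ 1 + x := by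
  have := Real.rpow_le_rpow_of_exponent_le (x := 1 + x) (by linarith) (show (3:ℝ)/4 ≤ 1 by norm_num)
  rwa [Real.rpow_one] at this

lemma mkSol {M ν lam e : ℝ} {k : ℤ} {o : ℂ} {V : ℝ → ℝ} {w φ F : ℝ → ℂ}
    (hp : Prof M V (dIR V) (dIR (dIR V)) (dIR (dIR (dIR V)))) (hsup : supDV V ≤ M)
    (hν : 0 < ν) (hν1 : ν ≤ 1) (hk : k ≠ 0) (hνk : ν * (k:ℝ) ^ 2 ≤ supDV V) (he : 0 ≤ e)
    (ho : ‖o‖ ≤ e * (ν * (k : ℝ) ^ 2) ^ ((1:ℝ)/3)) (cF : ContinuousOn F (Icc 0 1))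
    (h : OSNavier ν lam k o V w φ F) :
    ∃ τ, Sol M ((ν / |(k:ℝ)|) ^ ((1:ℝ)/6)) lam |(k:ℝ)| τ e V (dIR (dIR V)) (o / (Complex.I * k))
      w (dI w) (dI (dI w)) φ (dI φ) (fun y => F y / (Complex.I * k)) := by
  obtain ⟨hw, hφ, heq, hph, φ0, φ1, w0, w1⟩ := h
  have hw2 : ContDiffOn ℝ ((1 + 1 : ℕ) : WithTop ℕ∞) w (Icc 0 1) := by exact_mod_cast hw
  have hφ2 : ContDiffOn ℝ ((1 + 1 : ℕ) : WithTop ℕ∞) φ (Icc 0 1) := by exact_mod_cast hφ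
  have hw1 : ContDiffOn ℝ ((0 + 1 : ℕ) : WithTop ℕ∞) (dI w) (Icc 0 1) := dI_cd hw2
  have hφ1 : ContDiffOn ℝ ((0 + 1 : ℕ) : WithTop ℕ∞) (dI φ) (Icc 0 1) := dI_cd hφ2
  have cw2 : ContinuousOn (dI (dI w)) (Icc 0 1) := (dI_cd hw1).continuousOn
  have hkR : (k:ℝ) ≠ 0 := by exact_mod_cast hk
  have hkC : (k:ℂ) ≠ 0 := by exact_mod_cast hk
  have hIk : Complex.I * (k:ℂ) ≠ 0 := mul_ne_zero Complex.I_ne_zero hkC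
  have hK1 : 1 ≤ |(k:ℝ)| := by
    have := Int.one_le_abs hk
    exact_mod_cast this
  have hK0 : 0 < |(k:ℝ)| := by linarith
  have hM0 : 0 < M := by linarith [hp.hM]
  have hx : 0 < ν / |(k:ℝ)| := by positivity
  obtain ⟨r, hr⟩ : ∃ r, r = (ν / |(k:ℝ)|) ^ ((1:ℝ)/6) := ⟨_, rfl⟩
  have hr0 : 0 < r := by rw [hr]; positivity
  have hr6 : r ^ 6 = ν / |(k:ℝ)| := by rw [hr]; exact rp6 hx
  rw [← hr]
  have hr3 : (|(k:ℝ)| * r ^ 2) ^ 3 = ν * (k:ℝ) ^ 2 := by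
    have : (|(k:ℝ)| * r ^ 2) ^ 3 = |(k:ℝ)| ^ 3 * r ^ 6 := by ring
    rw [this, hr6, ← sq_abs (k:ℝ)]; field_simp
  have h13 : (ν * (k : ℝ) ^ 2) ^ ((1:ℝ)/3) = |(k:ℝ)| * r ^ 2 := by
    rw [← hr3, ← Real.rpow_natCast, ← Real.rpow_mul (by positivity)]; norm_num
  have nIk : ‖Complex.I * (k:ℂ)‖ = |(k:ℝ)| := by
    rw [norm_mul, Complex.norm_I, one_mul]; exact Complex.norm_intCast k
  have sqk : ((|(k:ℝ)| : ℝ) : ℂ) ^ 2 = (k:ℂ) ^ 2 := by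
    rw [← Complex.ofReal_pow, sq_abs]; push_cast; rfl
  refine ⟨(k:ℝ) / |(k:ℝ)|, hr0, ?_, hK1, ?_, ?_, he, ?_, hw2.continuousOn, hw1.continuousOn, cw2, hφ2.continuousOn,
    hφ1.continuousOn, cF.div_const _, dI_hd hw2, dI_hd hw1, dI_hd hφ2, ?_, φ0, φ1, w0, w1, ?_⟩
  · by_contra hc
    push Not at hc
    have a1 : 1 < r ^ 6 := one_lt_pow₀ hc (by norm_num)
    have a2 : ν / |(k:ℝ)| ≤ 1 := by rw [div_le_one hK0]; linarith
    linarith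
  · have a1 : (|(k:ℝ)| * r ^ 2) ^ 3 ≤ M ^ 3 := by
      rw [hr3]
      exact hνk.trans (hsup.trans (le_self_pow₀ hp.hM (by norm_num)))
    exact le_of_pow_le_pow_left₀ (by norm_num) hM0.le a1
  · rcases abs_cases (k:ℝ) with ⟨h, _⟩ | ⟨h, _⟩ <;> rw [h]
    · left; field_simp
    · right; field_simp
  · rw [norm_div, nIk, div_le_iff₀ hK0]
    rw [h13] at ho
    linarith
  · intro y hy
    have := dI_hd hφ1 y hy
    refine this.congr_deriv ?_
    rw [sqk]
    linear_combination hph y hy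
  · have hKC : ((|(k:ℝ)| : ℝ) : ℂ) ≠ 0 := by exact_mod_cast hK0.ne'
    refine ext_Icc ?_ (cF.div_const _) ?_
    · have c1 : ContinuousOn (fun y => ((V y - lam : ℝ) : ℂ)) (Icc 0 1) :=
        Complex.continuous_ofReal.comp_continuousOn (hp.cV.sub continuousOn_const)
      have c2 : ContinuousOn (fun y => ((dIR (dIR V) y : ℝ) : ℂ)) (Icc 0 1) :=
        Complex.continuous_ofReal.comp_continuousOn hp.cV2
      have cw := hw2.continuousOn
      exact (((c1.mul cw).sub (c2.mul hφ2.continuousOn)).add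
        (continuousOn_const.mul (cw2.sub (continuousOn_const.mul cw)))).add (continuousOn_const.mul cw)
    · intro y hy
      have E := heq y hy
      rw [eq_div_iff hIk, sqk, ← Complex.ofReal_pow, hr6, ← E]
      push_cast
      have s2 : ((|(k:ℝ)| : ℝ) : ℂ) * ((|(k:ℝ)| : ℝ) : ℂ) = (k:ℂ) * k := by linear_combination sqk
      have s3 : (k:ℂ) / ((|(k:ℝ)| : ℝ) : ℂ) * ((ν:ℂ) / ((|(k:ℝ)| : ℝ) : ℂ)) * k = ν := by
        field_simp
        linear_combination -(ν:ℂ) * sqk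
      have s4 : o / (Complex.I * k) * (Complex.I * k) = o := div_mul_cancel₀ _ hIk
      linear_combination (dI (dI w) y - (k:ℂ) ^ 2 * w y) * (Complex.I ^ 2 * s3 + ν * Complex.I_sq) + w y * s4

/-- Refined coefficient estimate (Lemma 2.4, estimate (2.25)): `L²` forcing. -/
theorem stmt_7 (V : ℝ → ℝ) (hV : GoodShear V) :
    ∃ C ν₀ ε₁ : ℝ, 0 < C ∧ 0 < ν₀ ∧ 0 < ε₁ ∧
      ∀ (ν lam : ℝ) (k : ℤ) (o : ℂ) (wNa φNa F : ℝ → ℂ),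
        0 < ν → ν ≤ ν₀ → k ≠ 0 →
        ν * (k : ℝ) ^ 2 ≤ supDV V →
        ‖o‖ ≤ ε₁ * (ν * (k : ℝ) ^ 2) ^ ((1:ℝ)/3) →
        ContinuousOn F (Set.Icc 0 1) →
        OSNavier ν lam k o V wNa φNa F →
        (1 + |(k : ℝ) * (lam - V 0)|) ^ ((3:ℝ)/4) * ‖coefA k wNa‖
            + (1 + |(k : ℝ) * (lam - V 1)|) ^ ((3:ℝ)/4) * ‖coefB k wNa‖
          ≤ C * ν ^ (-(1:ℝ)/6) * (|k| : ℝ) ^ (-(5:ℝ)/6) * L2 F := by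
  obtain ⟨M, hp, hsup, ⟨σ, hσ, hσV⟩, hc⟩ := shearData hV
  obtain ⟨C, r₀, e₀, hC, hr₀, he₀, he₁, H⟩ := closeAll hp hc hσ hσV
  have hM0 : 0 < M := by linarith [hp.hM]
  refine ⟨2 * (40000 * M ^ 7 * C), (min r₀ 1) ^ 6, e₀, by positivity, by positivity, he₀, ?_⟩
  intro ν lam k o w φ F hν hν0 hk hνk ho cF hOS
  have hm1 : min r₀ 1 ≤ 1 := min_le_right _ _
  have hm0 : 0 < min r₀ 1 := by positivity
  have hν1 : ν ≤ 1 := hν0.trans (pow_le_one₀ hm0.le hm1)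
  obtain ⟨τ, hs⟩ := mkSol hp hsup hν hν1 hk hνk he₀.le ho cF hOS
  have hK1 := hs.hK
  have hK0 : 0 < |(k:ℝ)| := by linarith
  have hx : 0 < ν / |(k:ℝ)| := by positivity
  have hr6 := rp6 hx
  have hsc := scal hν hK0
  have nF : nr (fun y => F y / (Complex.I * k)) ≤ 1 / |(k:ℝ)| * nr F := by
    refine nr_le _ F _ (by positivity) hs.cf cF (fun y _ => ?_)
    rw [norm_div, norm_mul, Complex.norm_I, one_mul, Complex.norm_intCast]
    exact le_of_eq (by ring)
  have hrle : (ν / |(k:ℝ)|) ^ ((1:ℝ)/6) ≤ r₀ := by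
    refine (le_of_pow_le_pow_left₀ (n := 6) (by norm_num) hm0.le ?_).trans (min_le_left r₀ 1)
    rw [hr6]
    exact (div_le_self hν.le hK1).trans hν0
  have H1 := H _ _ _ _ _ _ _ _ _ _ _ _ hs hrle le_rfl
  have A := coefBound hp hs he₁ (Bd0 hK1)
  have B := coefBound hp hs he₁ (Bd1 hK1)
  rw [← coefA_eq] at A
  rw [← coefB_eq] at B
  have hr0 := hs.hr
  have hE : EE |(k:ℝ)| φ (dI φ) ≤ √|(k:ℝ)| * EE |(k:ℝ)| φ (dI φ) :=
    le_mul_of_one_le_left (EE_nonneg _ _ _) (Real.one_le_sqrt.2 hK1)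
  generalize (ν / |(k:ℝ)|) ^ ((1:ℝ)/6) = r at *
  have hfin : nr (fun y => F y / (Complex.I * k)) / r ≤ ν ^ (-(1:ℝ)/6) * |(k:ℝ)| ^ (-(5:ℝ)/6) * L2 F := by
    rw [hsc, L2_nr, div_le_iff₀ hr0]
    refine nF.trans (le_of_eq ?_)
    field_simp
  have key : ∀ b : ℝ, ∀ c : ℂ, (1 + |(k:ℝ)| * |lam - V b|) * ‖c‖ ≤ 40000 * M ^ 7 *
      (nr (fun y => F y / (Complex.I * k)) / r + r * nr w + r ^ 3 * nr (dI w) + EE |(k:ℝ)| φ (dI φ)) →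
      (1 + |(k : ℝ) * (lam - V b)|) ^ ((3:ℝ)/4) * ‖c‖ ≤
        40000 * M ^ 7 * C * (ν ^ (-(1:ℝ)/6) * |(k:ℝ)| ^ (-(5:ℝ)/6) * L2 F) := by
    intro b c hb
    calc (1 + |(k : ℝ) * (lam - V b)|) ^ ((3:ℝ)/4) * ‖c‖ ≤ (1 + |(k:ℝ)| * |lam - V b|) * ‖c‖ := by
          rw [abs_mul]
          exact mul_le_mul_of_nonneg_right (pw34 (by positivity)) (norm_nonneg _)
      _ ≤ _ := hb
      _ ≤ 40000 * M ^ 7 * (C * (nr (fun y => F y / (Complex.I * k)) / r)) := by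
          refine mul_le_mul_of_nonneg_left ?_ (by positivity)
          linarith only [H1, hE]
      _ ≤ 40000 * M ^ 7 * (C * (ν ^ (-(1:ℝ)/6) * |(k:ℝ)| ^ (-(5:ℝ)/6) * L2 F)) := by
          refine mul_le_mul_of_nonneg_left (mul_le_mul_of_nonneg_left hfin hC.le) (by positivity)
      _ = _ := by ring
  have kA := key 0 _ A
  have kB := key 1 _ B
  linarith only [kA, kB]
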